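/- Let ω ∈ 𝒲 with associated functions φ and τ, and let g ∈ L²_ω. The following are equivalent: (1) the Hankel operator H_g extends to a bounded operator from A²_ω to L²_ω; (2) for some δ ∈ (0, m_τ) the function F_δ is bounded on 𝔻, i.e. sup_{z∈𝔻} F_δ(z) < ∞; (3) g admits a decomposition g = g₁ + g₂ where g₂ ∈ C¹(𝔻) with ∂̄g₂/(Δφ)^{1/2} ∈ L^∞(𝔻), while g₁ satisfies sup_{z∈𝔻} (1/|D(δτ(z))|) ∫_{D(δτ(z))} |g₁|² dA < ∞ for some δ ∈ (0, m_τ). -/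

import Mathlib

open MeasureTheory Filter Set
open scoped ENNReal ComplexOrder

noncomputable section

/-- The open unit disc in `ℂ`. -/
def unitDisc : Set ℂ := Metric.ball (0 : ℂ) 1

/-- Normalized area Lebesgue measure `dA = dx dy / π` on `ℂ`. -/
def dA : Measure ℂ := (ENNReal.ofReal Real.pi)⁻¹ • (volume : Measure ℂ)

/-- The weighted measure `ω dA` on the unit disc. -/
def muW (ω : ℂ → ℝ) : Measure ℂ :=
  (dA.restrict unitDisc).withDensity fun z => ENNReal.ofReal (ω z)

/-- The radial extension to `𝔻` of a function of `r ∈ [0,1)`. -/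
def radialize (τ : ℝ → ℝ) : ℂ → ℝ := fun z => τ ‖z‖

/-- The class `𝓛`, with constants `c₁, c₂`. -/
structure IsClassL (τC : ℂ → ℝ) (c₁ c₂ : ℝ) : Prop where
  c₁_pos : 0 < c₁
  c₂_pos : 0 < c₂
  pos : ∀ z ∈ unitDisc, 0 < τC z
  upper : ∀ z ∈ unitDisc, τC z ≤ c₁ * (1 - ‖z‖)
  lip : ∀ z ∈ unitDisc, ∀ ζ ∈ unitDisc, |τC z - τC ζ| ≤ c₂ * ‖z - ζ‖

/-- `m_τ = min(1, c₁⁻¹, c₂⁻¹)/4`. -/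
def mTau (c₁ c₂ : ℝ) : ℝ := min 1 (min c₁⁻¹ c₂⁻¹) / 4

/-- The Laplacian `Δφ = φ_xx + φ_yy` of a function `φ : ℂ → ℝ`. -/
def laplacian (φ : ℂ → ℝ) (z : ℂ) : ℝ :=
  fderiv ℝ (fun w => fderiv ℝ φ w 1) z 1 +
    fderiv ℝ (fun w => fderiv ℝ φ w Complex.I) z Complex.I

/-- The Wirtinger derivative `∂̄g = (g_x + i g_y)/2` of `g : ℂ → ℂ`. -/
def dbar (g : ℂ → ℂ) (z : ℂ) : ℂ :=
  (fderiv ℝ g z 1 + Complex.I * fderiv ℝ g z Complex.I) / 2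

/-- The class `𝒲` of weights `ω = e^{-2φ}` with associated radial profile `τ`. -/
structure IsClassW (ω φ : ℂ → ℝ) (τ : ℝ → ℝ) : Prop where
  pos : ∀ z ∈ unitDisc, 0 < ω z
  omega_eq : ∀ z ∈ unitDisc, ω z = Real.exp (-(2 * φ z))
  integrable : ∫⁻ z in unitDisc, ENNReal.ofReal (ω z) ∂dA < ⊤
  radial : ∀ z ∈ unitDisc, ∀ ζ ∈ unitDisc, ‖z‖ = ‖ζ‖ → φ z = φ ζ
  smooth : ContDiffOn ℝ 2 φ unitDisc
  lap_pos : ∀ z ∈ unitDisc, 0 < laplacian φ z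
  tau_pos : ∀ r ∈ Set.Ico (0 : ℝ) 1, 0 < τ r
  tau_anti : AntitoneOn τ (Set.Ico 0 1)
  tau_lim : Tendsto τ (nhdsWithin 1 (Set.Iio 1)) (nhds 0)
  tau_diff : ∀ r ∈ Set.Ico (0 : ℝ) 1, DifferentiableAt ℝ τ r
  tau_deriv_lim : Tendsto (deriv τ) (nhdsWithin 1 (Set.Iio 1)) (nhds 0)
  comp : ∃ C : ℝ, 1 ≤ C ∧ ∀ z ∈ unitDisc,
    τ ‖z‖ / C ≤ (laplacian φ z) ^ (-(1 / 2 : ℝ)) ∧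
      (laplacian φ z) ^ (-(1 / 2 : ℝ)) ≤ C * τ ‖z‖
  extra : (∃ C > (0 : ℝ), ∃ r₀ ∈ Set.Ico (0 : ℝ) 1,
      MonotoneOn (fun r => τ r * (1 - r) ^ C) (Set.Ico r₀ 1)) ∨
    Tendsto (fun r => deriv τ r * Real.log (1 / τ r)) (nhdsWithin 1 (Set.Iio 1)) (nhds 0)

/-- A `(δ,τ)`-lattice of the unit disc. -/
structure IsLattice (τC : ℂ → ℝ) (δ : ℝ) (z : ℕ → ℂ) : Prop where
  mem : ∀ j, z j ∈ unitDisc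
  sep : ∀ j k, j ≠ k → z j ∉ Metric.ball (z k) (δ * τC (z k))
  covers : ∀ w ∈ unitDisc, ∃ j, w ∈ Metric.ball (z j) (δ * τC (z j))
  mult : ∃ N : ℕ, ∀ w ∈ unitDisc,
    ({j : ℕ | w ∈ Metric.ball (z j) (3 * (δ * τC (z j)))}).ncard ≤ N

/-- The distance `d_τ(z,ζ) = |z-ζ| / min(τ(z),τ(ζ))`. -/
def dTau (τC : ℂ → ℝ) (z ζ : ℂ) : ℝ := ‖z - ζ‖ / min (τC z) (τC ζ)

/-- `(1/|D(δτ(z))|) ∫_{D(δτ(z))} |u|² dA`, valued in `ℝ≥0∞`. -/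
def localMeanE (τC : ℂ → ℝ) (δ : ℝ) (u : ℂ → ℂ) (z : ℂ) : ℝ≥0∞ :=
  (ENNReal.ofReal ((δ * τC z) ^ 2))⁻¹ *
    ∫⁻ w in Metric.ball z (δ * τC z), ENNReal.ofReal (‖u w‖ ^ 2) ∂dA

/-- `F_δ(z)² = inf over h analytic in D(δτ(z)) of the mean square of g - h`. -/
def FdeltaSqE (τC : ℂ → ℝ) (δ : ℝ) (g : ℂ → ℂ) (z : ℂ) : ℝ≥0∞ :=
  ⨅ (h : ℂ → ℂ) (_ : DifferentiableOn ℂ h (Metric.ball z (δ * τC z))),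
    localMeanE τC δ (fun w => g w - h w) z

/-- The submodule of `L²_ω` of elements with a representative analytic on `𝔻`. -/
def bergmanSubmodule (ω : ℂ → ℝ) : Submodule ℂ (Lp ℂ 2 (muW ω)) where
  carrier := {f | ∃ F : ℂ → ℂ, DifferentiableOn ℂ F unitDisc ∧ (f : ℂ → ℂ) =ᵐ[muW ω] F}
  zero_mem' := ⟨0, differentiableOn_const 0, Lp.coeFn_zero ℂ 2 (muW ω)⟩
  add_mem' := by
    rintro a b ⟨F, hF, ha⟩ ⟨G, hG, hb⟩
    refine ⟨F + G, hF.add hG, ?_⟩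
    filter_upwards [Lp.coeFn_add a b, ha, hb] with w h1 h2 h3
    rw [h1]; simp only [Pi.add_apply, h2, h3]
  smul_mem' := by
    rintro c a ⟨F, hF, ha⟩
    refine ⟨c • F, hF.const_smul c, ?_⟩
    filter_upwards [Lp.coeFn_smul c a, ha] with w h1 h2
    rw [h1]; simp only [Pi.smul_apply, h2]

/-- The Bergman space `A²_ω`, a closed subspace of `L²_ω`. -/
def bergmanH (ω : ℂ → ℝ) : Submodule ℂ (Lp ℂ 2 (muW ω)) :=
  (bergmanSubmodule ω).topologicalClosure

instance (ω : ℂ → ℝ) : CompleteSpace (bergmanH ω) :=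
  IsComplete.completeSpace_coe (IsClosed.isComplete (Submodule.isClosed_topologicalClosure _))

/-- The orthogonal (Bergman) projection of `L²_ω` onto `A²_ω`, valued in `A²_ω`. -/
def bergmanProjA (ω : ℂ → ℝ) : Lp ℂ 2 (muW ω) →L[ℂ] bergmanH ω :=
  Submodule.orthogonalProjectionOnto (bergmanH ω)

/-- The Bergman projection `P`, viewed as an operator of `L²_ω`. -/
def bergmanProj (ω : ℂ → ℝ) : Lp ℂ 2 (muW ω) →L[ℂ] Lp ℂ 2 (muW ω) :=
  (bergmanH ω).subtypeL.comp (bergmanProjA ω)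

/-- `T` is a bounded extension of the Hankel operator `H_g : f ↦ g f - P(g f)`,
defined on the bounded analytic functions `f ∈ H^∞`. -/
def IsHankelExtension (ω : ℂ → ℝ) (g : ℂ → ℂ)
    (T : bergmanH ω →L[ℂ] Lp ℂ 2 (muW ω)) : Prop :=
  ∀ (f : bergmanH ω) (F : ℂ → ℂ) (M : ℝ),
    DifferentiableOn ℂ F unitDisc →
    (∀ z ∈ unitDisc, ‖F z‖ ≤ M) →
    ((f : Lp ℂ 2 (muW ω)) : ℂ → ℂ) =ᵐ[muW ω] F →
    ∀ gF : Lp ℂ 2 (muW ω), ((gF : ℂ → ℂ) =ᵐ[muW ω] fun z => g z * F z) →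
    T f = gF - bergmanProj ω gF

/-- The `ν`-th singular number `s_ν(T) = inf{‖T - K‖ : rank K ≤ ν}`, `ν = 0, 1, 2, …`. -/
def singularNumber {E F : Type*} [NormedAddCommGroup E] [NormedSpace ℂ E]
    [NormedAddCommGroup F] [NormedSpace ℂ F] (T : E →L[ℂ] F) (ν : ℕ) : ℝ :=
  sInf {c : ℝ | ∃ K : E →L[ℂ] F,
    Module.rank ℂ (LinearMap.range (K : E →ₗ[ℂ] F)) ≤ (ν : Cardinal) ∧ c = ‖T - K‖}

/-- `‖T‖_{S^p}^p = ∑_ν s_ν(T)^p`. -/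
def schattenSum (p : ℝ) {E F : Type*} [NormedAddCommGroup E] [NormedSpace ℂ E]
    [NormedAddCommGroup F] [NormedSpace ℂ F] (T : E →L[ℂ] F) : ℝ :=
  ∑' ν : ℕ, singularNumber T ν ^ p

/-- Membership in the Schatten class `S^p`: `∑_ν s_ν(T)^p < ∞`. -/
def MemSchatten (p : ℝ) {E F : Type*} [NormedAddCommGroup E] [NormedSpace ℂ E]
    [NormedAddCommGroup F] [NormedSpace ℂ F] (T : E →L[ℂ] F) : Prop :=
  Summable fun ν : ℕ => singularNumber T ν ^ p

/-- A bounded operator has finite rank. -/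
def FiniteRank {E F : Type*} [NormedAddCommGroup E] [NormedSpace ℂ E]
    [NormedAddCommGroup F] [NormedSpace ℂ F] (T : E →L[ℂ] F) : Prop :=
  Module.rank ℂ (LinearMap.range (T : E →ₗ[ℂ] F)) < Cardinal.aleph0

/-- The decay estimate `|F(z)| ω(z)^{1/2} ≲ min(1, min(τ(α),τ(z))/|z-α|)^{3n}` on `𝔻`. -/
def TestDecay (τC ω : ℂ → ℝ) (C₀ : ℝ) (n : ℕ) (α : ℂ) (F : ℂ → ℂ) : Prop :=
  (∀ z ∈ unitDisc, ‖F z‖ * Real.sqrt (ω z) ≤ C₀) ∧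
    ∀ z ∈ unitDisc, z ≠ α → ‖F z‖ * Real.sqrt (ω z) ≤
      C₀ * (min (τC α) (τC z) / ‖z - α‖) ^ (3 * n)

/-- Multiplication of an `L²_ω` element by the indicator of a measurable set `D`. -/
def indLp (ω : ℂ → ℝ) (D : Set ℂ) (hD : MeasurableSet D) (f : Lp ℂ 2 (muW ω)) :
    Lp ℂ 2 (muW ω) :=
  MemLp.toLp (D.indicator f) ((Lp.memLp f).indicator hD)

/-- The subspace of `L²_ω` of elements vanishing a.e. off `D` with a representative
analytic on `D`;  its closure realizes `A²_ω(D)` inside `L²_ω`. -/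
def localBergmanSub (ω : ℂ → ℝ) (D : Set ℂ) : Submodule ℂ (Lp ℂ 2 (muW ω)) where
  carrier := {f | ((f : ℂ → ℂ) =ᵐ[(muW ω).restrict Dᶜ] 0) ∧
    ∃ h : ℂ → ℂ, DifferentiableOn ℂ h D ∧ (f : ℂ → ℂ) =ᵐ[(muW ω).restrict D] h}
  zero_mem' := by
    refine ⟨ae_restrict_of_ae (Lp.coeFn_zero ℂ 2 (muW ω)), 0, differentiableOn_const 0,
      ae_restrict_of_ae (Lp.coeFn_zero ℂ 2 (muW ω))⟩
  add_mem' := by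
    rintro a b ⟨ha0, F, hF, ha⟩ ⟨hb0, G, hG, hb⟩
    refine ⟨?_, F + G, hF.add hG, ?_⟩
    · filter_upwards [ae_restrict_of_ae (Lp.coeFn_add a b), ha0, hb0] with w h1 h2 h3
      rw [h1]; simp only [Pi.add_apply, h2, h3, Pi.zero_apply, add_zero]
    · filter_upwards [ae_restrict_of_ae (Lp.coeFn_add a b), ha, hb] with w h1 h2 h3
      rw [h1]; simp only [Pi.add_apply, h2, h3]
  smul_mem' := by
    rintro c a ⟨ha0, F, hF, ha⟩
    refine ⟨?_, c • F, hF.const_smul c, ?_⟩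
    · filter_upwards [ae_restrict_of_ae (Lp.coeFn_smul c a), ha0] with w h1 h2
      rw [h1]; simp only [Pi.smul_apply, h2, Pi.zero_apply, smul_zero]
    · filter_upwards [ae_restrict_of_ae (Lp.coeFn_smul c a), ha] with w h1 h2
      rw [h1]; simp only [Pi.smul_apply, h2]

instance (ω : ℂ → ℝ) (D : Set ℂ) :
    CompleteSpace ((localBergmanSub ω D).topologicalClosure) :=
  IsComplete.completeSpace_coe (IsClosed.isComplete (Submodule.isClosed_topologicalClosure _))

/-- The local projection `P_{α,δ}` (for `D = D(δτ(α))`), extended by zero off `D`,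
viewed as an operator of `L²_ω`. -/
def localProj (ω : ℂ → ℝ) (D : Set ℂ) : Lp ℂ 2 (muW ω) →L[ℂ] Lp ℂ 2 (muW ω) :=
  ((localBergmanSub ω D).topologicalClosure).subtypeL.comp
    (Submodule.orthogonalProjectionOnto ((localBergmanSub ω D).topologicalClosure))

/-- Integration by parts with a compactly supported factor. -/
lemma ibp_real {f g : ℂ → ℝ} (hf : ContDiff ℝ 1 f) (hg : ContDiff ℝ 1 g)
    (hc : HasCompactSupport g) (v : ℂ) :
    ∫ z, f z * fderiv ℝ g z v = - ∫ z, fderiv ℝ f z v * g z := by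
  have hf' : Continuous (fun z => fderiv ℝ f z v) :=
    (hf.continuous_fderiv one_ne_zero).clm_apply continuous_const
  have hg' : Continuous (fun z => fderiv ℝ g z v) :=
    (hg.continuous_fderiv one_ne_zero).clm_apply continuous_const
  have hcg' : HasCompactSupport (fun z => fderiv ℝ g z v) := hc.fderiv_apply ℝ v
  apply integral_mul_fderiv_eq_neg_fderiv_mul_of_integrable
  · exact (hf'.mul hg.continuous).integrable_of_hasCompactSupport hc.mul_left
  · exact (hf.continuous.mul hg').integrable_of_hasCompactSupport hcg'.mul_left
  · exact (hf.continuous.mul hg.continuous).integrable_of_hasCompactSupport hc.mul_left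
  · intro x _; exact hf.differentiable one_ne_zero x
  · intro x _; exact hg.differentiable one_ne_zero x

lemma contDiff_fderiv_apply' {f : ℂ → ℝ} (hf : ContDiff ℝ 2 f) (v : ℂ) :
    ContDiff ℝ 1 (fun z => fderiv ℝ f z v) :=
  (hf.fderiv_right (m := 1) (by norm_num)).clm_apply contDiff_const

lemma jac_integral_zero {u v : ℂ → ℝ} (hu : ContDiff ℝ 2 u) (hv : ContDiff ℝ 2 v)
    (hc : HasCompactSupport v) :
    ∫ z, (fderiv ℝ v z 1 * fderiv ℝ u z Complex.I - fderiv ℝ u z 1 * fderiv ℝ v z Complex.I) = 0 := by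
  have h1 := ibp_real (contDiff_fderiv_apply' hu Complex.I) (hv.of_le (by norm_num)) hc 1
  have h2 := ibp_real (contDiff_fderiv_apply' hu 1) (hv.of_le (by norm_num)) hc Complex.I
  have hsymm : ∀ z, fderiv ℝ (fun w => fderiv ℝ u w Complex.I) z 1 =
      fderiv ℝ (fun w => fderiv ℝ u w 1) z Complex.I := by
    intro z
    have hd : DifferentiableAt ℝ (fderiv ℝ u) z :=
      (hu.fderiv_right (m := 1) (by norm_num)).differentiable one_ne_zero z
    rw [fderiv_clm_apply hd (by fun_prop), fderiv_clm_apply hd (by fun_prop)]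
    have := (hu.contDiffAt (x := z)).isSymmSndFDerivAt (by simp)
    simpa using this 1 Complex.I
  have hu' : ∀ w, Continuous (fun z => fderiv ℝ u z w) := fun w =>
    (contDiff_fderiv_apply' hu w).continuous
  have hv' : ∀ w, Continuous (fun z => fderiv ℝ v z w) := fun w =>
    (contDiff_fderiv_apply' hv w).continuous
  have hcv' : ∀ w, HasCompactSupport (fun z => fderiv ℝ v z w) := fun w => hc.fderiv_apply ℝ w
  rw [integral_sub]
  · simp_rw [mul_comm (fderiv ℝ v _ 1)]
    rw [h1, h2]
    simp_rw [hsymm]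
    ring
  · exact ((hv' 1).mul (hu' _)).integrable_of_hasCompactSupport (hcv' 1).mul_right
  · exact ((hu' 1).mul (hv' _)).integrable_of_hasCompactSupport (hcv' _).mul_left

/-- The basic (dual Hörmander) inequality, global version. -/
lemma basic_ineq {θ : ℂ → ℝ} {η : ℂ → ℂ} (hθ : ContDiff ℝ 2 θ) (hη : ContDiff ℝ 2 η)
    (hc : HasCompactSupport η) :
    (1/2) * ∫ z, laplacian θ z * (Real.exp (2 * θ z) * ‖η z‖ ^ 2) ≤
      ∫ z, Real.exp (2 * θ z) * ‖dbar η z‖ ^ 2 := by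
  set β : ℂ → ℂ := fun z => (Real.exp (θ z) : ℂ) * η z with hβ
  have hexp : ContDiff ℝ 2 (fun z => (Real.exp (θ z) : ℂ)) :=
    Complex.ofRealCLM.contDiff.comp (Real.contDiff_exp.comp hθ)
  have hβs : ContDiff ℝ 2 β := hexp.mul hη
  have hβc : HasCompactSupport β := hc.mul_left
  set u : ℂ → ℝ := fun z => (β z).re with hu
  set v : ℂ → ℝ := fun z => (β z).im with hv
  have hus : ContDiff ℝ 2 u := Complex.reCLM.contDiff.comp hβs
  have hvs : ContDiff ℝ 2 v := Complex.imCLM.contDiff.comp hβs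
  have huc : HasCompactSupport u := hβc.comp_left (g := Complex.re) (by simp)
  have hvc : HasCompactSupport v := hβc.comp_left (g := Complex.im) (by simp)
  set N : ℂ → ℝ := fun z => u z ^ 2 + v z ^ 2 with hN
  have hNs : ContDiff ℝ 2 N := (hus.pow 2).add (hvs.pow 2)
  have hNc : HasCompactSupport N := by
    have h1 : HasCompactSupport (fun z => u z ^ 2) := huc.comp_left (g := fun x : ℝ => x ^ 2) (by simp)
    have h2 : HasCompactSupport (fun z => v z ^ 2) := hvc.comp_left (g := fun x : ℝ => x ^ 2) (by simp)
    exact h1.add h2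
  have hdθ : Differentiable ℝ θ := hθ.differentiable (by norm_num)
  have hdη : Differentiable ℝ η := hη.differentiable (by norm_num)
  have hdβ : Differentiable ℝ β := hβs.differentiable (by norm_num)
  have hdu : Differentiable ℝ u := hus.differentiable (by norm_num)
  have hdv : Differentiable ℝ v := hvs.differentiable (by norm_num)
  have hfu : ∀ z w, fderiv ℝ u z w = (fderiv ℝ β z w).re := by
    intro z w
    have := (Complex.reCLM.hasFDerivAt.comp z (hdβ z).hasFDerivAt).fderiv
    rw [show u = Complex.reCLM ∘ β from rfl, this]; rfl
  have hfv : ∀ z w, fderiv ℝ v z w = (fderiv ℝ β z w).im := by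
    intro z w
    have := (Complex.imCLM.hasFDerivAt.comp z (hdβ z).hasFDerivAt).fderiv
    rw [show v = Complex.imCLM ∘ β from rfl, this]; rfl
  have hfN : ∀ z w, fderiv ℝ N z w = 2 * u z * fderiv ℝ u z w + 2 * v z * fderiv ℝ v z w := by
    intro z w
    have := (((hdu z).hasFDerivAt.pow 2).add ((hdv z).hasFDerivAt.pow 2)).fderiv
    rw [show N = (fun z => u z ^ 2) + fun z => v z ^ 2 from rfl, this]
    simp
  have hfβ : ∀ z w, (Real.exp (θ z) : ℂ) * fderiv ℝ η z w
      = fderiv ℝ β z w - fderiv ℝ θ z w * β z := by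
    intro z w
    have h1 : HasFDerivAt (fun z => (Real.exp (θ z) : ℂ))
        (Complex.ofRealCLM.comp (Real.exp (θ z) • fderiv ℝ θ z)) z :=
      Complex.ofRealCLM.hasFDerivAt.comp z (hdθ z).hasFDerivAt.exp
    have := (h1.mul (hdη z).hasFDerivAt).fderiv
    rw [show β = fun z => (Real.exp (θ z) : ℂ) * η z from rfl]
    rw [show (fun z => (Real.exp (θ z) : ℂ) * η z) = (fun z => (Real.exp (θ z) : ℂ)) * η from rfl, this]
    simp
    ring
  have hpt : ∀ z, (fderiv ℝ v z 1 * fderiv ℝ u z Complex.I - fderiv ℝ u z 1 * fderiv ℝ v z Complex.I)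
      - (1/2) * (fderiv ℝ θ z 1 * fderiv ℝ N z 1 + fderiv ℝ θ z Complex.I * fderiv ℝ N z Complex.I) ≤
      Real.exp (2 * θ z) * ‖dbar η z‖ ^ 2 := by
    intro z
    have e1 : Real.exp (2 * θ z) * ‖dbar η z‖ ^ 2 =
        ‖((fderiv ℝ β z 1 - fderiv ℝ θ z 1 * β z) +
          Complex.I * (fderiv ℝ β z Complex.I - fderiv ℝ θ z Complex.I * β z)) / 2‖ ^ 2 := by
      rw [← hfβ, ← hfβ]
      rw [show ((Real.exp (θ z) : ℂ) * fderiv ℝ η z 1 +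
        Complex.I * ((Real.exp (θ z) : ℂ) * fderiv ℝ η z Complex.I)) / 2 =
        (Real.exp (θ z) : ℂ) * dbar η z by unfold dbar; ring]
      rw [norm_mul, mul_pow, Complex.norm_real, Real.norm_eq_abs, sq_abs, ← Real.exp_nat_mul]
      norm_num
    rw [e1, hfN, hfN, hfu, hfu, hfv, hfv]
    have hub : u z = (β z).re := rfl
    have hvb : v z = (β z).im := rfl
    rw [hub, hvb]
    generalize fderiv ℝ β z 1 = p
    generalize fderiv ℝ β z Complex.I = q
    generalize fderiv ℝ θ z 1 = a
    generalize fderiv ℝ θ z Complex.I = b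
    generalize β z = B
    have key : ‖((p - a * B) + Complex.I * (q - b * B)) / 2‖ ^ 2 =
       ‖((p + a * B) - Complex.I * (q + b * B)) / 2‖ ^ 2 + ((p.im * q.re - p.re * q.im)
        - (1/2) * (a * (2 * B.re * p.re + 2 * B.im * p.im) + b * (2 * B.re * q.re + 2 * B.im * q.im))) := by
      rw [Complex.sq_norm, Complex.sq_norm, Complex.normSq_apply, Complex.normSq_apply]
      simp
      ring
    rw [key]
    linarith [sq_nonneg ‖((p + a * B) - Complex.I * (q + b * B)) / 2‖]
  have hθ' : ∀ w, Continuous (fun z => fderiv ℝ θ z w) := fun w =>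
    (contDiff_fderiv_apply' hθ w).continuous
  have hu' : ∀ w, Continuous (fun z => fderiv ℝ u z w) := fun w =>
    (contDiff_fderiv_apply' hus w).continuous
  have hv' : ∀ w, Continuous (fun z => fderiv ℝ v z w) := fun w =>
    (contDiff_fderiv_apply' hvs w).continuous
  have hN' : ∀ w, Continuous (fun z => fderiv ℝ N z w) := fun w =>
    (contDiff_fderiv_apply' hNs w).continuous
  have hcN' : ∀ w, HasCompactSupport (fun z => fderiv ℝ N z w) := fun w => hNc.fderiv_apply ℝ w
  have hcv' : ∀ w, HasCompactSupport (fun z => fderiv ℝ v z w) := fun w => hvc.fderiv_apply ℝ w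
  have iJ : Integrable (fun z => fderiv ℝ v z 1 * fderiv ℝ u z Complex.I
      - fderiv ℝ u z 1 * fderiv ℝ v z Complex.I) :=
    (((hv' 1).mul (hu' _)).integrable_of_hasCompactSupport (hcv' 1).mul_right).sub
     (((hu' 1).mul (hv' _)).integrable_of_hasCompactSupport (hcv' _).mul_left)
  have iN : ∀ w, Integrable (fun z => fderiv ℝ θ z w * fderiv ℝ N z w) := fun w =>
    ((hθ' w).mul (hN' w)).integrable_of_hasCompactSupport (hcN' w).mul_left
  have hdb : Continuous (dbar η) := by
    unfold dbar
    have : ∀ w, Continuous (fun z => fderiv ℝ η z w) := fun w =>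
      (hη.continuous_fderiv (by norm_num)).clm_apply continuous_const
    exact ((this 1).add (continuous_const.mul (this _))).div_const _
  have hdbc : HasCompactSupport (dbar η) := by
    have h1 := hc.fderiv_apply ℝ (1 : ℂ)
    have h2 := hc.fderiv_apply ℝ Complex.I
    have h3 : HasCompactSupport (fun z => Complex.I * fderiv ℝ η z Complex.I) := h2.mul_left
    exact (h1.add h3).comp_left (g := fun x : ℂ => x / 2) (by simp)
  have iR : Integrable (fun z => Real.exp (2 * θ z) * ‖dbar η z‖ ^ 2) := by
    apply Continuous.integrable_of_hasCompactSupport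
    · have := hθ.continuous
      fun_prop
    · have : HasCompactSupport (fun z => ‖dbar η z‖ ^ 2) :=
        hdbc.comp_left (g := fun x : ℂ => ‖x‖ ^ 2) (by simp)
      exact this.mul_left
  have hθxx : ∀ w, Continuous (fun z => fderiv ℝ (fun y => fderiv ℝ θ y w) z w) := fun w =>
    ((contDiff_fderiv_apply' hθ w).continuous_fderiv one_ne_zero).clm_apply continuous_const
  have iT : ∀ w, Integrable (fun z => fderiv ℝ (fun y => fderiv ℝ θ y w) z w * N z) := fun w =>
    ((hθxx w).mul hNs.continuous).integrable_of_hasCompactSupport hNc.mul_left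
  have hNeq : ∀ z, N z = Real.exp (2 * θ z) * ‖η z‖ ^ 2 := by
    intro z
    have : N z = ‖β z‖ ^ 2 := by
      rw [Complex.sq_norm, Complex.normSq_apply, hN, hu, hv]; ring
    rw [this, hβ]
    simp only
    rw [norm_mul, mul_pow, Complex.norm_real, Real.norm_eq_abs, sq_abs, ← Real.exp_nat_mul]
    norm_num
  have hIntg := integral_mono (iJ.sub (((iN 1).add (iN Complex.I)).const_mul (1/2))) iR hpt
  refine le_trans (le_of_eq ?_) hIntg
  have hs := integral_sub iJ (((iN 1).add (iN Complex.I)).const_mul (1/2))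
  simp only [Pi.sub_apply, Pi.add_apply] at hs ⊢
  rw [hs, jac_integral_zero hus hvs hvc, integral_const_mul, integral_add (iN 1) (iN Complex.I),
    ibp_real (contDiff_fderiv_apply' hθ 1) (hNs.of_le (by norm_num)) hNc 1,
    ibp_real (contDiff_fderiv_apply' hθ Complex.I) (hNs.of_le (by norm_num)) hNc Complex.I]
  simp_rw [← hNeq]
  unfold laplacian
  simp_rw [add_mul]
  rw [integral_add (iT 1) (iT Complex.I)]
  ring

lemma isOpen_unitDisc : IsOpen unitDisc := Metric.isOpen_ball

lemma exists_global_ext {E : Type*} [NormedAddCommGroup E] [NormedSpace ℝ E] {n : ℕ∞} {θ : ℂ → E}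
    (hθ : ContDiffOn ℝ n θ unitDisc) {K : Set ℂ} (hK : IsCompact K) (hKD : K ⊆ unitDisc) :
    ∃ θ' : ℂ → E, ContDiff ℝ n θ' ∧ ∀ z ∈ K, θ' =ᶠ[nhds z] θ := by
  obtain ⟨r, hr1, hr⟩ : ∃ r < 1, K ⊆ Metric.ball 0 r :=
    exists_lt_subset_ball hK.isClosed hKD
  set r₀ := max r (1/2) with hr₀
  have h0 : 0 < r₀ := lt_of_lt_of_le (by norm_num) (le_max_right _ _)
  have h1 : r₀ < 1 := max_lt hr1 (by norm_num)
  let χ : ContDiffBump (0 : ℂ) := ⟨r₀, (1 + r₀) / 2, h0, by linarith⟩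
  refine ⟨fun z => χ z • θ z, ?_, ?_⟩
  · rw [contDiff_iff_contDiffAt]
    intro z
    by_cases hz : z ∈ unitDisc
    · exact χ.contDiffAt.smul (hθ.contDiffAt (isOpen_unitDisc.mem_nhds hz))
    · have : (fun z => χ z • θ z) =ᶠ[nhds z] fun _ => 0 := by
        have hz' : z ∈ (tsupport χ)ᶜ := by
          rw [χ.tsupport_eq]
          intro h
          apply hz
          have : ‖z‖ ≤ (1 + r₀) / 2 := by simpa using h
          simp [unitDisc]; linarith
        have hop : IsOpen (tsupport χ)ᶜ := (isClosed_tsupport _).isOpen_compl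
        filter_upwards [hop.mem_nhds hz'] with w hw
        have : χ w = 0 := image_eq_zero_of_notMem_tsupport hw
        simp [this]
      exact contDiffAt_const.congr_of_eventuallyEq this
  · intro z hz
    have hz' : z ∈ Metric.ball (0 : ℂ) r₀ := Metric.ball_subset_ball (le_max_left _ _) (hr hz)
    filter_upwards [Metric.isOpen_ball.mem_nhds hz'] with w hw
    have : χ w = 1 := χ.one_of_mem_closedBall (Metric.ball_subset_closedBall hw)
    simp [this]

lemma laplacian_congr {θ θ' : ℂ → ℝ} {z : ℂ} (h : θ' =ᶠ[nhds z] θ) :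
    laplacian θ' z = laplacian θ z := by
  unfold laplacian
  have h' : ∀ v : ℂ, (fun w => fderiv ℝ θ' w v) =ᶠ[nhds z] fun w => fderiv ℝ θ w v := by
    intro v
    filter_upwards [h.fderiv (𝕜 := ℝ)] with w hw
    rw [hw]
  rw [(h' 1).fderiv_eq, (h' Complex.I).fderiv_eq]

lemma dbar_congr {u u' : ℂ → ℂ} {z : ℂ} (h : u' =ᶠ[nhds z] u) : dbar u' z = dbar u z := by
  unfold dbar; rw [h.fderiv_eq]

lemma continuousOn_dbar {u : ℂ → ℂ} (hu : ContDiffOn ℝ 1 u unitDisc) :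
    ContinuousOn (dbar u) unitDisc := by
  have h := hu.continuousOn_fderiv_of_isOpen isOpen_unitDisc le_rfl
  have h' : ∀ v : ℂ, ContinuousOn (fun z => fderiv ℝ u z v) unitDisc := fun v =>
    h.clm_apply continuousOn_const
  unfold dbar
  exact ((h' 1).add (continuousOn_const.mul (h' _))).div_const _

lemma continuousOn_laplacian {θ : ℂ → ℝ} (hθ : ContDiffOn ℝ 2 θ unitDisc) :
    ContinuousOn (laplacian θ) unitDisc := by
  have h := hθ.fderiv_of_isOpen (m := 1) isOpen_unitDisc (by norm_num)
  have h' : ∀ v : ℂ, ContinuousOn (fun z => fderiv ℝ (fun w => fderiv ℝ θ w v) z v) unitDisc := by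
    intro v
    have h1 : ContDiffOn ℝ 1 (fun w => fderiv ℝ θ w v) unitDisc := h.clm_apply contDiffOn_const
    exact (h1.continuousOn_fderiv_of_isOpen isOpen_unitDisc le_rfl).clm_apply continuousOn_const
  exact (h' 1).add (h' _)

lemma measurableSet_unitDisc : MeasurableSet unitDisc := isOpen_unitDisc.measurableSet

/-- Test functions of class `C²` with compact support in the disc. -/
def testSub : Submodule ℂ (ℂ → ℂ) where
  carrier := {η | ContDiff ℝ 2 η ∧ HasCompactSupport η ∧ tsupport η ⊆ unitDisc}
  zero_mem' := by
    refine ⟨contDiff_const, HasCompactSupport.zero, ?_⟩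
    simp [tsupport]
  add_mem' := by
    rintro a b ⟨h1, h2, h3⟩ ⟨h4, h5, h6⟩
    exact ⟨h1.add h4, h2.add h5, (tsupport_add a b).trans (union_subset h3 h6)⟩
  smul_mem' := by
    rintro c a ⟨h1, h2, h3⟩
    refine ⟨h1.const_smul c, h2.smul_left (f := fun _ => c), ?_⟩
    exact (tsupport_smul_subset_right (fun _ => c) a).trans h3

lemma dbar_eq_zero_of_notMem {η : ℂ → ℂ} {z : ℂ} (hz : z ∉ tsupport η) : dbar η z = 0 := by
  have : η =ᶠ[nhds z] fun _ => 0 := by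
    have hop : IsOpen (tsupport η)ᶜ := (isClosed_tsupport _).isOpen_compl
    filter_upwards [hop.mem_nhds hz] with w hw
    exact image_eq_zero_of_notMem_tsupport hw
  rw [dbar_congr this]
  simp [dbar]

lemma continuous_dbar {η : ℂ → ℂ} (hη : ContDiff ℝ 1 η) : Continuous (dbar η) := by
  unfold dbar
  have : ∀ w, Continuous (fun z => fderiv ℝ η z w) := fun w =>
    (hη.continuous_fderiv (by norm_num)).clm_apply continuous_const
  exact ((this 1).add (continuous_const.mul (this _))).div_const _

lemma hasCompactSupport_dbar {η : ℂ → ℂ} (hc : HasCompactSupport η) :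
    HasCompactSupport (dbar η) :=
  HasCompactSupport.intro hc (fun _ hz => dbar_eq_zero_of_notMem hz)

lemma dbar_add {a b : ℂ → ℂ} {z : ℂ} (ha : DifferentiableAt ℝ a z) (hb : DifferentiableAt ℝ b z) :
    dbar (a + b) z = dbar a z + dbar b z := by
  unfold dbar; rw [fderiv_add ha hb]; simp; ring

lemma dbar_smul {a : ℂ → ℂ} (c : ℂ) {z : ℂ} (ha : DifferentiableAt ℝ a z) :
    dbar (c • a) z = c * dbar a z := by
  unfold dbar
  rw [fderiv_const_smul ha c]; simp; ring

/-- The basic inequality, local version. -/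
lemma basic_ineq_loc {θ : ℂ → ℝ} {η : ℂ → ℂ} (hθ : ContDiffOn ℝ 2 θ unitDisc) (hη : η ∈ testSub) :
    (1/2) * ∫ z, laplacian θ z * (Real.exp (2 * θ z) * ‖η z‖ ^ 2) ≤
      ∫ z, Real.exp (2 * θ z) * ‖dbar η z‖ ^ 2 := by
  obtain ⟨h1, h2, h3⟩ := hη
  obtain ⟨θ', hθ', heq⟩ := exists_global_ext (n := 2) hθ h2 h3
  have hb := basic_ineq hθ' h1 h2
  convert hb using 3
  · congr 1
    ext z
    by_cases hz : z ∈ tsupport η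
    · rw [laplacian_congr (heq z hz), (heq z hz).eq_of_nhds]
    · simp [image_eq_zero_of_notMem_tsupport hz]
  · rename_i z
    by_cases hz : z ∈ tsupport η
    · rw [(heq z hz).eq_of_nhds]
    · simp [dbar_eq_zero_of_notMem hz]

lemma ibp_complex {f g : ℂ → ℂ} (hf : ContDiff ℝ 1 f) (hg : ContDiff ℝ 1 g)
    (hc : HasCompactSupport g) (v : ℂ) :
    ∫ z, f z * fderiv ℝ g z v = - ∫ z, fderiv ℝ f z v * g z := by
  have hf' : Continuous (fun z => fderiv ℝ f z v) :=
    (hf.continuous_fderiv one_ne_zero).clm_apply continuous_const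
  have hg' : Continuous (fun z => fderiv ℝ g z v) :=
    (hg.continuous_fderiv one_ne_zero).clm_apply continuous_const
  have hcg' : HasCompactSupport (fun z => fderiv ℝ g z v) := hc.fderiv_apply ℝ v
  apply integral_mul_fderiv_eq_neg_fderiv_mul_of_integrable
  · exact (hf'.mul hg.continuous).integrable_of_hasCompactSupport hc.mul_left
  · exact (hf.continuous.mul hg').integrable_of_hasCompactSupport hcg'.mul_left
  · exact (hf.continuous.mul hg.continuous).integrable_of_hasCompactSupport hc.mul_left
  · intro x _; exact hf.differentiable one_ne_zero x
  · intro x _; exact hg.differentiable one_ne_zero x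

lemma ibp_dbar_global {f g : ℂ → ℂ} (hf : ContDiff ℝ 1 f) (hg : ContDiff ℝ 1 g)
    (hc : HasCompactSupport g) : ∫ z, f z * dbar g z = - ∫ z, dbar f z * g z := by
  have hf' : ∀ v, Continuous (fun z => fderiv ℝ f z v) := fun v =>
    (hf.continuous_fderiv one_ne_zero).clm_apply continuous_const
  have hg' : ∀ v, Continuous (fun z => fderiv ℝ g z v) := fun v =>
    (hg.continuous_fderiv one_ne_zero).clm_apply continuous_const
  have hcg' : ∀ v, HasCompactSupport (fun z => fderiv ℝ g z v) := fun v => hc.fderiv_apply ℝ v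
  have i1 : ∀ v, Integrable (fun z => f z * fderiv ℝ g z v) := fun v =>
    (hf.continuous.mul (hg' v)).integrable_of_hasCompactSupport (hcg' v).mul_left
  have i2 : ∀ v, Integrable (fun z => fderiv ℝ f z v * g z) := fun v =>
    ((hf' v).mul hg.continuous).integrable_of_hasCompactSupport hc.mul_left
  have e1 : ∀ z, f z * dbar g z = (1/2) * (f z * fderiv ℝ g z 1)
      + (Complex.I / 2) * (f z * fderiv ℝ g z Complex.I) := by
    intro z; unfold dbar; ring
  have e2 : ∀ z, dbar f z * g z = (1/2) * (fderiv ℝ f z 1 * g z)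
      + (Complex.I / 2) * (fderiv ℝ f z Complex.I * g z) := by
    intro z; unfold dbar; ring
  simp_rw [e1, e2]
  rw [integral_add ((i1 1).const_mul _) ((i1 _).const_mul _),
    integral_add ((i2 1).const_mul _) ((i2 _).const_mul _)]
  simp only [integral_const_mul]
  rw [ibp_complex hf hg hc, ibp_complex hf hg hc]
  ring

lemma ibp_dbar {f η : ℂ → ℂ} (hf : ContDiffOn ℝ 1 f unitDisc) (hη : η ∈ testSub) :
    ∫ z, f z * dbar η z = - ∫ z, dbar f z * η z := by
  obtain ⟨h1, h2, h3⟩ := hη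
  obtain ⟨f', hf', heq⟩ := exists_global_ext (n := 1) hf h2 h3
  have hb := ibp_dbar_global hf' (h1.of_le (by norm_num)) h2
  convert hb using 2
  · ext z
    by_cases hz : z ∈ tsupport η
    · rw [(heq z hz).eq_of_nhds]
    · simp [dbar_eq_zero_of_notMem hz]
  · congr 1
    ext z
    by_cases hz : z ∈ tsupport η
    · rw [dbar_congr (heq z hz)]
    · simp [image_eq_zero_of_notMem_tsupport hz]

/-- Abstract Riesz-type lemma. -/
lemma riesz_factor {V H : Type*} [AddCommGroup V] [Module ℂ V] [NormedAddCommGroup H]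
    [InnerProductSpace ℂ H] [CompleteSpace H] (T : V →ₗ[ℂ] H) (l : V →ₗ[ℂ] ℂ) (C : ℝ) (hC : 0 ≤ C)
    (h : ∀ v, ‖l v‖ ≤ C * ‖T v‖) : ∃ u : H, ‖u‖ ≤ C ∧ ∀ v, l v = inner ℂ u (T v) := by
  have hker : LinearMap.ker T ≤ LinearMap.ker l := by
    intro v hv
    rw [LinearMap.mem_ker] at hv ⊢
    have := h v
    rw [hv] at this
    simpa using this
  let l' : LinearMap.range T →ₗ[ℂ] ℂ :=
    ((LinearMap.ker T).liftQ l hker).comp T.quotKerEquivRange.symm.toLinearMap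
  have hl' : ∀ v, l' ⟨T v, LinearMap.mem_range_self T v⟩ = l v := by
    intro v
    have : T.quotKerEquivRange.symm ⟨T v, LinearMap.mem_range_self T v⟩ =
        (LinearMap.ker T).mkQ v := by
      rw [LinearEquiv.symm_apply_eq]
      rfl
    simp only [l', LinearMap.comp_apply, LinearEquiv.coe_coe, this]
    simp
  have hbd : ∀ x, ‖l' x‖ ≤ C * ‖x‖ := by
    rintro ⟨x, v, rfl⟩
    rw [hl']
    exact h v
  let L : LinearMap.range T →L[ℂ] ℂ := l'.mkContinuous C hbd
  obtain ⟨g, hg, hgn⟩ := exists_extension_norm_eq (LinearMap.range T) L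
  refine ⟨(InnerProductSpace.toDual ℂ H).symm g, ?_, ?_⟩
  · rw [LinearIsometryEquiv.norm_map, hgn]
    exact LinearMap.mkContinuous_norm_le _ hC _
  · intro v
    rw [InnerProductSpace.toDual_symm_apply]
    have := hg ⟨T v, LinearMap.mem_range_self T v⟩
    rw [this]
    exact (hl' v).symm

lemma continuous_of_support {E : Type*} [NormedAddCommGroup E] {f : ℂ → E} {K : Set ℂ}
    (hK : IsCompact K) (hKD : K ⊆ unitDisc) (hf : ContinuousOn f unitDisc)
    (h0 : ∀ z, z ∉ K → f z = 0) : Continuous f := by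
  rw [continuous_iff_continuousAt]
  intro z
  by_cases hz : z ∈ unitDisc
  · exact hf.continuousAt (isOpen_unitDisc.mem_nhds hz)
  · have hz' : z ∈ Kᶜ := fun h => hz (hKD h)
    have : f =ᶠ[nhds z] fun _ => 0 := by
      filter_upwards [hK.isClosed.isOpen_compl.mem_nhds hz'] with w hw
      exact h0 w hw
    exact (continuousAt_const (y := (0 : E))).congr this.symm

lemma memLp_T {θ : ℂ → ℝ} (hθ : ContDiffOn ℝ 2 θ unitDisc) (η : testSub) :
    Continuous (fun z => (Real.exp (θ z) : ℂ) * dbar η z) ∧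
    HasCompactSupport (fun z => (Real.exp (θ z) : ℂ) * dbar η z) := by
  obtain ⟨h1, h2, h3⟩ := η.2
  have hz : ∀ z, z ∉ tsupport (η : ℂ → ℂ) → (Real.exp (θ z) : ℂ) * dbar η z = 0 := by
    intro z hz
    rw [dbar_eq_zero_of_notMem hz, mul_zero]
  refine ⟨continuous_of_support h2 h3 ?_ hz, HasCompactSupport.intro h2 hz⟩
  refine ContinuousOn.mul ?_ (continuous_dbar (h1.of_le (by norm_num))).continuousOn
  exact Complex.continuous_ofReal.comp_continuousOn (Real.continuous_exp.comp_continuousOn hθ.continuousOn)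

/-- The operator `η ↦ e^θ ∂̄η`. -/
def opT {θ : ℂ → ℝ} (hθ : ContDiffOn ℝ 2 θ unitDisc) : testSub →ₗ[ℂ] Lp ℂ 2 (volume : Measure ℂ) where
  toFun η := ((memLp_T hθ η).1.memLp_of_hasCompactSupport (memLp_T hθ η).2 : MemLp _ 2 _).toLp
  map_add' a b := by
    rw [← MemLp.toLp_add]
    congr 1
    ext z
    have h1 := (a.2.1.differentiable (by norm_num)) z
    have h2 := (b.2.1.differentiable (by norm_num)) z
    simp only [Submodule.coe_add, Pi.add_apply]
    rw [dbar_add h1 h2]; ring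
  map_smul' c a := by
    rw [RingHom.id_apply, ← MemLp.toLp_const_smul]
    congr 1
    ext z
    have h1 := (a.2.1.differentiable (by norm_num)) z
    simp only [Submodule.coe_smul, Pi.smul_apply, smul_eq_mul]
    rw [dbar_smul c h1]; ring

lemma integrable_mul_test {v : ℂ → ℂ} (hv : ContinuousOn v unitDisc) {η : ℂ → ℂ} (hη : η ∈ testSub) :
    Integrable (fun z => v z * η z) := by
  obtain ⟨h1, h2, h3⟩ := hη
  have hz : ∀ z, z ∉ tsupport η → v z * η z = 0 := by
    intro z hz
    rw [image_eq_zero_of_notMem_tsupport hz, mul_zero]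
  exact (continuous_of_support h2 h3 (hv.mul h1.continuous.continuousOn) hz).integrable_of_hasCompactSupport
    (HasCompactSupport.intro h2 hz)

/-- The functional `η ↦ ∫ v η`. -/
def opL {v : ℂ → ℂ} (hv : ContinuousOn v unitDisc) : testSub →ₗ[ℂ] ℂ where
  toFun η := ∫ z, v z * (η : ℂ → ℂ) z
  map_add' a b := by
    rw [← integral_add (integrable_mul_test hv a.2) (integrable_mul_test hv b.2)]
    simp [mul_add]
  map_smul' c a := by
    rw [RingHom.id_apply, smul_eq_mul, ← integral_const_mul]
    congr 1; ext z; simp; ring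

lemma opT_norm_sq {θ : ℂ → ℝ} (hθ : ContDiffOn ℝ 2 θ unitDisc) (η : testSub) :
    ‖opT hθ η‖ ^ 2 = ∫ z, Real.exp (2 * θ z) * ‖dbar η z‖ ^ 2 := by
  have h := L2.inner_def (𝕜 := ℂ) (opT hθ η) (opT hθ η)
  have h2 : ∫ a, inner ℂ ((opT hθ η : ℂ → ℂ) a) ((opT hθ η : ℂ → ℂ) a) =
      ∫ a, ((Real.exp (2 * θ a) * ‖dbar η a‖ ^ 2 : ℝ) : ℂ) := by
    apply integral_congr_ae
    have := MemLp.coeFn_toLp ((memLp_T hθ η).1.memLp_of_hasCompactSupport (memLp_T hθ η).2 : MemLp _ 2 volume)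
    filter_upwards [this] with a ha
    have e : (opT hθ η : ℂ → ℂ) a = (Real.exp (θ a) : ℂ) * dbar η a := ha
    rw [e, inner_self_eq_norm_sq_to_K, norm_mul]
    simp only [Complex.norm_real, Real.norm_eq_abs, Real.abs_exp, Complex.coe_algebraMap]
    rw [two_mul, Real.exp_add]
    push_cast
    ring
  rw [h2, integral_complex_ofReal, inner_self_eq_norm_sq_to_K] at h
  have h3 : ((‖opT hθ η‖ ^ 2 : ℝ) : ℂ) = ((∫ z, Real.exp (2 * θ z) * ‖dbar η z‖ ^ 2 : ℝ) : ℂ) := by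
    rw [← h]; push_cast; rfl
  exact Complex.ofReal_injective h3

lemma opL_bound {θ : ℂ → ℝ} (hθ : ContDiffOn ℝ 2 θ unitDisc)
    (hpos : ∀ z ∈ unitDisc, 0 < laplacian θ z) {v : ℂ → ℂ} (hv : ContinuousOn v unitDisc)
    {K : ℝ} (hK : 0 ≤ K)
    (hb : ∫⁻ z in unitDisc, ENNReal.ofReal (‖v z‖ ^ 2 / laplacian θ z * Real.exp (-(2 * θ z))) ≤
      ENNReal.ofReal K) (η : testSub) : ‖opL hv η‖ ≤ Real.sqrt (2 * K) * ‖opT hθ η‖ := by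
  obtain ⟨h1, h2, h3⟩ := η.2
  have hη0 : ∀ z, z ∉ tsupport (η : ℂ → ℂ) → (η : ℂ → ℂ) z = 0 := fun z hz =>
    image_eq_zero_of_notMem_tsupport hz
  set a : ℂ → ℝ := fun z => ‖v z‖ / Real.sqrt (laplacian θ z) * Real.exp (-(θ z)) with ha
  set b : ℂ → ℝ := fun z => Real.sqrt (laplacian θ z) * (Real.exp (θ z) * ‖(η : ℂ → ℂ) z‖) with hbdef
  have hlc := continuousOn_laplacian hθ
  have hsq : ContinuousOn (fun z => Real.sqrt (laplacian θ z)) unitDisc :=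
    Real.continuous_sqrt.comp_continuousOn hlc
  have hac : ContinuousOn a unitDisc := by
    refine (hv.norm.div hsq ?_).mul (Real.continuous_exp.comp_continuousOn hθ.continuousOn.neg)
    intro z hz
    exact (Real.sqrt_pos.2 (hpos z hz)).ne'
  have hbc : ContinuousOn b unitDisc := hsq.mul
    ((Real.continuous_exp.comp_continuousOn hθ.continuousOn).mul h1.continuous.norm.continuousOn)
  have ha0 : ∀ z, 0 ≤ a z := fun z => by positivity
  have hb0 : ∀ z, 0 ≤ b z := fun z => by positivity
  have hab : ∀ z ∈ unitDisc, a z * b z = ‖v z * (η : ℂ → ℂ) z‖ := by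
    intro z hz
    have := (Real.sqrt_pos.2 (hpos z hz)).ne'
    simp only [ha, hbdef, norm_mul, Real.exp_neg]
    have := (Real.exp_pos (θ z)).ne'
    field_simp
  have step1 : ‖opL hv η‖ₑ ≤ ∫⁻ z in unitDisc, ENNReal.ofReal (a z) * ENNReal.ofReal (b z) := by
    calc ‖opL hv η‖ₑ ≤ ∫⁻ z, ‖v z * (η : ℂ → ℂ) z‖ₑ := enorm_integral_le_lintegral_enorm _
      _ = ∫⁻ z in unitDisc, ‖v z * (η : ℂ → ℂ) z‖ₑ := by
        rw [← lintegral_indicator measurableSet_unitDisc]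
        congr 1; ext z
        by_cases hz : z ∈ unitDisc
        · simp [hz]
        · rw [indicator_of_notMem hz, hη0 z (fun h => hz (h3 h))]; simp
      _ = _ := by
        refine setLIntegral_congr_fun measurableSet_unitDisc ?_
        intro z hz
        simp only
        rw [← ENNReal.ofReal_mul (ha0 z), hab z hz, ofReal_norm]
  have hol := ENNReal.lintegral_mul_le_Lp_mul_Lq (volume.restrict unitDisc) Real.HolderConjugate.two_two
    (f := fun z => ENNReal.ofReal (a z)) (g := fun z => ENNReal.ofReal (b z))
    (hac.aemeasurable measurableSet_unitDisc).ennreal_ofReal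
    (hbc.aemeasurable measurableSet_unitDisc).ennreal_ofReal
  have hA : ∫⁻ z in unitDisc, (ENNReal.ofReal (a z)) ^ (2:ℝ) ≤ ENNReal.ofReal K := by
    refine le_trans (le_of_eq ?_) hb
    refine setLIntegral_congr_fun measurableSet_unitDisc ?_
    intro z hz
    simp only [ENNReal.rpow_two]
    rw [← ENNReal.ofReal_pow (ha0 z)]
    congr 1
    simp only [ha, mul_pow, div_pow, Real.sq_sqrt (hpos z hz).le]
    rw [← Real.exp_nat_mul]; congr 2; push_cast; ring
  have hB : ∫⁻ z in unitDisc, (ENNReal.ofReal (b z)) ^ (2:ℝ) ≤ ENNReal.ofReal (2 * ‖opT hθ η‖ ^ 2) := by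
    have e1 : ∫⁻ z in unitDisc, (ENNReal.ofReal (b z)) ^ (2:ℝ) ≤
        ∫⁻ z, ENNReal.ofReal (laplacian θ z * (Real.exp (2 * θ z) * ‖(η : ℂ → ℂ) z‖ ^ 2)) := by
      refine le_trans (le_of_eq ?_) (setLIntegral_le_lintegral unitDisc _)
      refine setLIntegral_congr_fun measurableSet_unitDisc ?_
      intro z hz
      simp only [ENNReal.rpow_two]
      rw [← ENNReal.ofReal_pow (hb0 z)]
      congr 1
      simp only [hbdef, mul_pow, Real.sq_sqrt (hpos z hz).le]
      rw [← Real.exp_nat_mul]; norm_num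
    refine e1.trans ?_
    have hz0 : ∀ z, z ∉ tsupport (η : ℂ → ℂ) →
        laplacian θ z * (Real.exp (2 * θ z) * ‖(η : ℂ → ℂ) z‖ ^ 2) = 0 := fun z hz => by
      rw [hη0 z hz]; simp
    have hIntg : Integrable (fun z => laplacian θ z * (Real.exp (2 * θ z) * ‖(η : ℂ → ℂ) z‖ ^ 2)) := by
      refine (continuous_of_support h2 h3 ?_ hz0).integrable_of_hasCompactSupport
        (HasCompactSupport.intro h2 hz0)
      exact hlc.mul ((Real.continuous_exp.comp_continuousOn (continuousOn_const.mul hθ.continuousOn)).mul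
        (h1.continuous.norm.pow 2).continuousOn)
    rw [← ofReal_integral_eq_lintegral_ofReal hIntg]
    · apply ENNReal.ofReal_le_ofReal
      rw [opT_norm_sq]
      have := basic_ineq_loc hθ η.2
      linarith
    · refine Eventually.of_forall fun z => ?_
      by_cases hz : z ∈ tsupport (η : ℂ → ℂ)
      · have := hpos z (h3 hz)
        simp only [Pi.zero_apply]; positivity
      · simp only [Pi.zero_apply]; rw [hz0 z hz]
  have fin : ‖opL hv η‖ₑ ≤ ENNReal.ofReal (Real.sqrt (2 * K) * ‖opT hθ η‖) := by
    refine step1.trans (hol.trans ?_)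
    calc _ ≤ (ENNReal.ofReal K) ^ (1/2:ℝ) * (ENNReal.ofReal (2 * ‖opT hθ η‖ ^ 2)) ^ (1/2:ℝ) := by
          gcongr
      _ = _ := by
        rw [ENNReal.ofReal_rpow_of_nonneg hK (by norm_num),
          ENNReal.ofReal_rpow_of_nonneg (by positivity) (by norm_num),
          ← ENNReal.ofReal_mul (by positivity), ← Real.sqrt_eq_rpow, ← Real.sqrt_eq_rpow,
          ← Real.sqrt_mul hK]
        congr 1
        rw [show K * (2 * ‖opT hθ η‖ ^ 2) = (2 * K) * ‖opT hθ η‖ ^ 2 by ring,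
          Real.sqrt_mul (by positivity), Real.sqrt_sq (norm_nonneg _)]
  rw [← ofReal_norm] at fin
  exact (ENNReal.ofReal_le_ofReal_iff (by positivity)).1 fin

lemma hormander_weak {θ : ℂ → ℝ} (hθ : ContDiffOn ℝ 2 θ unitDisc)
    (hpos : ∀ z ∈ unitDisc, 0 < laplacian θ z) {u0 : ℂ → ℂ} (hu : ContDiffOn ℝ 1 u0 unitDisc)
    {K : ℝ} (hK : 0 ≤ K)
    (hb : ∫⁻ z in unitDisc, ENNReal.ofReal (‖dbar u0 z‖ ^ 2 / laplacian θ z * Real.exp (-(2 * θ z))) ≤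
      ENNReal.ofReal K) :
    ∃ h : ℂ → ℂ, LocallyIntegrableOn h unitDisc ∧
      (∀ η ∈ testSub, ∫ z, h z * dbar η z = 0) ∧
      ∫⁻ z in unitDisc, ENNReal.ofReal (‖u0 z - h z‖ ^ 2 * Real.exp (-(2 * θ z))) ≤
        ENNReal.ofReal (2 * K) := by
  obtain ⟨U, hU1, hU2⟩ := riesz_factor (opT hθ) (opL (continuousOn_dbar hu)) (Real.sqrt (2 * K))
    (by positivity) (fun η => opL_bound hθ hpos _ hK hb η)
  set u : ℂ → ℂ := fun z => - (starRingEnd ℂ (U z) * (Real.exp (θ z) : ℂ)) with hudef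
  have hec : ContinuousOn (fun z => (Real.exp (θ z) : ℂ)) unitDisc :=
    Complex.continuous_ofReal.comp_continuousOn (Real.continuous_exp.comp_continuousOn hθ.continuousOn)
  have hUint : LocallyIntegrable (fun z => starRingEnd ℂ (U z)) := by
    have h1 : MemLp (fun z => starRingEnd ℂ (U z)) 2 volume := by
      refine (Lp.memLp U).of_le ?_ (Eventually.of_forall fun z => by simp)
      exact (Complex.continuous_conj.comp_aestronglyMeasurable (Lp.aestronglyMeasurable U))
    exact h1.locallyIntegrable (by norm_num)
  have huint : LocallyIntegrableOn u unitDisc := by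
    have := (hUint.locallyIntegrableOn unitDisc).mul_continuousOn hec isOpen_unitDisc.isLocallyClosed
    exact this.neg
  refine ⟨fun z => u0 z - u z, ?_, ?_, ?_⟩
  · exact (hu.continuousOn.locallyIntegrableOn measurableSet_unitDisc).sub huint
  · intro η hη
    have hl := hU2 ⟨η, hη⟩
    have hl' : ∫ z, dbar u0 z * η z = ∫ z, starRingEnd ℂ (U z) * ((Real.exp (θ z) : ℂ) * dbar η z) := by
      have : ∫ z, dbar u0 z * η z = opL (continuousOn_dbar hu) ⟨η, hη⟩ := rfl
      rw [this, hl, L2.inner_def]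
      apply integral_congr_ae
      have := MemLp.coeFn_toLp ((memLp_T hθ ⟨η, hη⟩).1.memLp_of_hasCompactSupport
        (memLp_T hθ ⟨η, hη⟩).2 : MemLp _ 2 volume)
      filter_upwards [this] with a ha
      have e : (opT hθ ⟨η, hη⟩ : ℂ → ℂ) a = (Real.exp (θ a) : ℂ) * dbar η a := ha
      rw [e, RCLike.inner_apply]; ring
    have hi1 : Integrable (fun z => u0 z * dbar η z) := by
      have hz : ∀ z, z ∉ tsupport η → u0 z * dbar η z = 0 := by
        intro z hz
        rw [dbar_eq_zero_of_notMem hz, mul_zero]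
      exact (continuous_of_support hη.2.1 hη.2.2 (hu.continuousOn.mul
        (continuous_dbar (hη.1.of_le (by norm_num))).continuousOn) hz).integrable_of_hasCompactSupport
        (HasCompactSupport.intro hη.2.1 hz)
    have hi2 : Integrable (fun z => u z * dbar η z) := by
      have hc := memLp_T hθ ⟨η, hη⟩
      have := hUint.integrable_smul_right_of_hasCompactSupport hc.1 hc.2
      refine (this.neg).congr (Eventually.of_forall fun z => ?_)
      simp [hudef]; ring
    have : (fun z => (u0 z - u z) * dbar η z) = fun z => u0 z * dbar η z - u z * dbar η z := by
      ext z; ring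
    rw [this, integral_sub hi1 hi2, ibp_dbar hu hη, hl', ← integral_neg, ← integral_sub]
    · rw [integral_eq_zero_of_ae]
      refine Eventually.of_forall fun z => ?_
      simp [hudef]; ring
    · refine hi2.congr (Eventually.of_forall fun z => ?_)
      simp [hudef]; ring
    · exact hi2
  · have hn : ∫⁻ z, ENNReal.ofReal (‖U z‖ ^ 2) ≤ ENNReal.ofReal (2 * K) := by
      have h1 : eLpNorm U 2 volume ≤ ENNReal.ofReal (Real.sqrt (2 * K)) := by
        rw [← Lp.enorm_def, ← ofReal_norm]
        exact ENNReal.ofReal_le_ofReal hU1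
      have h2 : eLpNorm U 2 volume ^ 2 = ∫⁻ z, ENNReal.ofReal (‖U z‖ ^ 2) := by
        rw [eLpNorm_eq_lintegral_rpow_enorm_toReal (by norm_num) (by norm_num)]
        simp only [ENNReal.toReal_ofNat, ENNReal.rpow_two]
        rw [← ENNReal.rpow_two, ← ENNReal.rpow_mul]
        norm_num
      rw [← h2]
      calc _ ≤ (ENNReal.ofReal (Real.sqrt (2 * K))) ^ 2 := by gcongr
        _ = _ := by
          rw [← ENNReal.ofReal_pow (by positivity), Real.sq_sqrt (by positivity)]
    refine le_trans ?_ hn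
    refine le_trans (le_of_eq ?_) (setLIntegral_le_lintegral unitDisc _)
    congr 1; ext z
    congr 1
    have : u0 z - (u0 z - u z) = u z := by ring
    rw [this]
    simp only [hudef, norm_neg, norm_mul, Complex.norm_real, Real.norm_eq_abs, Real.abs_exp,
      RCLike.norm_conj, mul_pow]
    rw [mul_assoc, ← Real.exp_nat_mul, ← Real.exp_add]
    norm_num

lemma integral_rot (f : ℂ → ℂ) (t : ℝ) : ∫ w, f (circleMap 0 1 t * w) = ∫ w, f w := by
  have h := (rotation (Circle.exp t)).measurePreserving.integral_comp
    (rotation (Circle.exp t)).toHomeomorph.measurableEmbedding f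
  rw [← h]
  congr 1; ext w
  simp [rotation_apply, circleMap]

lemma lintegral_rot (f : ℂ → ℝ≥0∞) (t : ℝ) : ∫⁻ w, f (circleMap 0 1 t * w) = ∫⁻ w, f w := by
  have h := (rotation (Circle.exp t)).measurePreserving.lintegral_comp_emb
    (rotation (Circle.exp t)).toHomeomorph.measurableEmbedding f
  rw [← h]
  congr 1; ext w
  simp [rotation_apply, circleMap]

lemma mean_radial {G : ℂ → ℂ} {z : ℂ} {R R' : ℝ} (hR : R' < R)
    (hG : DifferentiableOn ℂ G (Metric.ball z R)) {ρ : ℝ → ℝ} (hρ : Measurable ρ) {B : ℝ}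
    (hB : ∀ t, |ρ t| ≤ B) (h0 : ∀ t, R' < t → ρ t = 0) :
    Integrable (fun w => (ρ ‖w‖ : ℂ) * G (z + w)) ∧
    ∫ w, (ρ ‖w‖ : ℂ) * G (z + w) = ((∫ w : ℂ, ρ ‖w‖ : ℝ) : ℂ) * G z := by
  classical
  set K := Metric.closedBall z R' with hKdef
  have hKsub : K ⊆ Metric.ball z R := Metric.closedBall_subset_ball hR
  have hGc : ContinuousOn G K := hG.continuousOn.mono hKsub
  set G' : ℂ → ℂ := K.piecewise G 0 with hG'
  have hG'm : Measurable G' := hGc.measurable_piecewise continuousOn_const Metric.isClosed_closedBall.measurableSet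
  obtain ⟨M, hM⟩ := (isCompact_closedBall z R').exists_bound_of_continuousOn hGc
  have hM0 : 0 ≤ max M 0 := le_max_right _ _
  have hG'b : ∀ w, ‖G' w‖ ≤ max M 0 := by
    intro w
    by_cases hw : w ∈ K
    · rw [hG', piecewise_eq_of_mem _ _ _ hw]; exact (hM w hw).trans (le_max_left _ _)
    · rw [hG', piecewise_eq_of_notMem _ _ _ hw]; simp
  have hmem : ∀ w : ℂ, ‖w‖ ≤ R' → z + w ∈ K := by
    intro w hw; simpa [hKdef, dist_eq_norm] using hw
  have heq : ∀ w : ℂ, (ρ ‖w‖ : ℂ) * G (z + w) = (ρ ‖w‖ : ℂ) * G' (z + w) := by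
    intro w
    by_cases hw : ‖w‖ ≤ R'
    · rw [hG', piecewise_eq_of_mem _ _ _ (hmem w hw)]
    · rw [h0 _ (not_le.1 hw)]; simp
  have hB0 : 0 ≤ B := (abs_nonneg _).trans (hB 0)
  set μ := (volume : Measure ℝ).restrict (Ioc 0 (2 * Real.pi)) with hμ
  set Φ : ℝ → ℂ → ℂ := fun t w => (ρ ‖w‖ : ℂ) * G' (z + circleMap 0 1 t * w) with hΦ
  have hΦm : Measurable (Function.uncurry Φ) := by
    have h1 : Measurable (fun p : ℝ × ℂ => (ρ ‖p.2‖ : ℂ)) :=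
      Complex.measurable_ofReal.comp (hρ.comp measurable_snd.norm)
    have h2 : Measurable (fun p : ℝ × ℂ => z + circleMap 0 1 p.1 * p.2) := by
      have : Continuous (circleMap 0 1) := continuous_circleMap 0 1
      fun_prop
    exact h1.mul (hG'm.comp h2)
  have hdom : Integrable (fun p : ℝ × ℂ => (Metric.closedBall (0 : ℂ) R').indicator (fun _ => B * max M 0) p.2)
      (μ.prod volume) := by
    have hi : Integrable ((Metric.closedBall (0 : ℂ) R').indicator (fun _ => B * max M 0)) volume := by
      rw [integrable_indicator_iff Metric.isClosed_closedBall.measurableSet]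
      exact integrableOn_const (isCompact_closedBall _ _).measure_lt_top.ne
    have := hi.comp_snd μ
    exact this
  have hΦi : Integrable (Function.uncurry Φ) (μ.prod volume) := by
    refine hdom.mono' hΦm.aestronglyMeasurable (Eventually.of_forall ?_)
    rintro ⟨t, w⟩
    simp only [Function.uncurry, hΦ, norm_mul, Complex.norm_real, Real.norm_eq_abs]
    by_cases hw : ‖w‖ ≤ R'
    · rw [indicator_of_mem (by simpa using hw)]
      exact mul_le_mul (hB _) (hG'b _) (norm_nonneg _) hB0
    · rw [indicator_of_notMem (by simpa using hw), h0 _ (not_le.1 hw)]; simp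
  have hswap := integral_integral_swap hΦi
  have hrot : ∀ t, ∫ w, Φ t w = ∫ w, (ρ ‖w‖ : ℂ) * G (z + w) := by
    intro t
    simp only [heq]
    rw [← integral_rot (fun w => (ρ ‖w‖ : ℂ) * G' (z + w)) t]
    simp [hΦ]
  have hcirc : ∀ w, ∫ t, Φ t w ∂μ = ((2 * Real.pi * ρ ‖w‖ : ℝ) : ℂ) * G z := by
    intro w
    by_cases hw : ‖w‖ ≤ R'
    · have hd : DiffContOnCl ℂ (fun ζ => G (z + ζ * w)) (Metric.ball 0 |(1:ℝ)|) := by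
        rw [abs_one]
        have hm : MapsTo (fun ζ : ℂ => z + ζ * w) (Metric.closedBall 0 1) K := by
          intro ζ hζ
          apply hmem
          rw [norm_mul]
          have : ‖ζ‖ ≤ 1 := by simpa using hζ
          nlinarith [norm_nonneg w, norm_nonneg ζ]
        refine ⟨?_, ?_⟩
        · refine hG.comp (Differentiable.differentiableOn (by fun_prop)) ?_
          exact fun ζ hζ => hKsub (hm (Metric.ball_subset_closedBall hζ))
        · rw [closure_ball _ one_ne_zero]
          exact hGc.comp (Continuous.continuousOn (by fun_prop)) hm
      have hca := hd.circleAverage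
      rw [Real.circleAverage] at hca
      simp only [zero_mul, add_zero] at hca
      rw [intervalIntegral.integral_of_le (by positivity)] at hca
      have hpi : (2 * Real.pi) ≠ 0 := by positivity
      rw [inv_smul_eq_iff₀ hpi] at hca
      have : ∀ t, Φ t w = (ρ ‖w‖ : ℂ) * G (z + circleMap 0 1 t * w) := by
        intro t
        simp only [hΦ]
        rw [hG', piecewise_eq_of_mem _ _ _ (hmem _ (by simpa using hw))]
      simp only [this]
      rw [integral_const_mul, hca]
      push_cast
      rw [Complex.real_smul]; push_cast; ring
    · simp [hΦ, h0 _ (not_le.1 hw)]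
  simp only [hrot, hcirc] at hswap
  rw [integral_mul_const, integral_complex_ofReal, integral_const_mul, integral_const] at hswap
  constructor
  · simp only [heq]
    have hi : Integrable ((Metric.closedBall (0 : ℂ) R').indicator (fun _ => B * max M 0)) volume := by
      rw [integrable_indicator_iff Metric.isClosed_closedBall.measurableSet]
      exact integrableOn_const (isCompact_closedBall _ _).measure_lt_top.ne
    refine hi.mono' ?_ (Eventually.of_forall ?_)
    · refine Measurable.aestronglyMeasurable ?_
      exact (Complex.measurable_ofReal.comp (hρ.comp measurable_norm)).mul
        (hG'm.comp (measurable_const.add measurable_id))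
    · intro w
      simp only [norm_mul, Complex.norm_real, Real.norm_eq_abs]
      by_cases hw : ‖w‖ ≤ R'
      · rw [indicator_of_mem (by simpa using hw)]
        exact mul_le_mul (hB _) (hG'b _) (norm_nonneg _) hB0
      · rw [indicator_of_notMem (by simpa using hw), h0 _ (not_le.1 hw)]; simp
  · have hm : μ.real univ = 2 * Real.pi := by
      simp [hμ, Measure.real, Real.pi_pos.le]
    rw [hm, Complex.real_smul] at hswap
    have hpi : ((2 * Real.pi : ℝ) : ℂ) ≠ 0 := by
      exact_mod_cast (by positivity : (2 * Real.pi) ≠ 0)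
    apply mul_left_cancel₀ hpi
    rw [hswap]; push_cast; ring

/-- The sub-mean value property over discs. -/
lemma submean {G : ℂ → ℂ} {z : ℂ} {r R : ℝ} (hr : 0 < r) (hR : r < R)
    (hG : DifferentiableOn ℂ G (Metric.ball z R)) :
    ENNReal.ofReal (Real.pi * r ^ 2 * ‖G z‖ ^ 2) ≤
      ∫⁻ w in Metric.ball z r, ENNReal.ofReal (‖G w‖ ^ 2) := by
  set ρ : ℝ → ℝ := (Iio r).indicator (fun _ => 1) with hρ
  have hm := mean_radial hR (hG.pow 2) (ρ := ρ) (measurable_const.indicator measurableSet_Iio)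
    (B := 1) (fun t => by by_cases h : t < r <;> simp [hρ, h])
    (fun t ht => by simp [hρ, ht.le])
  have hρb : ∀ w : ℂ, ρ ‖w‖ = (Metric.ball (0 : ℂ) r).indicator (fun _ => 1) w := by
    intro w
    by_cases h : ‖w‖ < r <;> simp [hρ, h]
  have hIntg : ∫ w : ℂ, ρ ‖w‖ = Real.pi * r ^ 2 := by
    simp only [hρb]
    rw [integral_indicator Metric.isOpen_ball.measurableSet]
    simp only [integral_const, MeasurableSet.univ, smul_eq_mul, mul_one]
    rw [measureReal_restrict_apply_univ, Measure.real, Complex.volume_ball]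
    simp [hr.le]; ring
  rw [hIntg] at hm
  have key : ‖((Real.pi * r ^ 2 : ℝ) : ℂ) * (G ^ 2) z‖ₑ ≤
      ∫⁻ w, ‖(ρ ‖w‖ : ℂ) * (G ^ 2) (z + w)‖ₑ := by
    rw [← hm.2]; exact enorm_integral_le_lintegral_enorm _
  have e1 : ‖((Real.pi * r ^ 2 : ℝ) : ℂ) * (G ^ 2) z‖ₑ = ENNReal.ofReal (Real.pi * r ^ 2 * ‖G z‖ ^ 2) := by
    rw [← ofReal_norm, norm_mul, Complex.norm_real, Real.norm_of_nonneg (by positivity)]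
    simp
  rw [e1] at key
  refine key.trans (le_of_eq ?_)
  have e2 := lintegral_add_left_eq_self (μ := volume)
    (fun w => (Metric.ball z r).indicator (fun w => ENNReal.ofReal (‖G w‖ ^ 2)) w) z
  rw [← lintegral_indicator Metric.isOpen_ball.measurableSet, ← e2]
  congr 1; ext w
  rw [← ofReal_norm, norm_mul, Complex.norm_real]
  by_cases h : ‖w‖ < r
  · rw [indicator_of_mem (by simpa using h)]
    simp [hρ, h]
  · rw [indicator_of_notMem (by simpa using h)]
    simp [hρ, h]

open ContinuousLinearMap in
lemma conv_swap {p q : ℂ → ℝ} {f : ℂ → ℂ} (hp : Continuous p) (hpc : HasCompactSupport p)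
    (hq : Continuous q) (hqc : HasCompactSupport q) (hf : LocallyIntegrable f) :
    convolution p (convolution q f (lsmul ℝ ℝ) volume) (lsmul ℝ ℝ) volume =
      convolution q (convolution p f (lsmul ℝ ℝ) volume) (lsmul ℝ ℝ) volume := by
  have key : ∀ {p q : ℂ → ℝ}, Continuous p → HasCompactSupport p → Continuous q →
      HasCompactSupport q → ∀ x,
      (convolution (convolution p q (lsmul ℝ ℝ) volume) f (lsmul ℝ ℝ) volume) x =
      convolution p (convolution q f (lsmul ℝ ℝ) volume) (lsmul ℝ ℝ) volume x := by
    intro p q hp hpc hq hqc x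
    have hf' : LocallyIntegrable (fun x => ‖f x‖) := fun x => (hf x).norm
    refine convolution_assoc (lsmul ℝ ℝ) (lsmul ℝ ℝ) (lsmul ℝ ℝ) (lsmul ℝ ℝ) ?_ ?_ ?_ ?_ ?_ ?_ ?_
    · intro x y z; simp [mul_assoc]
    · exact hp.aestronglyMeasurable
    · exact hq.aestronglyMeasurable
    · exact hf.aestronglyMeasurable
    · exact Eventually.of_forall fun y => hpc.convolutionExists_left _ hp hq.locallyIntegrable y
    · exact Eventually.of_forall fun y => hqc.norm.convolutionExists_left _ hq.norm hf' y
    · refine hpc.norm.convolutionExists_left _ hp.norm ?_ x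
      exact (hqc.norm.continuous_convolution_left _ hq.norm hf').locallyIntegrable
  ext x
  rw [← key hp hpc hq hqc, ← key hq hqc hp hpc]
  congr 1
  ext y
  rw [convolution_eq_swap, convolution_def]
  congr 1; ext t
  simp [mul_comm]

open ContinuousLinearMap in
lemma holo_conv {h f : ℂ → ℂ} (hw : ∀ η ∈ testSub, ∫ z, h z * dbar η z = 0)
    {k : ℂ → ℝ} (hk : ContDiff ℝ 2 k) {r s : ℝ} (hs : s ≤ 1)
    (hsupp : ∀ z : ℂ, r ≤ ‖z‖ → k z = 0)
    (hf : LocallyIntegrable f) (hfh : ∀ z ∈ Metric.ball (0 : ℂ) s, f z = h z) :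
    DifferentiableOn ℂ (convolution k f (lsmul ℝ ℝ) volume) (Metric.ball 0 (s - r)) := by
  have hsub : tsupport k ⊆ Metric.closedBall 0 r := by
    refine closure_minimal ?_ Metric.isClosed_closedBall
    intro z hz
    by_contra h'
    exact hz (hsupp z (by simpa using (not_le.1 (by simpa using h')).le))
  have hkc : HasCompactSupport k := HasCompactSupport.of_support_subset_isCompact
    (isCompact_closedBall 0 r) (subset_closure.trans hsub)
  intro x hx
  have hx' : ‖x‖ < s - r := by simpa using hx
  have hF := hkc.hasFDerivAt_convolution_left (lsmul ℝ ℝ) (hk.of_le (by norm_num)) hf x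
  refine DifferentiableAt.differentiableWithinAt ?_
  rw [differentiableAt_complex_iff_differentiableAt_real]
  refine ⟨hF.differentiableAt, ?_⟩
  rw [hF.fderiv]
  have hfc : Continuous (fderiv ℝ k) := hk.continuous_fderiv (by norm_num)
  have hex := (hkc.fderiv ℝ).convolutionExists_left ((lsmul ℝ ℝ : ℝ →L[ℝ] ℂ →L[ℝ] ℂ).precompL ℂ)
    hfc hf x
  have happ : ∀ v, (convolution (fderiv ℝ k) f ((lsmul ℝ ℝ : ℝ →L[ℝ] ℂ →L[ℝ] ℂ).precompL ℂ) volume x) v =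
      ∫ t, (fderiv ℝ k (x - t) v : ℂ) * f t := by
    intro v
    rw [convolution_def, ContinuousLinearMap.integral_apply hex,
      ← integral_sub_left_eq_self _ volume x]
    congr 1; ext t
    rw [precompL_apply]
    simp
  set η : ℂ → ℂ := fun t => (k (x - t) : ℂ) with hη
  have hηsub : tsupport η ⊆ Metric.closedBall x r := by
    refine closure_minimal ?_ Metric.isClosed_closedBall
    intro z hz
    by_contra h'
    apply hz
    simp only [hη]
    rw [hsupp]; · simp
    have h2 := (not_le.1 (by simpa [dist_eq_norm] using h')).le
    rwa [norm_sub_rev] at h2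
  have hsub2 : Metric.closedBall x r ⊆ Metric.ball 0 s := by
    intro z hz
    have : ‖z - x‖ ≤ r := by simpa [dist_eq_norm] using hz
    have h3 : ‖z‖ ≤ ‖z - x‖ + ‖x‖ := by simpa using norm_add_le (z - x) x
    simp; linarith
  have hηd : ContDiff ℝ 2 η := Complex.ofRealCLM.contDiff.comp (hk.comp (contDiff_const.sub contDiff_id))
  have hηt : η ∈ testSub := by
    refine ⟨hηd, ?_, ?_⟩
    · exact HasCompactSupport.of_support_subset_isCompact (isCompact_closedBall x r)
        (subset_closure.trans hηsub)
    · exact hηsub.trans (hsub2.trans (Metric.ball_subset_ball hs))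
  have hder : ∀ t v, fderiv ℝ η t v = -(fderiv ℝ k (x - t) v : ℂ) := by
    intro t v
    have h1 : HasFDerivAt k (fderiv ℝ k (x - t)) (x - t) := (hk.differentiable (by norm_num) _).hasFDerivAt
    have h2 : HasFDerivAt (fun t : ℂ => x - t) (-(ContinuousLinearMap.id ℝ ℂ)) t :=
      (hasFDerivAt_id t).const_sub x
    have h3 : HasFDerivAt η _ t := Complex.ofRealCLM.hasFDerivAt.comp t (h1.comp t h2)
    rw [h3.fderiv]; simp
  have hIntg : ∀ v, Integrable (fun t => (fderiv ℝ k (x - t) v : ℂ) * f t) := by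
    intro v
    have := hf.integrable_smul_left_of_hasCompactSupport
      (g := fun t => fderiv ℝ η t v) ((hηd.continuous_fderiv (by norm_num)).clm_apply continuous_const)
      (hηt.2.1.fderiv_apply ℝ v)
    refine this.neg.congr (Eventually.of_forall fun t => ?_)
    simp [hder]
  have hzero := hw η hηt
  have e : ∫ z, h z * dbar η z = -(1/2) * ((∫ t, (fderiv ℝ k (x - t) 1 : ℂ) * f t) +
      Complex.I * ∫ t, (fderiv ℝ k (x - t) Complex.I : ℂ) * f t) := by
    rw [← integral_const_mul, ← integral_add (hIntg 1) ((hIntg _).const_mul _), ← integral_const_mul]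
    congr 1; ext t
    by_cases ht : t ∈ Metric.ball (0 : ℂ) s
    · rw [← hfh t ht, dbar, hder, hder]; ring
    · have ht' : t ∉ tsupport η := fun h => ht (hsub2 (hηsub h))
      have hfd : ∀ v, fderiv ℝ k (x - t) v = 0 := by
        intro v
        have h1 := hder t v
        have h2 : fderiv ℝ η t = 0 := by
          by_contra h3
          exact ht' (support_fderiv_subset ℝ h3)
        rw [h2] at h1
        have := h1.symm
        simpa using this
      rw [dbar_eq_zero_of_notMem ht', hfd, hfd]; simp
  rw [hzero] at e
  rw [happ, happ, smul_eq_mul]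
  set a := ∫ t, (fderiv ℝ k (x - t) 1 : ℂ) * f t
  set b := ∫ t, (fderiv ℝ k (x - t) Complex.I : ℂ) * f t
  have e2 : a + Complex.I * b = 0 := by linear_combination (2) * e
  have : Complex.I * (a + Complex.I * b) = 0 := by rw [e2, mul_zero]
  rw [mul_add, ← mul_assoc, Complex.I_mul_I] at this
  linear_combination -this

/-- A smooth radial normalized kernel. -/
lemma exists_radial_kernel {ε : ℝ} (hε : 0 < ε) : ∃ ψ : ℝ → ℝ, Continuous ψ ∧ (∃ B, ∀ t, |ψ t| ≤ B) ∧
    (∀ t, ε ≤ |t| → ψ t = 0) ∧ ContDiff ℝ 2 (fun w : ℂ => ψ ‖w‖) ∧ ∫ w : ℂ, ψ ‖w‖ = 1 := by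
  set ψ0 : ℝ → ℝ := fun t => Real.smoothTransition (2 - 2 * t ^ 2 / ε ^ 2) with hψ0
  have hc0 : Continuous ψ0 := by
    have := Real.smoothTransition.continuous
    fun_prop
  have h0 : ∀ t, ε ≤ |t| → ψ0 t = 0 := by
    intro t ht
    apply Real.smoothTransition.zero_of_nonpos
    have : ε ^ 2 ≤ t ^ 2 := by rw [← sq_abs t]; gcongr
    have : 1 ≤ t ^ 2 / ε ^ 2 := by rw [le_div_iff₀ (by positivity)]; linarith
    rw [mul_div_assoc]; linarith
  have hcd : ContDiff ℝ 2 (fun w : ℂ => ψ0 ‖w‖) := by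
    simp only [hψ0]
    have h1 : ContDiff ℝ 2 (fun w : ℂ => ‖w‖ ^ 2) := contDiff_norm_sq ℝ
    exact Real.smoothTransition.contDiff.comp (contDiff_const.sub ((contDiff_const.mul h1).div_const _))
  have hcs : HasCompactSupport (fun w : ℂ => ψ0 ‖w‖) := by
    refine HasCompactSupport.intro (isCompact_closedBall (0 : ℂ) ε) ?_
    intro w hw
    apply h0
    rw [abs_norm]
    simpa using (not_le.1 (by simpa using hw)).le
  have hnn : ∀ t, 0 ≤ ψ0 t := fun t => Real.smoothTransition.nonneg _
  have hI : 0 < ∫ w : ℂ, ψ0 ‖w‖ := by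
    refine Continuous.integral_pos_of_hasCompactSupport_nonneg_nonzero hcd.continuous hcs
      (fun w => hnn _) (x := 0) ?_
    simp [hψ0]
  refine ⟨fun t => (∫ w : ℂ, ψ0 ‖w‖)⁻¹ * ψ0 t, continuous_const.mul hc0,
    ⟨(∫ w : ℂ, ψ0 ‖w‖)⁻¹, ?_⟩, ?_, contDiff_const.mul hcd, ?_⟩
  · intro t
    rw [abs_of_nonneg (mul_nonneg (inv_nonneg.2 hI.le) (hnn t))]
    exact mul_le_of_le_one_right (inv_nonneg.2 hI.le) (Real.smoothTransition.le_one _)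
  · intro t ht; simp only [h0 t ht, mul_zero]
  · rw [integral_const_mul, inv_mul_cancel₀ hI.ne']

open ContinuousLinearMap in
lemma weyl_local {h : ℂ → ℂ} (hl : LocallyIntegrableOn h unitDisc)
    (hw : ∀ η ∈ testSub, ∫ z, h z * dbar η z = 0) {s : ℝ} (hs0 : 0 < s) (hs : s < 1) :
    ∃ H : ℂ → ℂ, DifferentiableOn ℂ H (Metric.ball 0 s) ∧
      ∀ᵐ z, z ∈ Metric.ball (0 : ℂ) s → h z = H z := by
  set ε := (1 - s) / 4 with hε
  have hε0 : 0 < ε := by rw [hε]; linarith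
  set s' := s + 3 * ε with hs'
  have hs'1 : s' < 1 := by rw [hs', hε]; linarith
  set f : ℂ → ℂ := (Metric.ball (0 : ℂ) s').indicator h with hf
  have hfi : Integrable f := by
    rw [hf, integrable_indicator_iff Metric.isOpen_ball.measurableSet]
    have : IntegrableOn h (Metric.closedBall 0 s') :=
      hl.integrableOn_compact_subset (Metric.closedBall_subset_ball hs'1) (isCompact_closedBall _ _)
    exact this.mono_set Metric.ball_subset_closedBall
  have hfl := hfi.locallyIntegrable
  have hfh : ∀ z ∈ Metric.ball (0 : ℂ) s', f z = h z := fun z hz => by rw [hf, indicator_of_mem hz]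
  obtain ⟨ψ, hψc, ⟨B, hB⟩, hψ0, hψd, hψ1⟩ := exists_radial_kernel hε0
  set k : ℂ → ℝ := fun w => ψ ‖w‖ with hk
  have hkc : HasCompactSupport k := by
    refine HasCompactSupport.intro (isCompact_closedBall (0 : ℂ) ε) ?_
    intro w hw
    apply hψ0
    rw [abs_norm]
    simpa using (not_le.1 (by simpa using hw)).le
  have hH := holo_conv hw hψd (r := ε) hs'1.le (fun z hz => hψ0 _ (by rwa [abs_norm])) hfl hfh
  have hss : Metric.ball (0 : ℂ) s ⊆ Metric.ball 0 (s' - ε) :=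
    Metric.ball_subset_ball (by rw [hs']; linarith)
  refine ⟨convolution k f (lsmul ℝ ℝ) volume, hH.mono hss, ?_⟩
  let bmp : ℕ → ContDiffBump (0 : ℂ) := fun n =>
    { rIn := ε / (2 * (n + 1))
      rOut := ε / (n + 1)
      rIn_pos := by positivity
      rIn_lt_rOut := by
        apply div_lt_div_of_pos_left hε0 (by positivity)
        have : (0 : ℝ) ≤ n := Nat.cast_nonneg n
        linarith }
  have hr0 : Tendsto (fun i => (bmp i).rOut) atTop (nhds 0) := by
    have := (tendsto_one_div_add_atTop_nhds_zero_nat (𝕜 := ℝ)).const_mul ε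
    simpa [bmp, div_eq_mul_inv] using this
  have hae := ContDiffBump.ae_convolution_tendsto_right_of_locallyIntegrable (μ := (volume : Measure ℂ))
    (φ := bmp) (l := atTop) (K := 2) hr0 (Eventually.of_forall fun n => by
      simp only [bmp]; field_simp; rfl) hfl
  filter_upwards [hae] with x hx hxs
  have hcH : Continuous (convolution k f (lsmul ℝ ℝ) volume) :=
    hkc.continuous_convolution_left _ hψd.continuous hfl
  have hlim2 := ContDiffBump.convolution_tendsto_right_of_continuous (μ := (volume : Measure ℂ)) hr0 hcH x
  have hxs' : ‖x‖ < s := by simpa using hxs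
  have hEq : ∀ n, (convolution ((bmp n).normed volume) f (lsmul ℝ ℝ) volume) x =
      (convolution ((bmp n).normed volume) (convolution k f (lsmul ℝ ℝ) volume) (lsmul ℝ ℝ) volume) x := by
    intro n
    have hbc : HasCompactSupport ((bmp n).normed (volume : Measure ℂ)) := (bmp n).hasCompactSupport_normed
    have hbcont : Continuous ((bmp n).normed (volume : Measure ℂ)) := (bmp n).continuous_normed
    rw [conv_swap hbcont hbc hψd.continuous hkc hfl]
    have hro : (bmp n).rOut ≤ ε := by
      simp only [bmp]
      apply div_le_self hε0.le
      have : (0 : ℝ) ≤ n := Nat.cast_nonneg n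
      linarith
    have hGn := holo_conv hw (k := (bmp n).normed (volume : Measure ℂ)) (r := ε)
      ((bmp n).contDiff_normed) hs'1.le (fun z hz => by
        have : z ∉ Function.support ((bmp n).normed (volume : Measure ℂ)) := by
          rw [ContDiffBump.support_normed_eq]
          simp; linarith
        simpa using this) hfl hfh
    set G := convolution ((bmp n).normed volume) f (lsmul ℝ ℝ) volume
    have hball : Metric.ball x (2 * ε) ⊆ Metric.ball 0 (s' - ε) := by
      intro z hz
      have : ‖z - x‖ < 2 * ε := by simpa [dist_eq_norm] using hz
      have h3 : ‖z‖ ≤ ‖z - x‖ + ‖x‖ := by simpa using norm_add_le (z - x) x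
      simp; rw [hs']; linarith
    have hm := (mean_radial (R' := ε) (by linarith) (hGn.mono hball) hψc.measurable hB
      (fun t ht => hψ0 t (ht.le.trans (le_abs_self t)))).2
    rw [hψ1] at hm
    rw [convolution_def]
    simp only [lsmul_apply, Complex.real_smul]
    rw [← integral_neg_eq_self]
    simp only [sub_neg_eq_add, hk, norm_neg]
    rw [hm]; simp
  have hx2 : Tendsto (fun i => (convolution ((bmp i).normed volume) f (lsmul ℝ ℝ) volume) x) atTop
      (nhds (convolution k f (lsmul ℝ ℝ) volume x)) := by
    simp only [hEq]; exact hlim2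
  have := tendsto_nhds_unique hx hx2
  rw [← this]
  exact (hfh x (by simp; rw [hs']; linarith)).symm

lemma eqOn_of_ae_eq_ball {F G : ℂ → ℂ} {U : Set ℂ} (hU : IsOpen U) (hF : ContinuousOn F U)
    (hG : ContinuousOn G U) (h : ∀ᵐ z, z ∈ U → F z = G z) : EqOn F G U := by
  refine Measure.eqOn_open_of_ae_eq (μ := volume) ?_ hU hF hG
  rw [EventuallyEq, ae_restrict_iff' hU.measurableSet]
  exact h

lemma weyl {h : ℂ → ℂ} (hl : LocallyIntegrableOn h unitDisc)
    (hw : ∀ η ∈ testSub, ∫ z, h z * dbar η z = 0) :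
    ∃ H : ℂ → ℂ, DifferentiableOn ℂ H unitDisc ∧ ∀ᵐ z, z ∈ unitDisc → h z = H z := by
  let s : ℕ → ℝ := fun n => 1 - 1 / (n + 2)
  have hs0 : ∀ n, 0 < s n := by
    intro n
    have : (0 : ℝ) ≤ n := Nat.cast_nonneg n
    simp only [s]
    rw [sub_pos, div_lt_one (by linarith)]; linarith
  have hs1 : ∀ n, s n < 1 := by
    intro n
    have : (0 : ℝ) ≤ n := Nat.cast_nonneg n
    simp only [s]
    have : 0 < 1 / ((n : ℝ) + 2) := by positivity
    linarith
  have hsl : Tendsto s atTop (nhds 1) := by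
    have h1 := (tendsto_one_div_add_atTop_nhds_zero_nat (𝕜 := ℝ)).comp (tendsto_add_atTop_nat 1)
    have h2 := h1.const_sub 1
    simp only [sub_zero] at h2
    refine h2.congr fun n => ?_
    simp only [s, Function.comp]
    push_cast; ring
  choose Hn hHd hHe using fun n => weyl_local hl hw (hs0 n) (hs1 n)
  have hagree : ∀ n m z, z ∈ Metric.ball (0 : ℂ) (s n) → z ∈ Metric.ball (0 : ℂ) (s m) → Hn n z = Hn m z := by
    intro n m z hz1 hz2
    refine eqOn_of_ae_eq_ball (U := Metric.ball (0 : ℂ) (s n) ∩ Metric.ball (0 : ℂ) (s m))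
      (Metric.isOpen_ball.inter Metric.isOpen_ball) ((hHd n).continuousOn.mono inter_subset_left)
      ((hHd m).continuousOn.mono inter_subset_right) ?_ ⟨hz1, hz2⟩
    filter_upwards [hHe n, hHe m] with w h1 h2 hw'
    rw [← h1 hw'.1, h2 hw'.2]
  have hex : ∀ z ∈ unitDisc, ∃ n, z ∈ Metric.ball (0 : ℂ) (s n) := by
    intro z hz
    have hz' : ‖z‖ < 1 := by simpa [unitDisc] using hz
    obtain ⟨n, hn⟩ := ((tendsto_order.1 hsl).1 _ hz').exists
    exact ⟨n, by simpa using hn⟩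
  classical
  let H : ℂ → ℂ := fun z => if hz : ∃ n, z ∈ Metric.ball (0 : ℂ) (s n) then Hn hz.choose z else 0
  have hHn : ∀ n z, z ∈ Metric.ball (0 : ℂ) (s n) → H z = Hn n z := by
    intro n z hz
    have hz' : ∃ n, z ∈ Metric.ball (0 : ℂ) (s n) := ⟨n, hz⟩
    simp only [H, dif_pos hz']
    exact hagree _ _ z hz'.choose_spec hz
  refine ⟨H, ?_, ?_⟩
  · intro z hz
    obtain ⟨n, hn⟩ := hex z hz
    have hd := (hHd n).differentiableAt (Metric.isOpen_ball.mem_nhds hn)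
    refine (hd.congr_of_eventuallyEq ?_).differentiableWithinAt
    filter_upwards [Metric.isOpen_ball.mem_nhds hn] with w hw'
    exact hHn n w hw'
  · have := ae_all_iff.2 hHe
    filter_upwards [this] with z hz hzD
    obtain ⟨n, hn⟩ := hex z hzD
    rw [hz n hn, hHn n z hn]

/-- Hörmander's theorem. -/
lemma hormander {θ : ℂ → ℝ} (hθ : ContDiffOn ℝ 2 θ unitDisc)
    (hpos : ∀ z ∈ unitDisc, 0 < laplacian θ z) {u0 : ℂ → ℂ} (hu : ContDiffOn ℝ 1 u0 unitDisc)
    {K : ℝ} (hK : 0 ≤ K)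
    (hb : ∫⁻ z in unitDisc, ENNReal.ofReal (‖dbar u0 z‖ ^ 2 / laplacian θ z * Real.exp (-(2 * θ z))) ≤
      ENNReal.ofReal K) :
    ∃ h : ℂ → ℂ, DifferentiableOn ℂ h unitDisc ∧
      ∫⁻ z in unitDisc, ENNReal.ofReal (‖u0 z - h z‖ ^ 2 * Real.exp (-(2 * θ z))) ≤
        ENNReal.ofReal (2 * K) := by
  obtain ⟨h, h1, h2, h3⟩ := hormander_weak hθ hpos hu hK hb
  obtain ⟨H, hH, he⟩ := weyl h1 h2
  refine ⟨H, hH, le_trans (le_of_eq ?_) h3⟩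
  refine lintegral_congr_ae ?_
  rw [EventuallyEq, ae_restrict_iff' measurableSet_unitDisc]
  filter_upwards [he] with z hz hzD
  rw [hz hzD]

lemma mem_unitDisc {z : ℂ} : z ∈ unitDisc ↔ ‖z‖ < 1 := by simp [unitDisc]

lemma mTau_pos {c₁ c₂ : ℝ} (h1 : 0 < c₁) (h2 : 0 < c₂) : 0 < mTau c₁ c₂ := by
  unfold mTau; positivity

lemma mTau_le {c₁ c₂ : ℝ} (h1 : 0 < c₁) (h2 : 0 < c₂) :
    mTau c₁ c₂ ≤ 1/4 ∧ mTau c₁ c₂ * c₁ ≤ 1/4 ∧ mTau c₁ c₂ * c₂ ≤ 1/4 := by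
  unfold mTau
  have a1 : min 1 (min c₁⁻¹ c₂⁻¹) ≤ 1 := min_le_left _ _
  have a2 : min 1 (min c₁⁻¹ c₂⁻¹) ≤ c₁⁻¹ := (min_le_right _ _).trans (min_le_left _ _)
  have a3 : min 1 (min c₁⁻¹ c₂⁻¹) ≤ c₂⁻¹ := (min_le_right _ _).trans (min_le_right _ _)
  have b2 : min 1 (min c₁⁻¹ c₂⁻¹) * c₁ ≤ 1 := by
    have := mul_le_mul_of_nonneg_right a2 h1.le
    rwa [inv_mul_cancel₀ h1.ne'] at this
  have b3 : min 1 (min c₁⁻¹ c₂⁻¹) * c₂ ≤ 1 := by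
    have := mul_le_mul_of_nonneg_right a3 h2.le
    rwa [inv_mul_cancel₀ h2.ne'] at this
  refine ⟨by linarith, by linarith, by linarith⟩

section geom
variable {τ : ℝ → ℝ} {c₁ c₂ : ℝ}

lemma tau_pos' (hL : IsClassL (radialize τ) c₁ c₂) {z : ℂ} (hz : z ∈ unitDisc) : 0 < τ ‖z‖ := hL.pos z hz

/-- Elementary geometry of the discs `D(δτ(z))`. -/
lemma geom (hL : IsClassL (radialize τ) c₁ c₂) {z w : ℂ} (hz : z ∈ unitDisc)
    (hw : ‖w - z‖ ≤ mTau c₁ c₂ * τ ‖z‖) :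
    w ∈ unitDisc ∧ 3/4 * τ ‖z‖ ≤ τ ‖w‖ ∧ τ ‖w‖ ≤ 5/4 * τ ‖z‖ := by
  obtain ⟨m1, m2, m3⟩ := mTau_le hL.c₁_pos hL.c₂_pos
  have hm := mTau_pos hL.c₁_pos hL.c₂_pos
  have ht : 0 < τ ‖z‖ := hL.pos z hz
  have hu : τ ‖z‖ ≤ c₁ * (1 - ‖z‖) := hL.upper z hz
  have hz1 := mem_unitDisc.1 hz
  have hwD : w ∈ unitDisc := by
    rw [mem_unitDisc]
    have h3 : ‖w‖ ≤ ‖w - z‖ + ‖z‖ := by simpa using norm_add_le (w - z) z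
    have : mTau c₁ c₂ * τ ‖z‖ ≤ 1/4 * (1 - ‖z‖) := by
      calc mTau c₁ c₂ * τ ‖z‖ ≤ mTau c₁ c₂ * (c₁ * (1 - ‖z‖)) := by gcongr
        _ = (mTau c₁ c₂ * c₁) * (1 - ‖z‖) := by ring
        _ ≤ _ := by apply mul_le_mul_of_nonneg_right m2; linarith
    linarith
  refine ⟨hwD, ?_⟩
  have hl : |τ ‖w‖ - τ ‖z‖| ≤ c₂ * ‖w - z‖ := hL.lip w hwD z hz
  have : c₂ * ‖w - z‖ ≤ 1/4 * τ ‖z‖ := by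
    calc c₂ * ‖w - z‖ ≤ c₂ * (mTau c₁ c₂ * τ ‖z‖) := by
          apply mul_le_mul_of_nonneg_left hw hL.c₂_pos.le
      _ = (mTau c₁ c₂ * c₂) * τ ‖z‖ := by ring
      _ ≤ _ := mul_le_mul_of_nonneg_right m3 ht.le
  have h2 := abs_le.1 (hl.trans this)
  constructor <;> linarith [h2.1, h2.2]

lemma closedBall_sub (hL : IsClassL (radialize τ) c₁ c₂) {z : ℂ} (hz : z ∈ unitDisc) :
    Metric.closedBall z (mTau c₁ c₂ * τ ‖z‖) ⊆ unitDisc := by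
  intro w hw
  exact (geom hL hz (by simpa [dist_eq_norm] using hw)).1

lemma lap_bounds {ω φ : ℂ → ℝ} (hW : IsClassW ω φ τ) : ∃ C : ℝ, 1 ≤ C ∧ ∀ z ∈ unitDisc,
    1 / (C * τ ‖z‖ ^ 2) ≤ laplacian φ z ∧ laplacian φ z ≤ C / τ ‖z‖ ^ 2 := by
  obtain ⟨C, hC, h⟩ := hW.comp
  refine ⟨C ^ 2, one_le_pow₀ hC, fun z hz => ?_⟩
  obtain ⟨h1, h2⟩ := h z hz
  have hl := hW.lap_pos z hz
  have ht : 0 < τ ‖z‖ := hW.tau_pos _ ⟨norm_nonneg _, mem_unitDisc.1 hz⟩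
  have e : (laplacian φ z) ^ (-(1 / 2 : ℝ)) = (Real.sqrt (laplacian φ z))⁻¹ := by
    rw [Real.rpow_neg hl.le, Real.sqrt_eq_rpow]
  rw [e] at h1 h2
  have hs : 0 < Real.sqrt (laplacian φ z) := Real.sqrt_pos.2 hl
  have hsq := Real.sq_sqrt hl.le
  set s := Real.sqrt (laplacian φ z)
  have hC0 : 0 < C := by linarith
  constructor
  · rw [div_le_iff₀ (by positivity), ← hsq]
    have : 1 ≤ s * (C * τ ‖z‖) := by
      have := mul_le_mul_of_nonneg_left h2 hs.le
      rwa [mul_inv_cancel₀ hs.ne'] at this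
    nlinarith
  · rw [le_div_iff₀ (by positivity), ← hsq]
    have : s * τ ‖z‖ ≤ C := by
      have := mul_le_mul_of_nonneg_left h1 hs.le
      rw [mul_inv_cancel₀ hs.ne', ← mul_div_assoc, div_le_one hC0] at this
      exact this
    have h0 : 0 ≤ s * τ ‖z‖ := by positivity
    nlinarith
end geom

section hess
variable {φ : ℂ → ℝ}

lemma hasFDerivAt_fderiv_disc (hφ : ContDiffOn ℝ 2 φ unitDisc) {z : ℂ} (hz : z ∈ unitDisc) :
    HasFDerivAt (fderiv ℝ φ) (fderiv ℝ (fderiv ℝ φ) z) z := by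
  have h := hφ.fderiv_of_isOpen (m := 1) isOpen_unitDisc (by norm_num)
  exact ((h.differentiableOn one_ne_zero).differentiableAt (isOpen_unitDisc.mem_nhds hz)).hasFDerivAt

lemma laplacian_eq (hφ : ContDiffOn ℝ 2 φ unitDisc) {z : ℂ} (hz : z ∈ unitDisc) :
    laplacian φ z = fderiv ℝ (fderiv ℝ φ) z 1 1 + fderiv ℝ (fderiv ℝ φ) z Complex.I Complex.I := by
  have h := hasFDerivAt_fderiv_disc hφ hz
  have h' : ∀ v, fderiv ℝ (fun w => fderiv ℝ φ w v) z = (fderiv ℝ (fderiv ℝ φ) z).flip v := by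
    intro v
    have := h.clm_apply (hasFDerivAt_const v z)
    rw [this.fderiv]; ext; simp
  unfold laplacian
  rw [h', h']; simp

lemma radial_fderiv (hφ : ContDiffOn ℝ 2 φ unitDisc)
    (hr : ∀ z ∈ unitDisc, ∀ ζ ∈ unitDisc, ‖z‖ = ‖ζ‖ → φ z = φ ζ) {z : ℂ} (hz : z ∈ unitDisc) :
    fderiv ℝ φ z (Complex.I * z) = 0 := by
  have hd : HasFDerivAt φ (fderiv ℝ φ z) z :=
    ((hφ.differentiableOn (by norm_num)).differentiableAt (isOpen_unitDisc.mem_nhds hz)).hasFDerivAt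
  have hc : HasDerivAt (fun t : ℝ => circleMap 0 1 t * z) (Complex.I * z) 0 := by
    have := (hasDerivAt_circleMap 0 1 0).mul_const z
    simpa [circleMap] using this
  have hcomp : HasDerivAt (fun t : ℝ => φ (circleMap 0 1 t * z)) (fderiv ℝ φ z (Complex.I * z)) 0 := by
    have hd' : HasFDerivAt φ (fderiv ℝ φ z) (circleMap 0 1 0 * z) := by simpa [circleMap] using hd
    exact hd'.comp_hasDerivAt 0 hc
  have hconst : (fun t : ℝ => φ (circleMap 0 1 t * z)) = fun _ => φ z := by
    ext t
    have hn : ‖circleMap 0 1 t * z‖ = ‖z‖ := by simp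
    exact hr _ (by rw [mem_unitDisc, hn]; exact mem_unitDisc.1 hz) _ hz hn
  rw [hconst] at hcomp
  exact hcomp.unique (hasDerivAt_const 0 (φ z))

lemma radial_snd (hφ : ContDiffOn ℝ 2 φ unitDisc)
    (hr : ∀ z ∈ unitDisc, ∀ ζ ∈ unitDisc, ‖z‖ = ‖ζ‖ → φ z = φ ζ) {z : ℂ} (hz : z ∈ unitDisc) (v : ℂ) :
    fderiv ℝ (fderiv ℝ φ) z v (Complex.I * z) = - fderiv ℝ φ z (Complex.I * v) := by
  have h := hasFDerivAt_fderiv_disc hφ hz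
  have hl : HasFDerivAt (fun w : ℂ => Complex.I * w) ((ContinuousLinearMap.mul ℝ ℂ) Complex.I) z :=
    ((ContinuousLinearMap.mul ℝ ℂ) Complex.I).hasFDerivAt
  have h1 := h.clm_apply hl
  have h0 : (fun w => fderiv ℝ φ w (Complex.I * w)) =ᶠ[nhds z] fun _ => 0 := by
    filter_upwards [isOpen_unitDisc.mem_nhds hz] with w hw
    exact radial_fderiv hφ hr hw
  have h2 := h1.congr_of_eventuallyEq h0.symm
  have h3 := h2.unique (hasFDerivAt_const (0 : ℝ) z)
  have h4 := congrArg (fun L => L v) h3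
  simp at h4
  linarith

lemma trace_eq (hφ : ContDiffOn ℝ 2 φ unitDisc) {z : ℂ} (hz : z ∈ unitDisc) (u : ℂ) :
    fderiv ℝ (fderiv ℝ φ) z u u + fderiv ℝ (fderiv ℝ φ) z (Complex.I * u) (Complex.I * u) =
      ‖u‖ ^ 2 * laplacian φ z := by
  rw [laplacian_eq hφ hz]
  set D := fderiv ℝ (fderiv ℝ φ) z
  have e1 : u = u.re • (1 : ℂ) + u.im • Complex.I := by
    simp [Complex.re_add_im]
  have e2 : Complex.I * u = (-u.im) • (1 : ℂ) + u.re • Complex.I := by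
    apply Complex.ext <;> simp
  have e3 : ‖u‖ ^ 2 = u.re ^ 2 + u.im ^ 2 := by
    rw [← Complex.normSq_eq_norm_sq, Complex.normSq_apply]; ring
  rw [e3, e2]
  have : D u u = D (u.re • (1 : ℂ) + u.im • Complex.I) (u.re • (1 : ℂ) + u.im • Complex.I) := by
    rw [← e1]
  rw [this]
  simp only [map_add, map_smul, ContinuousLinearMap.add_apply, ContinuousLinearMap.smul_apply,
    smul_eq_mul]
  ring

lemma radial_first (hφ : ContDiffOn ℝ 2 φ unitDisc)
    (hr : ∀ z ∈ unitDisc, ∀ ζ ∈ unitDisc, ‖z‖ = ‖ζ‖ → φ z = φ ζ) {z : ℂ} (hz : z ∈ unitDisc)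
    {M : ℝ} (hM : ∀ w, ‖w‖ ≤ ‖z‖ → 0 ≤ laplacian φ w ∧ laplacian φ w ≤ M) :
    0 ≤ fderiv ℝ φ z z ∧ fderiv ℝ φ z z ≤ M * ‖z‖ ^ 2 / 2 := by
  set G : ℝ → ℝ := fun t => fderiv ℝ φ ((t : ℂ) * z) ((t : ℂ) * z) with hG
  have hmem : ∀ t ∈ Icc (0:ℝ) 1, ((t : ℂ) * z) ∈ unitDisc ∧ ‖(t : ℂ) * z‖ = t * ‖z‖ := by
    intro t ht
    have : ‖(t : ℂ) * z‖ = t * ‖z‖ := by simp [abs_of_nonneg ht.1]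
    refine ⟨?_, this⟩
    rw [mem_unitDisc, this]
    have := mem_unitDisc.1 hz
    nlinarith [ht.1, ht.2, norm_nonneg z]
  have hder : ∀ t ∈ Icc (0:ℝ) 1, HasDerivAt G
      (fderiv ℝ (fderiv ℝ φ) ((t : ℂ) * z) z ((t : ℂ) * z) + fderiv ℝ φ ((t : ℂ) * z) z) t := by
    intro t ht
    have hl : HasDerivAt (fun t : ℝ => (t : ℂ) * z) z t := by
      have := (Complex.ofRealCLM.hasDerivAt (x := t)).mul_const z
      simpa using this
    have h1 := (hasFDerivAt_fderiv_disc hφ (hmem t ht).1).comp_hasDerivAt t hl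
    exact h1.clm_apply hl
  have hder2 : ∀ t ∈ Ioo (0:ℝ) 1,
      fderiv ℝ (fderiv ℝ φ) ((t : ℂ) * z) z ((t : ℂ) * z) + fderiv ℝ φ ((t : ℂ) * z) z =
      t * ‖z‖ ^ 2 * laplacian φ ((t : ℂ) * z) := by
    intro t ht
    have ht' : t ∈ Icc (0:ℝ) 1 := ⟨ht.1.le, ht.2.le⟩
    obtain ⟨hm, hn⟩ := hmem t ht'
    have h1 := trace_eq hφ hm ((t : ℂ) * z)
    rw [radial_snd hφ hr hm, ← mul_assoc Complex.I Complex.I, Complex.I_mul_I, hn] at h1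
    have hs : (t : ℂ) * z = t • z := by simp
    have h2 : fderiv ℝ (fderiv ℝ φ) ((t : ℂ) * z) ((t : ℂ) * z) ((t : ℂ) * z) =
        t * fderiv ℝ (fderiv ℝ φ) ((t : ℂ) * z) z ((t : ℂ) * z) := by
      have : fderiv ℝ (fderiv ℝ φ) ((t : ℂ) * z) ((t : ℂ) * z) =
          t • fderiv ℝ (fderiv ℝ φ) ((t : ℂ) * z) z := by
        conv_lhs => rw [show fderiv ℝ (fderiv ℝ φ) ((t : ℂ) * z) ((t : ℂ) * z) =
          fderiv ℝ (fderiv ℝ φ) ((t : ℂ) * z) (t • z) by rw [hs]]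
        rw [map_smul]
      rw [this]; simp
    have h3 : fderiv ℝ φ ((t : ℂ) * z) ((t : ℂ) * z) = t * fderiv ℝ φ ((t : ℂ) * z) z := by
      conv_lhs => rw [show fderiv ℝ φ ((t : ℂ) * z) ((t : ℂ) * z) =
        fderiv ℝ φ ((t : ℂ) * z) (t • z) by rw [hs]]
      rw [map_smul]; simp
    have h4 : fderiv ℝ φ ((t : ℂ) * z) (-1 * ((t : ℂ) * z)) = - fderiv ℝ φ ((t : ℂ) * z) ((t : ℂ) * z) := by
      rw [neg_one_mul, map_neg]
    rw [h4, neg_neg, h2, h3] at h1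
    have : t ≠ 0 := ht.1.ne'
    apply mul_left_cancel₀ this
    rw [mul_add, h1]; ring
  have hGc : ContinuousOn G (Icc 0 1) := fun t ht => (hder t ht).continuousAt.continuousWithinAt
  have hG0 : G 0 = 0 := by simp [hG]
  have hG1 : G 1 = fderiv ℝ φ z z := by simp [hG]
  have hbd : ∀ t ∈ Ioo (0:ℝ) 1, 0 ≤ laplacian φ ((t : ℂ) * z) ∧ laplacian φ ((t : ℂ) * z) ≤ M := by
    intro t ht
    apply hM
    rw [(hmem t ⟨ht.1.le, ht.2.le⟩).2]
    nlinarith [ht.1, ht.2, norm_nonneg z]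
  have hmono1 : MonotoneOn G (Icc 0 1) := by
    refine monotoneOn_of_deriv_nonneg (convex_Icc 0 1) hGc ?_ ?_
    · rw [interior_Icc]
      exact fun t ht => (hder t ⟨ht.1.le, ht.2.le⟩).differentiableAt.differentiableWithinAt
    · rw [interior_Icc]
      intro t ht
      rw [(hder t ⟨ht.1.le, ht.2.le⟩).deriv, hder2 t ht]
      have := (hbd t ht).1
      have := ht.1
      positivity
  have hd2 : ∀ t ∈ Icc (0:ℝ) 1, HasDerivAt (fun t => M * ‖z‖ ^ 2 * t ^ 2 / 2 - G t)
      (M * ‖z‖ ^ 2 * t - (fderiv ℝ (fderiv ℝ φ) ((t : ℂ) * z) z ((t : ℂ) * z) + fderiv ℝ φ ((t : ℂ) * z) z)) t := by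
    intro t ht
    refine HasDerivAt.sub ?_ (hder t ht)
    have := (((hasDerivAt_pow 2 t).const_mul (M * ‖z‖ ^ 2)).div_const 2)
    refine this.congr_deriv ?_
    push_cast
    simp only [Nat.add_one_sub_one, pow_one]
    ring
  have hmono2 : MonotoneOn (fun t => M * ‖z‖ ^ 2 * t ^ 2 / 2 - G t) (Icc 0 1) := by
    refine monotoneOn_of_deriv_nonneg (convex_Icc 0 1)
      (fun t ht => (hd2 t ht).continuousAt.continuousWithinAt) ?_ ?_
    · rw [interior_Icc]
      exact fun t ht => (hd2 t ⟨ht.1.le, ht.2.le⟩).differentiableAt.differentiableWithinAt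
    · rw [interior_Icc]
      intro t ht
      rw [(hd2 t ⟨ht.1.le, ht.2.le⟩).deriv, hder2 t ht]
      have h1 := (hbd t ht).2
      have h2 : 0 ≤ t * ‖z‖ ^ 2 := mul_nonneg ht.1.le (by positivity)
      nlinarith
  have r1 := hmono1 (left_mem_Icc.2 zero_le_one) (right_mem_Icc.2 zero_le_one) zero_le_one
  have r2 := hmono2 (left_mem_Icc.2 zero_le_one) (right_mem_Icc.2 zero_le_one) zero_le_one
  simp only [hG0, hG1] at r1 r2
  constructor
  · exact r1
  · norm_num at r2; linarith

lemma hess_bound_ne (hφ : ContDiffOn ℝ 2 φ unitDisc)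
    (hr : ∀ z ∈ unitDisc, ∀ ζ ∈ unitDisc, ‖z‖ = ‖ζ‖ → φ z = φ ζ) {z : ℂ} (hz : z ∈ unitDisc)
    (hz0 : z ≠ 0) {M : ℝ} (hM : ∀ w, ‖w‖ ≤ ‖z‖ → 0 ≤ laplacian φ w ∧ laplacian φ w ≤ M) (v : ℂ) :
    |fderiv ℝ (fderiv ℝ φ) z v v| ≤ M * ‖v‖ ^ 2 := by
  obtain ⟨p1, p2⟩ := radial_first hφ hr hz hM
  obtain ⟨l1, l2⟩ := hM z le_rfl
  have hsym : ∀ a b, fderiv ℝ (fderiv ℝ φ) z a b = fderiv ℝ (fderiv ℝ φ) z b a := by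
    have hc : ContDiffAt ℝ 2 φ z := hφ.contDiffAt (isOpen_unitDisc.mem_nhds hz)
    exact fun a b => (hc.isSymmSndFDerivAt (by simp)) a b
  have t1 := trace_eq hφ hz z
  have s1 := radial_snd hφ hr hz (Complex.I * z)
  rw [← mul_assoc Complex.I Complex.I, Complex.I_mul_I, neg_one_mul, map_neg, neg_neg] at s1
  have s2 := radial_snd hφ hr hz z
  rw [radial_fderiv hφ hr hz, neg_zero] at s2
  have s3 := hsym (Complex.I * z) z
  rw [s2] at s3
  set c := v / z with hc
  have hv : v = c.re • z + c.im • (Complex.I * z) := by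
    have : c.re • z + c.im • (Complex.I * z) = (c.re + c.im * Complex.I) * z := by
      simp only [Complex.real_smul]; ring
    rw [this, Complex.re_add_im, hc, div_mul_cancel₀ _ hz0]
  have hnv : ‖v‖ ^ 2 = (c.re ^ 2 + c.im ^ 2) * ‖z‖ ^ 2 := by
    have : v = c * z := by rw [hc, div_mul_cancel₀ _ hz0]
    rw [this, norm_mul, mul_pow, ← Complex.normSq_eq_norm_sq c, Complex.normSq_apply]; ring
  rw [hnv, hv]
  simp only [map_add, map_smul, ContinuousLinearMap.add_apply, ContinuousLinearMap.smul_apply,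
    smul_eq_mul, s1, s2, s3]
  set P := fderiv ℝ φ z z
  set Q := fderiv ℝ (fderiv ℝ φ) z z z
  rw [s1] at t1
  have hQ1 : Q ≤ M * ‖z‖ ^ 2 := by nlinarith [sq_nonneg ‖z‖]
  have hQ2 : -(M * ‖z‖ ^ 2) ≤ Q := by nlinarith [sq_nonneg ‖z‖, mul_nonneg l1 (sq_nonneg ‖z‖)]
  have hP1 : P ≤ M * ‖z‖ ^ 2 := by nlinarith [sq_nonneg ‖z‖]
  have hP2 : -(M * ‖z‖ ^ 2) ≤ P := by nlinarith [sq_nonneg ‖z‖]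
  rw [abs_le]
  constructor
  · nlinarith [sq_nonneg c.re, sq_nonneg c.im]
  · nlinarith [sq_nonneg c.re, sq_nonneg c.im]

end hess

section taylor
variable {ω φ : ℂ → ℝ} {τ : ℝ → ℝ} {c₁ c₂ : ℝ}

lemma continuousOn_tau (hL : IsClassL (radialize τ) c₁ c₂) : ContinuousOn (fun z : ℂ => τ ‖z‖) unitDisc := by
  have : LipschitzOnWith (Real.toNNReal c₂) (fun z : ℂ => τ ‖z‖) unitDisc := by
    refine LipschitzOnWith.of_dist_le_mul fun z hz w hw => ?_
    rw [Real.coe_toNNReal _ hL.c₂_pos.le, Real.dist_eq, dist_eq_norm]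
    exact hL.lip z hz w hw
  exact this.continuousOn

lemma hess_bound (hW : IsClassW ω φ τ) (hL : IsClassL (radialize τ) c₁ c₂) {C : ℝ} (hC : 1 ≤ C)
    (h : ∀ z ∈ unitDisc, 1 / (C * τ ‖z‖ ^ 2) ≤ laplacian φ z ∧ laplacian φ z ≤ C / τ ‖z‖ ^ 2)
    {z : ℂ} (hz : z ∈ unitDisc) (v : ℂ) :
    |fderiv ℝ (fderiv ℝ φ) z v v| ≤ C / τ ‖z‖ ^ 2 * ‖v‖ ^ 2 := by
  have main : ∀ z ∈ unitDisc, z ≠ 0 → |fderiv ℝ (fderiv ℝ φ) z v v| ≤ C / τ ‖z‖ ^ 2 * ‖v‖ ^ 2 := by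
    intro z hz hz0
    refine hess_bound_ne hW.smooth hW.radial hz hz0 ?_ v
    intro w hw
    have hw1 : ‖w‖ < 1 := hw.trans_lt (mem_unitDisc.1 hz)
    have hwD : w ∈ unitDisc := mem_unitDisc.2 hw1
    refine ⟨(hW.lap_pos w hwD).le, (h w hwD).2.trans ?_⟩
    have h1 : τ ‖z‖ ≤ τ ‖w‖ := hW.tau_anti ⟨norm_nonneg _, hw1⟩ ⟨norm_nonneg _, mem_unitDisc.1 hz⟩ hw
    have h2 : 0 < τ ‖z‖ := hL.pos z hz
    gcongr
  by_cases hz0 : z = 0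
  · have hcont : ContinuousOn (fun z => fderiv ℝ (fderiv ℝ φ) z) unitDisc := by
      have h1 := hW.smooth.fderiv_of_isOpen (m := 1) isOpen_unitDisc (by norm_num)
      exact h1.continuousOn_fderiv_of_isOpen isOpen_unitDisc le_rfl
    have c1 : ContinuousAt (fun z => |fderiv ℝ (fderiv ℝ φ) z v v|) z :=
      ((hcont.clm_apply continuousOn_const).clm_apply continuousOn_const).abs.continuousAt
        (isOpen_unitDisc.mem_nhds hz)
    have c2 : ContinuousAt (fun z : ℂ => C / τ ‖z‖ ^ 2 * ‖v‖ ^ 2) z := by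
      have := (continuousOn_tau hL).continuousAt (isOpen_unitDisc.mem_nhds hz)
      refine (ContinuousAt.div continuousAt_const (this.pow 2) ?_).mul continuousAt_const
      have h2 : 0 < τ ‖z‖ := hL.pos z hz
      exact (pow_pos h2 2).ne'
    refine le_of_tendsto_of_tendsto (b := nhdsWithin z {z}ᶜ) (c1.tendsto.mono_left nhdsWithin_le_nhds)
      (c2.tendsto.mono_left nhdsWithin_le_nhds) ?_
    filter_upwards [self_mem_nhdsWithin, nhdsWithin_le_nhds (isOpen_unitDisc.mem_nhds hz)] with w hw hwD
    exact main w hwD (by rw [← hz0]; exact hw)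
  · exact main z hz hz0

lemma approx_hol (hW : IsClassW ω φ τ) (hL : IsClassL (radialize τ) c₁ c₂) :
    ∃ C0 : ℝ, 0 ≤ C0 ∧ ∀ a ∈ unitDisc, ∃ p : ℂ, ∀ w, ‖w - a‖ ≤ mTau c₁ c₂ * τ ‖a‖ →
      |φ a + (p * (w - a)).re - φ w| ≤ C0 := by
  obtain ⟨C, hC, hlap⟩ := lap_bounds hW
  refine ⟨2 * C, by linarith, fun a ha => ?_⟩
  set l := fderiv ℝ φ a with hl
  refine ⟨⟨l 1, - l Complex.I⟩, fun w hw => ?_⟩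
  have hlin : ∀ v : ℂ, l v = ((⟨l 1, - l Complex.I⟩ : ℂ) * v).re := by
    intro v
    have e1 : v = v.re • (1 : ℂ) + v.im • Complex.I := by simp [Complex.re_add_im]
    conv_lhs => rw [e1]
    rw [map_add, map_smul, map_smul]; simp; ring
  rw [← hlin]
  set v := w - a with hv
  have hτ : 0 < τ ‖a‖ := hL.pos a ha
  obtain ⟨m1, -, -⟩ := mTau_le hL.c₁_pos hL.c₂_pos
  have hm := mTau_pos hL.c₁_pos hL.c₂_pos
  have hseg : ∀ t ∈ Icc (0:ℝ) 1, a + (t : ℂ) * v ∈ unitDisc ∧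
      3/4 * τ ‖a‖ ≤ τ ‖a + (t : ℂ) * v‖ := by
    intro t ht
    have : ‖a + (t : ℂ) * v - a‖ ≤ mTau c₁ c₂ * τ ‖a‖ := by
      rw [add_sub_cancel_left, norm_mul, Complex.norm_real, Real.norm_of_nonneg ht.1]
      have := norm_nonneg v
      nlinarith [ht.1, ht.2]
    exact ⟨(geom hL ha this).1, (geom hL ha this).2.1⟩
  have hline : ∀ t : ℝ, HasDerivAt (fun t : ℝ => a + (t : ℂ) * v) v t := by
    intro t
    have := ((Complex.ofRealCLM.hasDerivAt (x := t)).mul_const v).const_add a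
    simpa using this
  set q1 : ℝ → ℝ := fun t => fderiv ℝ φ (a + (t : ℂ) * v) v with hq1
  have hd1 : ∀ t ∈ Icc (0:ℝ) 1, HasDerivWithinAt q1
      (fderiv ℝ (fderiv ℝ φ) (a + (t : ℂ) * v) v v) (Icc 0 1) t := by
    intro t ht
    have h1 := (hasFDerivAt_fderiv_disc hW.smooth (hseg t ht).1).comp_hasDerivAt t (hline t)
    have h2 := h1.clm_apply (hasDerivAt_const t v)
    simp only [map_zero, add_zero] at h2
    exact h2.hasDerivWithinAt
  have hb1 : ∀ t ∈ Icc (0:ℝ) 1, ‖fderiv ℝ (fderiv ℝ φ) (a + (t : ℂ) * v) v v‖ ≤ 2 * C := by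
    intro t ht
    refine (hess_bound hW hL hC hlap (hseg t ht).1 v).trans ?_
    have h1 := (hseg t ht).2
    have h2 : ‖v‖ ≤ 1/4 * τ ‖a‖ := hw.trans (by gcongr)
    have h3 : ‖v‖ ≤ τ ‖a + (t : ℂ) * v‖ := by linarith
    have h4 : 0 < τ ‖a + (t : ℂ) * v‖ := by linarith
    rw [div_mul_eq_mul_div, div_le_iff₀ (by positivity)]
    have : ‖v‖ ^ 2 ≤ τ ‖a + (t : ℂ) * v‖ ^ 2 := by gcongr
    nlinarith [sq_nonneg ‖v‖]
  have hlip : ∀ t ∈ Icc (0:ℝ) 1, ‖q1 t - q1 0‖ ≤ 2 * C := by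
    intro t ht
    have := (convex_Icc (0:ℝ) 1).norm_image_sub_le_of_norm_hasDerivWithin_le hd1 hb1
      (left_mem_Icc.2 zero_le_one) ht
    refine this.trans ?_
    rw [sub_zero, Real.norm_of_nonneg ht.1]
    nlinarith [ht.2]
  have hq10 : q1 0 = l v := by simp [hq1, hl]
  set q : ℝ → ℝ := fun t => φ (a + (t : ℂ) * v) - t * l v with hq
  have hd : ∀ t ∈ Icc (0:ℝ) 1, HasDerivWithinAt q (q1 t - q1 0) (Icc 0 1) t := by
    intro t ht
    have hφd : HasFDerivAt φ (fderiv ℝ φ (a + (t : ℂ) * v)) (a + (t : ℂ) * v) :=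
      ((hW.smooth.differentiableOn (by norm_num)).differentiableAt
        (isOpen_unitDisc.mem_nhds (hseg t ht).1)).hasFDerivAt
    have h1 := hφd.comp_hasDerivAt t (hline t)
    have h2 := h1.sub ((hasDerivAt_id t).mul_const (l v))
    have h3 := h2.congr_deriv (show _ = q1 t - q1 0 by rw [one_mul, hq10])
    exact h3.hasDerivWithinAt
  have := (convex_Icc (0:ℝ) 1).norm_image_sub_le_of_norm_hasDerivWithin_le hd hlip
    (left_mem_Icc.2 zero_le_one) (right_mem_Icc.2 zero_le_one)
  rw [sub_zero, norm_one, mul_one] at this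
  have hw' : a + v = w := by rw [hv]; ring
  simp only [hq, Complex.ofReal_one, Complex.ofReal_zero, one_mul, zero_mul, add_zero, sub_zero, hw'] at this
  rw [Real.norm_eq_abs, abs_sub_comm] at this
  convert this using 2
  ring

end taylor

section wsub
variable {ω φ : ℂ → ℝ} {τ : ℝ → ℝ} {c₁ c₂ : ℝ}

/-- Weighted sub-mean value property. -/
lemma wsubmean (hW : IsClassW ω φ τ) (hL : IsClassL (radialize τ) c₁ c₂) :
    ∃ C : ℝ, 0 < C ∧ ∀ F : ℂ → ℂ, DifferentiableOn ℂ F unitDisc → ∀ z ∈ unitDisc, ∀ ε : ℝ, 0 < ε →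
      ε < mTau c₁ c₂ → ENNReal.ofReal (‖F z‖ ^ 2 * Real.exp (-(2 * φ z))) ≤
        ENNReal.ofReal (C / (ε * τ ‖z‖) ^ 2) *
          ∫⁻ w in Metric.ball z (ε * τ ‖z‖), ENNReal.ofReal (‖F w‖ ^ 2 * Real.exp (-(2 * φ w))) := by
  obtain ⟨C0, hC0, happ⟩ := approx_hol hW hL
  refine ⟨Real.exp (2 * C0) / Real.pi, by positivity, fun F hF z hz ε hε hεm => ?_⟩
  obtain ⟨p, hp⟩ := happ z hz
  have hτ : 0 < τ ‖z‖ := hL.pos z hz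
  set G : ℂ → ℂ := fun w => F w * Complex.exp (-((φ z : ℂ) + p * (w - z))) with hG
  have hR : ε * τ ‖z‖ < mTau c₁ c₂ * τ ‖z‖ := by gcongr
  have hGd : DifferentiableOn ℂ G (Metric.ball z (mTau c₁ c₂ * τ ‖z‖)) := by
    refine (hF.mono ((Metric.ball_subset_closedBall).trans (closedBall_sub hL hz))).mul ?_
    apply Differentiable.differentiableOn
    fun_prop
  have hr : 0 < ε * τ ‖z‖ := by positivity
  have hsub := submean hr hR hGd
  have hn : ∀ w, ‖G w‖ ^ 2 = ‖F w‖ ^ 2 * Real.exp (-(2 * (φ z + (p * (w - z)).re))) := by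
    intro w
    rw [hG]; simp only [norm_mul, Complex.norm_exp, mul_pow]
    rw [← Real.exp_nat_mul]
    congr 2
    simp; ring
  have hnz : ‖G z‖ ^ 2 = ‖F z‖ ^ 2 * Real.exp (-(2 * φ z)) := by rw [hn]; simp
  have hle : ∫⁻ w in Metric.ball z (ε * τ ‖z‖), ENNReal.ofReal (‖G w‖ ^ 2) ≤
      ENNReal.ofReal (Real.exp (2 * C0)) *
        ∫⁻ w in Metric.ball z (ε * τ ‖z‖), ENNReal.ofReal (‖F w‖ ^ 2 * Real.exp (-(2 * φ w))) := by
    rw [← lintegral_const_mul' _ _ ENNReal.ofReal_ne_top]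
    refine setLIntegral_mono' measurableSet_ball fun w hw => ?_
    rw [← ENNReal.ofReal_mul (by positivity)]
    apply ENNReal.ofReal_le_ofReal
    rw [hn, mul_left_comm, ← Real.exp_add]
    have := hp w (by rw [mem_ball_iff_norm] at hw; linarith)
    have := (abs_le.1 this).1
    gcongr
    linarith
  have e1 : ENNReal.ofReal (Real.exp (2 * C0) / Real.pi / (ε * τ ‖z‖) ^ 2) =
      ENNReal.ofReal (1 / (Real.pi * (ε * τ ‖z‖) ^ 2)) * ENNReal.ofReal (Real.exp (2 * C0)) := by
    rw [← ENNReal.ofReal_mul (by positivity)]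
    congr 1; field_simp
  have e2 : ENNReal.ofReal (‖F z‖ ^ 2 * Real.exp (-(2 * φ z))) =
      ENNReal.ofReal (1 / (Real.pi * (ε * τ ‖z‖) ^ 2)) *
        ENNReal.ofReal (Real.pi * (ε * τ ‖z‖) ^ 2 * ‖G z‖ ^ 2) := by
    rw [← ENNReal.ofReal_mul (by positivity), hnz]
    congr 1; field_simp
  rw [e1, e2]
  refine le_trans ?_ (le_of_eq (mul_assoc _ _ _).symm)
  exact mul_le_mul' le_rfl (hsub.trans hle)

lemma ofReal_pi_ne : ENNReal.ofReal Real.pi ≠ 0 := by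
  simp [Real.pi_pos]

lemma dA_restrict (s : Set ℂ) : dA.restrict s = (ENNReal.ofReal Real.pi)⁻¹ • (volume.restrict s) := by
  rw [dA, Measure.restrict_smul]

lemma aemeas_omega (hW : IsClassW ω φ τ) :
    AEMeasurable (fun z => ENNReal.ofReal (ω z)) (dA.restrict unitDisc) := by
  have h1 : ContinuousOn (fun z => ENNReal.ofReal (Real.exp (-(2 * φ z)))) unitDisc := by
    refine ENNReal.continuous_ofReal.comp_continuousOn ?_
    refine Real.continuous_exp.comp_continuousOn ?_
    exact ((continuousOn_const.mul hW.smooth.continuousOn)).neg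
  refine (h1.aemeasurable (μ := dA) measurableSet_unitDisc).congr ?_
  filter_upwards [ae_restrict_mem measurableSet_unitDisc] with z hz
  rw [hW.omega_eq z hz]

lemma lintegral_muW (hW : IsClassW ω φ τ) (f : ℂ → ℝ≥0∞) :
    ∫⁻ z, f z ∂(muW ω) = (ENNReal.ofReal Real.pi)⁻¹ *
      ∫⁻ z in unitDisc, ENNReal.ofReal (Real.exp (-(2 * φ z))) * f z := by
  rw [muW, lintegral_withDensity_eq_lintegral_mul_non_measurable₀ _ (aemeas_omega hW)
    (Eventually.of_forall fun _ => ENNReal.ofReal_lt_top), dA_restrict, lintegral_smul_measure]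
  rw [smul_eq_mul]
  congr 1
  refine setLIntegral_congr_fun measurableSet_unitDisc fun z hz => ?_
  simp only [Pi.mul_apply]
  rw [hW.omega_eq z hz]

lemma ae_muW_iff (hW : IsClassW ω φ τ) {p : ℂ → Prop} :
    (∀ᵐ z ∂(muW ω), p z) ↔ ∀ᵐ z ∂(volume.restrict unitDisc), p z := by
  rw [muW, ae_withDensity_iff' (aemeas_omega hW), dA_restrict]
  rw [Measure.ae_ennreal_smul_measure_iff (by simp)]
  rw [ae_restrict_iff' measurableSet_unitDisc, ae_restrict_iff' measurableSet_unitDisc]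
  refine eventually_congr (Eventually.of_forall fun z => ?_)
  constructor
  · intro h hz
    refine h hz ?_
    simpa using hW.pos z hz
  · intro h hz _
    exact h hz

lemma aesm_muW_iff (hW : IsClassW ω φ τ) {f : ℂ → ℂ} :
    AEStronglyMeasurable f (muW ω) ↔ AEStronglyMeasurable f (volume.restrict unitDisc) := by
  constructor
  · exact fun ⟨g, hg, h⟩ => ⟨g, hg, (ae_muW_iff hW).1 h⟩
  · exact fun ⟨g, hg, h⟩ => ⟨g, hg, (ae_muW_iff hW).2 h⟩

lemma lp_normsq {μ : Measure ℂ} (f : Lp ℂ 2 μ) :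
    ∫⁻ z, ENNReal.ofReal (‖f z‖ ^ 2) ∂μ = ENNReal.ofReal (‖f‖ ^ 2) := by
  have h := eLpNorm_eq_lintegral_rpow_enorm_toReal (p := 2) (by norm_num) (by norm_num)
    (f := f) (μ := μ)
  have h2 : ∫⁻ z, ENNReal.ofReal (‖f z‖ ^ 2) ∂μ = ∫⁻ z, ‖f z‖ₑ ^ (2:ℝ≥0∞).toReal ∂μ := by
    refine lintegral_congr fun z => ?_
    rw [ENNReal.ofReal_pow (norm_nonneg _), ofReal_norm_eq_enorm]; simp
  rw [h2, ENNReal.ofReal_pow (norm_nonneg _), Lp.norm_def, ENNReal.ofReal_toReal (Lp.eLpNorm_ne_top f), h,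
    ← ENNReal.rpow_natCast, ← ENNReal.rpow_mul]
  simp

lemma memLp_of_lintegral {μ : Measure ℂ} {f : ℂ → ℂ} (hf : AEStronglyMeasurable f μ)
    (h : ∫⁻ z, ENNReal.ofReal (‖f z‖ ^ 2) ∂μ < ⊤) : MemLp f 2 μ := by
  refine ⟨hf, ?_⟩
  rw [eLpNorm_lt_top_iff_lintegral_rpow_enorm_lt_top (by norm_num) (by norm_num)]
  refine lt_of_le_of_lt (le_of_eq ?_) h
  refine lintegral_congr fun z => ?_
  rw [ENNReal.ofReal_pow (norm_nonneg _), ofReal_norm_eq_enorm]; simp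

lemma lintegral_of_memLp {μ : Measure ℂ} {f : ℂ → ℂ} (hf : MemLp f 2 μ) :
    ∫⁻ z, ENNReal.ofReal (‖f z‖ ^ 2) ∂μ < ⊤ := by
  have := lp_normsq (hf.toLp f)
  rw [lintegral_congr_ae (g := fun z => ENNReal.ofReal (‖f z‖ ^ 2))] at this
  · rw [this]; exact ENNReal.ofReal_lt_top
  · filter_upwards [hf.coeFn_toLp] with z hz
    rw [hz]

/-- The norm of an `L²_ω` element as a plain weighted integral. -/
lemma muW_normsq (hW : IsClassW ω φ τ) (f : Lp ℂ 2 (muW ω)) {F : ℂ → ℂ} (hF : (f : ℂ → ℂ) =ᵐ[muW ω] F) :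
    ∫⁻ z in unitDisc, ENNReal.ofReal (‖F z‖ ^ 2 * Real.exp (-(2 * φ z))) =
      ENNReal.ofReal (Real.pi * ‖f‖ ^ 2) := by
  have h := lp_normsq f
  rw [lintegral_congr_ae (g := fun z => ENNReal.ofReal (‖F z‖ ^ 2)) (by
    filter_upwards [hF] with z hz; rw [hz]), lintegral_muW hW] at h
  have e : ∫⁻ z in unitDisc, ENNReal.ofReal (‖F z‖ ^ 2 * Real.exp (-(2 * φ z))) =
      ∫⁻ z in unitDisc, ENNReal.ofReal (Real.exp (-(2 * φ z))) * ENNReal.ofReal (‖F z‖ ^ 2) := by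
    refine lintegral_congr fun z => ?_
    rw [← ENNReal.ofReal_mul (by positivity), mul_comm]
  rw [e, ENNReal.ofReal_mul Real.pi_pos.le, ← h, ← mul_assoc, ENNReal.mul_inv_cancel ofReal_pi_ne
    ENNReal.ofReal_ne_top, one_mul]

lemma memLp_muW (hW : IsClassW ω φ τ) {F : ℂ → ℂ} (hF : AEStronglyMeasurable F (volume.restrict unitDisc))
    (h : ∫⁻ z in unitDisc, ENNReal.ofReal (‖F z‖ ^ 2 * Real.exp (-(2 * φ z))) < ⊤) :
    MemLp F 2 (muW ω) := by
  refine memLp_of_lintegral ((aesm_muW_iff hW).2 hF) ?_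
  rw [lintegral_muW hW]
  refine ENNReal.mul_lt_top (by simp [Real.pi_pos]) ?_
  refine lt_of_le_of_lt (le_of_eq ?_) h
  refine lintegral_congr fun z => ?_
  rw [← ENNReal.ofReal_mul (by positivity), mul_comm]

end wsub

/-- Extension of a bounded operator from a subspace of a Hilbert space. -/
lemma hilbert_extend {E F : Type*} [NormedAddCommGroup E] [InnerProductSpace ℂ E] [CompleteSpace E]
    [NormedAddCommGroup F] [NormedSpace ℂ F] [CompleteSpace F] (S : Submodule ℂ E) (L : S →ₗ[ℂ] F)
    (K : ℝ) (hK : ∀ x : S, ‖L x‖ ≤ K * ‖x‖) : ∃ T : E →L[ℂ] F, ∀ x : S, T x = L x := by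
  set S' := S.topologicalClosure with hS'
  have : CompleteSpace S' := IsComplete.completeSpace_coe
    (IsClosed.isComplete (Submodule.isClosed_topologicalClosure _))
  set e : S →ₗ[ℂ] S' := Submodule.inclusion S.le_topologicalClosure with he
  have hd : DenseRange e := by
    have : DenseRange (Set.inclusion (show (S : Set E) ⊆ (S.topologicalClosure : Set E) from S.le_topologicalClosure)) := by
      rw [denseRange_inclusion_iff]
      exact le_of_eq S.topologicalClosure_coe
    exact this
  have hn : ∃ C, ∀ x, ‖L x‖ ≤ C * ‖e x‖ := ⟨K, fun x => hK x⟩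
  refine ⟨(L.extendOfNorm e).comp (Submodule.orthogonalProjectionOnto S'), fun x => ?_⟩
  have h1 : Submodule.orthogonalProjectionOnto S' (x : E) = e x := by
    have := Submodule.orthogonalProjectionOnto_mem_subspace_eq_self (K := S') (e x)
    exact this
  rw [ContinuousLinearMap.comp_apply, h1]
  exact LinearMap.extendOfNorm_eq hd hn x

section hankel
variable {ω φ : ℂ → ℝ} {τ : ℝ → ℝ} {c₁ c₂ : ℝ}

lemma measurable_tauInd (hL : IsClassL (radialize τ) c₁ c₂) :
    Measurable (unitDisc.indicator fun z : ℂ => τ ‖z‖) := by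
  refine measurable_of_isOpen fun s hs => ?_
  classical
  have := (continuousOn_tau hL).measurable_piecewise (g := fun _ : ℂ => (0:ℝ)) continuousOn_const measurableSet_unitDisc
  have e : (unitDisc.indicator fun z : ℂ => τ ‖z‖) = unitDisc.piecewise (fun z : ℂ => τ ‖z‖) (fun _ => 0) := by
    ext z; by_cases hz : z ∈ unitDisc <;> simp [hz]
  rw [e]
  exact this hs.measurableSet

lemma carleson (hW : IsClassW ω φ τ) (hL : IsClassL (radialize τ) c₁ c₂) (g : ℂ → ℂ)
    (hg : AEStronglyMeasurable g (volume.restrict unitDisc)) {δ M : ℝ} (hδ : δ ∈ Set.Ioo 0 (mTau c₁ c₂))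
    (hM : ∀ z ∈ unitDisc, localMeanE (radialize τ) δ g z ≤ ENNReal.ofReal M) :
    ∃ K : ℝ, 0 ≤ K ∧ ∀ F : ℂ → ℂ, DifferentiableOn ℂ F unitDisc →
      ∫⁻ z in unitDisc, ENNReal.ofReal (‖g z * F z‖ ^ 2 * Real.exp (-(2 * φ z))) ≤
        ENNReal.ofReal K * ∫⁻ z in unitDisc, ENNReal.ofReal (‖F z‖ ^ 2 * Real.exp (-(2 * φ z))) := by
  obtain ⟨C, hC, hsub⟩ := wsubmean hW hL
  set ε := δ / 2 with hε
  have hε0 : 0 < ε := by have := hδ.1; positivity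
  have hεm : ε < mTau c₁ c₂ := by have := hδ.1; have := hδ.2; rw [hε]; linarith
  refine ⟨C * 16 * Real.pi * max M 0, by positivity, fun F hF => ?_⟩
  set t : ℂ → ℝ := unitDisc.indicator fun z : ℂ => τ ‖z‖ with ht
  have htm : Measurable t := measurable_tauInd hL
  have htD : ∀ z ∈ unitDisc, t z = τ ‖z‖ := fun z hz => by rw [ht, indicator_of_mem hz]
  set A : Set (ℂ × ℂ) := {q | ‖q.2 - q.1‖ < ε * t q.1} with hA
  have hAm : MeasurableSet A := by
    refine measurableSet_lt ?_ ?_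
    · fun_prop
    · exact (htm.comp measurable_fst).const_mul ε
  set Φ : ℂ → ℝ≥0∞ := fun w => ENNReal.ofReal (‖F w‖ ^ 2 * Real.exp (-(2 * φ w))) with hΦ
  have hΦm : AEMeasurable Φ (volume.restrict unitDisc) := by
    have h1 : ContinuousOn Φ unitDisc := by
      refine ENNReal.continuous_ofReal.comp_continuousOn ((hF.continuousOn.norm.pow 2).mul ?_)
      exact Real.continuous_exp.comp_continuousOn (continuousOn_const.mul hW.smooth.continuousOn).neg
    exact h1.aemeasurable measurableSet_unitDisc
  set k : ℂ → ℝ≥0∞ := fun z => ENNReal.ofReal (‖g z‖ ^ 2) * ENNReal.ofReal (C / (ε * t z) ^ 2) with hk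
  have hkm : AEMeasurable k (volume.restrict unitDisc) := by
    have h1 : AEMeasurable (fun z => ENNReal.ofReal (‖g z‖ ^ 2)) (volume.restrict unitDisc) :=
      (hg.norm.aemeasurable.pow_const 2).ennreal_ofReal
    have h2 : Measurable fun z => ENNReal.ofReal (C / (ε * t z) ^ 2) := by fun_prop
    exact h1.mul h2.aemeasurable
  have step1 : ∫⁻ z in unitDisc, ENNReal.ofReal (‖g z * F z‖ ^ 2 * Real.exp (-(2 * φ z))) ≤
      ∫⁻ z in unitDisc, ∫⁻ w in unitDisc, A.indicator (fun q => k q.1 * Φ q.2) (z, w) := by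
    refine setLIntegral_mono' measurableSet_unitDisc fun z hz => ?_
    have h1 := hsub F hF z hz ε hε0 hεm
    have hball : Metric.ball z (ε * τ ‖z‖) ⊆ unitDisc := by
      refine subset_trans (fun w hw => ?_) (closedBall_sub hL hz)
      rw [Metric.mem_ball] at hw
      rw [Metric.mem_closedBall]
      have : 0 < τ ‖z‖ := hL.pos z hz
      nlinarith
    calc ENNReal.ofReal (‖g z * F z‖ ^ 2 * Real.exp (-(2 * φ z)))
        = ENNReal.ofReal (‖g z‖ ^ 2) * ENNReal.ofReal (‖F z‖ ^ 2 * Real.exp (-(2 * φ z))) := by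
          rw [← ENNReal.ofReal_mul (by positivity), norm_mul]; congr 1; ring
      _ ≤ ENNReal.ofReal (‖g z‖ ^ 2) * (ENNReal.ofReal (C / (ε * τ ‖z‖) ^ 2) *
          ∫⁻ w in Metric.ball z (ε * τ ‖z‖), Φ w) := mul_le_mul' le_rfl h1
      _ = ∫⁻ w in Metric.ball z (ε * τ ‖z‖), k z * Φ w := by
          rw [lintegral_const_mul' _ _ (by
            exact ENNReal.mul_ne_top ENNReal.ofReal_ne_top ENNReal.ofReal_ne_top), hk]
          simp only [htD z hz, mul_assoc]
      _ = ∫⁻ w in unitDisc, (Metric.ball z (ε * τ ‖z‖)).indicator (fun w => k z * Φ w) w := by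
          rw [lintegral_indicator measurableSet_ball, Measure.restrict_restrict measurableSet_ball,
            inter_eq_self_of_subset_left hball]
      _ ≤ _ := by
          refine lintegral_mono fun w => ?_
          by_cases hw : w ∈ Metric.ball z (ε * τ ‖z‖)
          · have : (z, w) ∈ A := by
              simp only [hA, mem_setOf_eq, htD z hz]; exact mem_ball_iff_norm.1 hw
            simp [hw, this]
          · simp [hw]
  have hswap := lintegral_lintegral_swap (μ := volume.restrict unitDisc) (ν := volume.restrict unitDisc)
    (f := fun z w => A.indicator (fun q => k q.1 * Φ q.2) (z, w)) (by
      refine AEMeasurable.indicator ?_ hAm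
      exact (hkm.comp_fst).mul (hΦm.comp_snd))
  refine step1.trans ?_
  rw [hswap, ← lintegral_const_mul' _ _ ENNReal.ofReal_ne_top]
  refine setLIntegral_mono' measurableSet_unitDisc fun w hw => ?_
  have hτw : 0 < τ ‖w‖ := hL.pos w hw
  have step2 : ∀ z ∈ unitDisc, A.indicator (fun q => k q.1 * Φ q.2) (z, w) ≤
      Φ w * ((Metric.ball w (δ * τ ‖w‖)).indicator (fun z => ENNReal.ofReal (‖g z‖ ^ 2) *
        ENNReal.ofReal (C * 16 / (δ * τ ‖w‖) ^ 2)) z) := by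
    intro z hz
    by_cases hzw : (z, w) ∈ A
    · have h1 : ‖w - z‖ < ε * τ ‖z‖ := by simpa only [hA, mem_setOf_eq, htD z hz] using hzw
      have hτz : 0 < τ ‖z‖ := hL.pos z hz
      obtain ⟨-, h3, h4⟩ := geom hL hz (w := w) (by nlinarith)
      have h5 : z ∈ Metric.ball w (δ * τ ‖w‖) := by
        rw [mem_ball_iff_norm, norm_sub_rev]; rw [hε] at h1; nlinarith [hδ.1]
      rw [indicator_of_mem hzw, indicator_of_mem h5, hk]
      simp only [htD z hz]
      rw [mul_comm (Φ w)]
      refine mul_le_mul' (mul_le_mul' le_rfl (ENNReal.ofReal_le_ofReal ?_)) le_rfl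
      · rw [hε]
        have hδ0 := hδ.1
        rw [div_le_div_iff₀ (by positivity) (by positivity)]
        have : (δ * τ ‖w‖) ^ 2 ≤ 16 * (δ / 2 * τ ‖z‖) ^ 2 := by
          have : δ * τ ‖w‖ ≤ 4 * (δ / 2 * τ ‖z‖) := by nlinarith
          calc (δ * τ ‖w‖) ^ 2 ≤ (4 * (δ / 2 * τ ‖z‖)) ^ 2 := by gcongr
            _ = _ := by ring
        nlinarith
    · simp [hzw]
  have hballw : Metric.ball w (δ * τ ‖w‖) ⊆ unitDisc := by
    refine subset_trans (fun z hz => ?_) (closedBall_sub hL hw)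
    rw [Metric.mem_ball] at hz
    rw [Metric.mem_closedBall]
    have := hδ.2
    nlinarith
  refine (setLIntegral_mono' measurableSet_unitDisc step2).trans ?_
  rw [lintegral_const_mul' _ _ (by rw [hΦ]; exact ENNReal.ofReal_ne_top), lintegral_indicator measurableSet_ball,
    Measure.restrict_restrict measurableSet_ball, inter_eq_self_of_subset_left hballw,
    lintegral_mul_const' _ _ ENNReal.ofReal_ne_top, mul_comm (Φ w)]
  refine mul_le_mul' ?_ le_rfl
  have hm := hM w hw
  unfold localMeanE at hm
  rw [dA_restrict, lintegral_smul_measure, smul_eq_mul] at hm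
  set I := ∫⁻ z in Metric.ball w (δ * τ ‖w‖), ENNReal.ofReal (‖g z‖ ^ 2) with hI
  have hm' : (ENNReal.ofReal ((δ * τ ‖w‖) ^ 2))⁻¹ * ((ENNReal.ofReal Real.pi)⁻¹ * I) ≤ ENNReal.ofReal M := hm
  have hδ0 := hδ.1
  have hIle : I ≤ ENNReal.ofReal ((δ * τ ‖w‖) ^ 2) * (ENNReal.ofReal Real.pi * ENNReal.ofReal M) := by
    rw [← ENNReal.div_eq_inv_mul, ← ENNReal.div_eq_inv_mul] at hm'
    rw [ENNReal.div_le_iff (ENNReal.ofReal_pos.2 (by positivity)).ne' (by simp), ENNReal.div_le_iff (by simp [Real.pi_pos]) (by simp)] at hm'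
    refine hm'.trans (le_of_eq (by ring))
  calc I * ENNReal.ofReal (C * 16 / (δ * τ ‖w‖) ^ 2)
      ≤ ENNReal.ofReal ((δ * τ ‖w‖) ^ 2) * (ENNReal.ofReal Real.pi * ENNReal.ofReal (max M 0)) *
        ENNReal.ofReal (C * 16 / (δ * τ ‖w‖) ^ 2) := by
        refine mul_le_mul' (hIle.trans ?_) le_rfl
        gcongr
        exact le_max_left _ _
    _ = ENNReal.ofReal (C * 16 * Real.pi * max M 0) := by
        rw [← ENNReal.ofReal_mul Real.pi_pos.le, ← ENNReal.ofReal_mul (by positivity),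
          ← ENNReal.ofReal_mul (by positivity)]
        congr 1
        have : (δ * τ ‖w‖) ≠ 0 := by positivity
        field_simp
lemma dbar_holo_mul {F g : ℂ → ℂ} {z : ℂ} (hF : DifferentiableAt ℂ F z) (hg : DifferentiableAt ℝ g z) :
    dbar (fun w => g w * F w) z = dbar g z * F z := by
  have hFr : HasFDerivAt F ((fderiv ℂ F z).restrictScalars ℝ) z := hF.hasFDerivAt.restrictScalars ℝ
  have h := hg.hasFDerivAt.mul hFr
  have h' : fderiv ℝ (fun w => g w * F w) z = g z • (fderiv ℂ F z).restrictScalars ℝ + F z • fderiv ℝ g z := h.fderiv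
  unfold dbar
  rw [h']
  have hI : fderiv ℂ F z Complex.I = Complex.I * fderiv ℂ F z 1 := by
    have := (fderiv ℂ F z).map_smul Complex.I 1
    simpa using this
  simp [hI]
  linear_combination (g z * deriv F z / 2) * Complex.I_mul_I

lemma bergmanProj_of_mem {h : Lp ℂ 2 (muW ω)} (hh : h ∈ bergmanH ω) : bergmanProj ω h = h := by
  have := Submodule.orthogonalProjectionOnto_mem_subspace_eq_self (K := bergmanH ω) ⟨h, hh⟩
  have := congrArg Subtype.val this
  exact this

lemma bergmanProj_norm_le (h : Lp ℂ 2 (muW ω)) : ‖bergmanProj ω h‖ ≤ ‖h‖ := by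
  have h1 := (bergmanH ω).orthogonalProjectionOnto_norm_le
  have h2 := (bergmanProjA ω).le_opNorm h
  have h3 : ‖bergmanProjA ω‖ ≤ 1 := h1
  have h4 : ‖bergmanProj ω h‖ = ‖bergmanProjA ω h‖ := rfl
  rw [h4]
  nlinarith [norm_nonneg h]

lemma norm_le_of_lintegral (hW : IsClassW ω φ τ) (f : Lp ℂ 2 (muW ω)) {F : ℂ → ℂ} (hF : (f : ℂ → ℂ) =ᵐ[muW ω] F)
    {K : ℝ} (hK : 0 ≤ K) (h : ∫⁻ z in unitDisc, ENNReal.ofReal (‖F z‖ ^ 2 * Real.exp (-(2 * φ z))) ≤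
      ENNReal.ofReal (Real.pi * K ^ 2)) : ‖f‖ ≤ K := by
  rw [muW_normsq hW f hF, ENNReal.ofReal_le_ofReal_iff (by positivity)] at h
  have : ‖f‖ ^ 2 ≤ K ^ 2 := le_of_mul_le_mul_left h Real.pi_pos
  exact abs_le_of_sq_le_sq' this hK |>.2

set_option maxHeartbeats 2000000 in
lemma three_imp_one (hW : IsClassW ω φ τ) (hL : IsClassL (radialize τ) c₁ c₂)
    (g : ℂ → ℂ) (hg : MemLp g 2 (muW ω)) (g₁ g₂ : ℂ → ℂ) (hdec : ∀ z ∈ unitDisc, g z = g₁ z + g₂ z)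
    (hsm : ContDiffOn ℝ 1 g₂ unitDisc) {M : ℝ}
    (hM : ∀ z ∈ unitDisc, ‖dbar g₂ z‖ / Real.sqrt (laplacian φ z) ≤ M)
    {δ M' : ℝ} (hδ : δ ∈ Set.Ioo 0 (mTau c₁ c₂))
    (hM' : ∀ z ∈ unitDisc, localMeanE (radialize τ) δ g₁ z ≤ ENNReal.ofReal M') :
    ∃ T : bergmanH ω →L[ℂ] Lp ℂ 2 (muW ω), IsHankelExtension ω g T := by
  have hD := measurableSet_unitDisc
  have hga : AEStronglyMeasurable g (volume.restrict unitDisc) := (aesm_muW_iff hW).1 hg.1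
  have hg2a : AEStronglyMeasurable g₂ (volume.restrict unitDisc) :=
    hsm.continuousOn.aestronglyMeasurable hD
  have hg1a : AEStronglyMeasurable g₁ (volume.restrict unitDisc) := by
    refine (hga.sub hg2a).congr ?_
    filter_upwards [ae_restrict_mem hD] with z hz
    simp [hdec z hz]
  have hM0 : 0 ≤ M := le_trans (by positivity) (hM 0 (by simp [mem_unitDisc]))
  obtain ⟨K1, hK1, hcar⟩ := carleson hW hL g₁ hg1a hδ hM'
  have bound : ∀ (f gF : Lp ℂ 2 (muW ω)) (F : ℂ → ℂ), DifferentiableOn ℂ F unitDisc →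
      (f : ℂ → ℂ) =ᵐ[muW ω] F → ((gF : ℂ → ℂ) =ᵐ[muW ω] fun z => g z * F z) →
      ‖gF - bergmanProj ω gF‖ ≤ 2 * (Real.sqrt K1 + Real.sqrt (2 * M ^ 2)) * ‖f‖ := by
    intro f gF F hF hfF hgF
    have hnorm := muW_normsq hW f hfF
    have hFa : AEStronglyMeasurable F (volume.restrict unitDisc) := hF.continuousOn.aestronglyMeasurable hD
    have hc := hcar F hF
    rw [hnorm, ← ENNReal.ofReal_mul hK1] at hc
    have hm1 : MemLp (fun z => g₁ z * F z) 2 (muW ω) :=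
      memLp_muW hW (hg1a.mul hFa) (hc.trans_lt ENNReal.ofReal_lt_top)
    have hn1 : ‖hm1.toLp‖ ≤ Real.sqrt K1 * ‖f‖ := by
      refine norm_le_of_lintegral hW _ hm1.coeFn_toLp (by positivity) (hc.trans (le_of_eq ?_))
      rw [mul_pow, Real.sq_sqrt hK1]; congr 1; ring
    set u0 : ℂ → ℂ := fun z => g₂ z * F z with hu0
    have hFr : ContDiffOn ℝ 1 F unitDisc := by
      have := (hF.contDiffOn (n := 1) isOpen_unitDisc)
      exact this.restrict_scalars ℝ
    have hu0c : ContDiffOn ℝ 1 u0 unitDisc := hsm.mul hFr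
    have hK : ∫⁻ z in unitDisc, ENNReal.ofReal (‖dbar u0 z‖ ^ 2 / laplacian φ z * Real.exp (-(2 * φ z))) ≤
        ENNReal.ofReal (M ^ 2 * (Real.pi * ‖f‖ ^ 2)) := by
      rw [ENNReal.ofReal_mul (by positivity), ← hnorm, ← lintegral_const_mul' _ _ ENNReal.ofReal_ne_top]
      refine setLIntegral_mono' hD fun z hz => ?_
      rw [← ENNReal.ofReal_mul (by positivity)]
      apply ENNReal.ofReal_le_ofReal
      have hz' := isOpen_unitDisc.mem_nhds hz
      rw [hu0, dbar_holo_mul (hF.differentiableAt hz') ((hsm.differentiableOn one_ne_zero).differentiableAt hz')]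
      have hl := hW.lap_pos z hz
      have h1 := hM z hz
      have h2 : ‖dbar g₂ z‖ ^ 2 / laplacian φ z ≤ M ^ 2 := by
        rw [← Real.sq_sqrt hl.le, ← div_pow]
        gcongr
      calc ‖dbar g₂ z * F z‖ ^ 2 / laplacian φ z * Real.exp (-(2 * φ z))
          = ‖dbar g₂ z‖ ^ 2 / laplacian φ z * (‖F z‖ ^ 2 * Real.exp (-(2 * φ z))) := by
            rw [norm_mul]; ring
        _ ≤ _ := by gcongr
    obtain ⟨h, hh, hv⟩ := hormander hW.smooth hW.lap_pos hu0c (by positivity) hK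
    have hva : AEStronglyMeasurable (fun z => u0 z - h z) (volume.restrict unitDisc) :=
      (hg2a.mul hFa).sub (hh.continuousOn.aestronglyMeasurable hD)
    have hm2 : MemLp (fun z => u0 z - h z) 2 (muW ω) :=
      memLp_muW hW hva (hv.trans_lt ENNReal.ofReal_lt_top)
    have hn2 : ‖hm2.toLp‖ ≤ Real.sqrt (2 * M ^ 2) * ‖f‖ := by
      refine norm_le_of_lintegral hW _ hm2.coeFn_toLp (by positivity) (hv.trans (le_of_eq ?_))
      rw [mul_pow, Real.sq_sqrt (by positivity)]; congr 1; ring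
    have hmem : gF - hm1.toLp - hm2.toLp ∈ bergmanH ω := by
      refine Submodule.le_topologicalClosure _ ?_
      refine ⟨h, hh, ?_⟩
      have hDae : ∀ᵐ z ∂(muW ω), z ∈ unitDisc := (ae_muW_iff hW).2 (ae_restrict_mem hD)
      filter_upwards [Lp.coeFn_sub (gF - hm1.toLp) hm2.toLp, Lp.coeFn_sub gF hm1.toLp, hgF, hm1.coeFn_toLp,
        hm2.coeFn_toLp, hDae] with z e1 e2 e3 e4 e5 hz
      rw [e1, Pi.sub_apply, e2, Pi.sub_apply, e3, e4, e5, hu0, hdec z hz]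
      ring
    have hP := bergmanProj_of_mem hmem
    set X := hm1.toLp + hm2.toLp with hX
    have e : gF = (gF - hm1.toLp - hm2.toLp) + X := by rw [hX]; abel
    have e2 : gF - bergmanProj ω gF = X - bergmanProj ω X := by
      conv_lhs => rw [e, map_add, hP]
      abel
    rw [e2]
    have := bergmanProj_norm_le X
    have h3 : ‖X‖ ≤ _ := norm_add_le _ _
    have h4 := norm_sub_le X (bergmanProj ω X)
    linarith
  set S : Submodule ℂ (bergmanH ω) :=
    { carrier := {f | ∃ (F : ℂ → ℂ) (M : ℝ), DifferentiableOn ℂ F unitDisc ∧ (∀ z ∈ unitDisc, ‖F z‖ ≤ M) ∧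
        ((f : Lp ℂ 2 (muW ω)) : ℂ → ℂ) =ᵐ[muW ω] F}
      zero_mem' := ⟨0, 0, differentiableOn_const 0, fun _ _ => by simp, Lp.coeFn_zero ℂ 2 (muW ω)⟩
      add_mem' := by
        rintro a b ⟨F, M, hF, hM, ha⟩ ⟨G, N, hG, hN, hb⟩
        refine ⟨F + G, M + N, hF.add hG, fun z hz => (norm_add_le _ _).trans (add_le_add (hM z hz) (hN z hz)), ?_⟩
        filter_upwards [Lp.coeFn_add (a : Lp ℂ 2 (muW ω)) b, ha, hb] with w h1 h2 h3
        rw [Submodule.coe_add, h1]; simp only [Pi.add_apply, h2, h3]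
      smul_mem' := by
        rintro c a ⟨F, M, hF, hM, ha⟩
        refine ⟨c • F, ‖c‖ * M, hF.const_smul c, fun z hz => ?_, ?_⟩
        · rw [Pi.smul_apply, norm_smul]; gcongr; exact hM z hz
        · filter_upwards [Lp.coeFn_smul c (a : Lp ℂ 2 (muW ω)), ha] with w h1 h2
          rw [Submodule.coe_smul, h1]; simp only [Pi.smul_apply, h2] } with hS
  have hmem : ∀ f : S, MemLp (fun z => g z * ((f : bergmanH ω) : Lp ℂ 2 (muW ω)) z) 2 (muW ω) := by
    rintro ⟨f, F, M, hF, hFM, hf⟩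
    have hFa : AEStronglyMeasurable F (muW ω) :=
      (aesm_muW_iff hW).2 (hF.continuousOn.aestronglyMeasurable hD)
    have hDae : ∀ᵐ z ∂(muW ω), z ∈ unitDisc := (ae_muW_iff hW).2 (ae_restrict_mem hD)
    refine MemLp.of_le_mul (c := M) hg (hg.1.mul (Lp.aestronglyMeasurable _)) ?_
    filter_upwards [hf, hDae] with z hz hzD
    rw [norm_mul, mul_comm]
    refine mul_le_mul_of_nonneg_right ?_ (norm_nonneg _)
    have := hFM z hzD
    rw [← hz] at this
    exact this
  set L0 : S →ₗ[ℂ] Lp ℂ 2 (muW ω) :=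
    { toFun := fun f => (hmem f).toLp
      map_add' := by
        intro a b
        rw [← MemLp.toLp_add]
        refine MemLp.toLp_congr _ _ ?_
        filter_upwards [Lp.coeFn_add ((a : bergmanH ω) : Lp ℂ 2 (muW ω)) b] with z hz
        simp only [Submodule.coe_add, hz, Pi.add_apply]; ring
      map_smul' := by
        intro c a
        rw [RingHom.id_apply, ← MemLp.toLp_const_smul]
        refine MemLp.toLp_congr _ _ ?_
        filter_upwards [Lp.coeFn_smul c ((a : bergmanH ω) : Lp ℂ 2 (muW ω))] with z hz
        simp only [Submodule.coe_smul, hz, Pi.smul_apply, smul_eq_mul]; ring } with hL0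
  set L : S →ₗ[ℂ] Lp ℂ 2 (muW ω) := L0 - ((bergmanProj ω : Lp ℂ 2 (muW ω) →ₗ[ℂ] Lp ℂ 2 (muW ω)).comp L0) with hLdef
  have hLapp : ∀ f, L f = (hmem f).toLp - bergmanProj ω (hmem f).toLp := fun f => rfl
  obtain ⟨T, hT⟩ := hilbert_extend S L (2 * (Real.sqrt K1 + Real.sqrt (2 * M ^ 2))) (by
    intro f
    obtain ⟨F, N, hF, hFN, hf⟩ := f.2
    rw [hLapp]
    refine bound (f : bergmanH ω) _ F hF hf ?_
    filter_upwards [(hmem f).coeFn_toLp, hf] with z h1 h2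
    rw [h1, h2])
  refine ⟨T, fun f F N hF hFN hf gF hgF => ?_⟩
  have hfS : f ∈ S := ⟨F, N, hF, hFN, hf⟩
  have := hT ⟨f, hfS⟩
  rw [hLapp] at this
  have e : gF = (hmem ⟨f, hfS⟩).toLp := by
    refine Lp.ext ?_
    filter_upwards [hgF, (hmem ⟨f, hfS⟩).coeFn_toLp, hf] with z h1 h2 h3
    rw [h1, h2, h3]
  rw [e]
  exact this
end hankel

section far
variable {ω φ : ℂ → ℝ} {τ : ℝ → ℝ} {c₁ c₂ : ℝ}

lemma tau_slope (hW : IsClassW ω φ τ) {ε : ℝ} (hε : 0 < ε) : ∃ ρ : ℝ, 0 ≤ ρ ∧ ρ < 1 ∧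
    ∀ s t, ρ < s → s ≤ t → t < 1 → τ s ≤ τ t + ε * (t - s) := by
  have h := hW.tau_deriv_lim.eventually (Metric.ball_mem_nhds 0 hε)
  rw [Filter.Eventually, mem_nhdsLT_iff_exists_Ioo_subset] at h
  obtain ⟨l, hl, hsub⟩ := h
  refine ⟨max l 0, le_max_right _ _, max_lt hl one_pos, fun s t hs hst ht => ?_⟩
  have hs0 : 0 < s := lt_of_le_of_lt (le_max_right _ _) hs
  have hsl : l < s := lt_of_le_of_lt (le_max_left _ _) hs
  have hd : ∀ x ∈ Icc s t, HasDerivWithinAt τ (deriv τ x) (Icc s t) x := fun x hx =>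
    ((hW.tau_diff x ⟨hs0.le.trans hx.1, hx.2.trans_lt ht⟩).hasDerivAt).hasDerivWithinAt
  have hb : ∀ x ∈ Icc s t, ‖deriv τ x‖ ≤ ε := by
    intro x hx
    have : x ∈ Ioo l 1 := ⟨hsl.trans_le hx.1, hx.2.trans_lt ht⟩
    have := hsub this
    have h2 : dist (deriv τ x) 0 < ε := this
    rw [dist_zero_right] at h2
    exact h2.le
  have := (convex_Icc s t).norm_image_sub_le_of_norm_hasDerivWithin_le hd hb
    (right_mem_Icc.2 hst) (left_mem_Icc.2 hst)
  rw [Real.norm_eq_abs, Real.norm_eq_abs, abs_sub_comm s t, abs_of_nonneg (sub_nonneg.2 hst)] at this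
  linarith [le_abs_self (τ s - τ t)]

lemma tau_far (hW : IsClassW ω φ τ) {K : ℝ} (hK : 1 ≤ K) : ∃ ρ : ℝ, 0 ≤ ρ ∧ ρ < 1 ∧
    ∀ a ∈ unitDisc, ρ < ‖a‖ → ∀ z ∈ unitDisc,
      K * τ ‖z‖ * (2 * K * τ ‖a‖) ≤ (2 * K * τ ‖a‖) ^ 2 + ‖z - a‖ ^ 2 := by
  obtain ⟨ρ, hρ0, hρ1, hsl⟩ := tau_slope hW (ε := 1 / K) (by positivity)
  set ρ1 := (1 + ρ) / 2 with hρ1d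
  have hτ0 : 0 < τ 0 := hW.tau_pos 0 ⟨le_rfl, one_pos⟩
  have hsm := hW.tau_lim.eventually (gt_mem_nhds (show (0:ℝ) < (ρ1 - ρ) ^ 2 / (2 * K * K * τ 0) by
    have : 0 < ρ1 - ρ := by rw [hρ1d]; linarith
    positivity))
  rw [Filter.Eventually, mem_nhdsLT_iff_exists_Ioo_subset] at hsm
  obtain ⟨l, hl, hsub⟩ := hsm
  refine ⟨max l ρ1, le_trans (by rw [hρ1d]; linarith) (le_max_right _ _),
    max_lt hl (by rw [hρ1d]; linarith), fun a ha hal z hz => ?_⟩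
  have ha1 := mem_unitDisc.1 ha
  have hz1 := mem_unitDisc.1 hz
  have hal1 : l < ‖a‖ := lt_of_le_of_lt (le_max_left _ _) hal
  have hal2 : ρ1 < ‖a‖ := lt_of_le_of_lt (le_max_right _ _) hal
  have hτa : 0 < τ ‖a‖ := hW.tau_pos _ ⟨norm_nonneg _, ha1⟩
  have hτz : 0 < τ ‖z‖ := hW.tau_pos _ ⟨norm_nonneg _, hz1⟩
  have hd : ‖a‖ - ‖z‖ ≤ ‖z - a‖ := by rw [norm_sub_rev]; exact norm_sub_norm_le a z
  rcases le_total ‖a‖ ‖z‖ with h | h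
  · have : τ ‖z‖ ≤ τ ‖a‖ := hW.tau_anti ⟨norm_nonneg _, ha1⟩ ⟨norm_nonneg _, hz1⟩ h
    have h1 : K * τ ‖z‖ * (2 * K * τ ‖a‖) ≤ K * τ ‖a‖ * (2 * K * τ ‖a‖) := by gcongr
    nlinarith [sq_nonneg ‖z - a‖, sq_nonneg (K * τ ‖a‖)]
  · rcases lt_or_ge ρ ‖z‖ with h' | h'
    · have h1 := hsl _ _ h' h ha1
      have h2 : K * τ ‖z‖ ≤ K * τ ‖a‖ + ‖z - a‖ := by
        calc K * τ ‖z‖ ≤ K * (τ ‖a‖ + 1 / K * (‖a‖ - ‖z‖)) := by gcongr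
          _ = K * τ ‖a‖ + (‖a‖ - ‖z‖) := by field_simp
          _ ≤ _ := by linarith
      have h3 : K * τ ‖z‖ * (2 * K * τ ‖a‖) ≤ (K * τ ‖a‖ + ‖z - a‖) * (2 * K * τ ‖a‖) := by gcongr
      nlinarith [sq_nonneg (‖z - a‖ - K * τ ‖a‖)]
    · have h1 : τ ‖a‖ < (ρ1 - ρ) ^ 2 / (2 * K * K * τ 0) := hsub ⟨hal1, ha1⟩
      rw [lt_div_iff₀ (by positivity)] at h1
      have h2 : τ ‖z‖ ≤ τ 0 := hW.tau_anti ⟨le_rfl, one_pos⟩ ⟨norm_nonneg _, hz1⟩ (norm_nonneg _)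
      have h3 : (ρ1 - ρ) ^ 2 ≤ ‖z - a‖ ^ 2 := by
        have : 0 ≤ ρ1 - ρ := by rw [hρ1d]; linarith
        gcongr
        linarith
      have h4 : K * τ ‖z‖ * (2 * K * τ ‖a‖) ≤ K * τ 0 * (2 * K * τ ‖a‖) := by gcongr
      nlinarith [sq_nonneg (2 * K * τ ‖a‖)]

end far

section potential

/-- The logarithmic potential used to perturb the weight. -/
def logPot (a : ℂ) (R : ℝ) (z : ℂ) : ℝ := Real.log (1 + ‖z - a‖ ^ 2 / R ^ 2) / 2

lemma contDiff_normsq_sub (a : ℂ) : ContDiff ℝ 2 (fun z : ℂ => ‖z - a‖ ^ 2) :=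
  (contDiff_norm_sq ℝ).comp (contDiff_id.sub contDiff_const)

lemma contDiff_logPot (a : ℂ) (R : ℝ) : ContDiff ℝ 2 (logPot a R) := by
  unfold logPot
  refine ContDiff.div_const (ContDiff.log ?_ ?_) _
  · exact contDiff_const.add ((contDiff_normsq_sub a).div_const _)
  · intro x; positivity

lemma hasFDerivAt_normsq (a z : ℂ) : HasFDerivAt (fun z : ℂ => ‖z - a‖ ^ 2)
    (2 • (innerSL ℝ (z - a))) z := by
  have := ((hasFDerivAt_id (𝕜 := ℝ) z).sub_const a).norm_sq
  simpa using this

lemma inner_one' (u : ℂ) : inner ℝ u (1 : ℂ) = u.re := by simp [Complex.inner]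
lemma inner_I' (u : ℂ) : inner ℝ u Complex.I = u.im := by simp [Complex.inner]

lemma fderiv_logPot (a : ℂ) {R : ℝ} (hR : 0 < R) (z v : ℂ) :
    fderiv ℝ (logPot a R) z v = inner ℝ (z - a) v / (R ^ 2 + ‖z - a‖ ^ 2) := by
  have h1 := (((hasFDerivAt_normsq a z).mul_const ((R ^ 2)⁻¹)).const_add 1)
  have h0 : (1 + ‖z - a‖ ^ 2 * (R ^ 2)⁻¹) ≠ 0 := by positivity
  have h2 := (h1.log h0).mul_const (2⁻¹ : ℝ)
  have h3 : fderiv ℝ (logPot a R) z = _ := h2.fderiv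
  rw [h3]
  simp
  field_simp
  ring

lemma laplacian_logPot (a : ℂ) {R : ℝ} (hR : 0 < R) (z : ℂ) :
    laplacian (logPot a R) z = 2 * R ^ 2 / (R ^ 2 + ‖z - a‖ ^ 2) ^ 2 := by
  unfold laplacian
  have hd : HasFDerivAt (fun z : ℂ => R ^ 2 + ‖z - a‖ ^ 2) (2 • (innerSL ℝ (z - a))) z :=
    (hasFDerivAt_normsq a z).const_add _
  have h0 : R ^ 2 + ‖z - a‖ ^ 2 ≠ 0 := by positivity
  have e : ∀ v : ℂ, fderiv ℝ (fun w => fderiv ℝ (logPot a R) w v) z v =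
      (‖v‖ ^ 2 * (R ^ 2 + ‖z - a‖ ^ 2) - 2 * (inner ℝ (z - a) v) ^ 2) / (R ^ 2 + ‖z - a‖ ^ 2) ^ 2 := by
    intro v
    have e1 : (fun w => fderiv ℝ (logPot a R) w v) = fun w => inner ℝ (w - a) v / (R ^ 2 + ‖w - a‖ ^ 2) := by
      ext w; exact fderiv_logPot a hR w v
    rw [e1]
    have hn : HasFDerivAt (fun w : ℂ => inner ℝ (w - a) v) (innerSL ℝ v) z := by
      have : HasFDerivAt (fun w : ℂ => innerSL ℝ v (w - a)) (innerSL ℝ v) z :=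
        (innerSL ℝ v).hasFDerivAt.comp z ((hasFDerivAt_id (𝕜 := ℝ) z).sub_const a)
      refine this.congr_of_eventuallyEq (Eventually.of_forall fun w => ?_)
      simp [real_inner_comm]
    have h1 := hn.mul ((hasDerivAt_inv h0).comp_hasFDerivAt z hd)
    have h2 : fderiv ℝ (fun w => inner ℝ (w - a) v / (R ^ 2 + ‖w - a‖ ^ 2)) z = _ := h1.fderiv
    rw [h2]
    simp only [_root_.add_apply, _root_.smul_apply, innerSL_apply_apply, Function.comp,
      real_inner_self_eq_norm_sq, smul_eq_mul]
    field_simp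
    ring
  rw [e, e, inner_one', inner_I']
  have e3 : ‖z - a‖ ^ 2 = (z - a).re ^ 2 + (z - a).im ^ 2 := by
    rw [← Complex.normSq_eq_norm_sq, Complex.normSq_apply]; ring
  rw [← add_div, norm_one, Complex.norm_I]
  congr 1
  linear_combination (2:ℝ) * e3

lemma laplacian_sub {φ ψ : ℂ → ℝ} (hφ : ContDiffOn ℝ 2 φ unitDisc) (hψ : ContDiffOn ℝ 2 ψ unitDisc)
    {z : ℂ} (hz : z ∈ unitDisc) : laplacian (fun w => φ w - ψ w) z = laplacian φ z - laplacian ψ z := by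
  have e0 : ∀ w ∈ unitDisc, fderiv ℝ (fun w => φ w - ψ w) w = fderiv ℝ φ w - fderiv ℝ ψ w := by
    intro w hw
    have h1 := (hφ.differentiableOn (by norm_num)).differentiableAt (isOpen_unitDisc.mem_nhds hw)
    have h2 := (hψ.differentiableOn (by norm_num)).differentiableAt (isOpen_unitDisc.mem_nhds hw)
    exact fderiv_fun_sub h1 h2
  have e1 : fderiv ℝ (fderiv ℝ (fun w => φ w - ψ w)) z = fderiv ℝ (fderiv ℝ φ) z - fderiv ℝ (fderiv ℝ ψ) z := by
    have : fderiv ℝ (fun w => φ w - ψ w) =ᶠ[nhds z] fun w => fderiv ℝ φ w - fderiv ℝ ψ w := by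
      filter_upwards [isOpen_unitDisc.mem_nhds hz] with w hw using e0 w hw
    rw [this.fderiv_eq]
    exact fderiv_fun_sub (hasFDerivAt_fderiv_disc hφ hz).differentiableAt (hasFDerivAt_fderiv_disc hψ hz).differentiableAt
  rw [laplacian_eq (hφ.sub hψ) hz, laplacian_eq hφ hz, laplacian_eq hψ hz, e1]
  simp; ring

end potential

section cutoff

/-- The radial profile of the cut-off construction. -/
def kap (s : ℝ) : ℝ := if s ≤ 1 then 2 - s else s⁻¹

/-- The derivative of `kap`. -/
def kap' (s : ℝ) : ℝ := if s ≤ 1 then -1 else -(s ^ 2)⁻¹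

lemma hasDerivAt_kap (s : ℝ) : HasDerivAt kap (kap' s) s := by
  rcases lt_trichotomy s 1 with h | h | h
  · have e : kap =ᶠ[nhds s] fun s => 2 - s := by
      filter_upwards [Iio_mem_nhds h] with x hx
      simp [kap, (mem_Iio.1 hx).le]
    have : kap' s = -1 := by simp [kap', h.le]
    rw [this]
    exact ((hasDerivAt_id s).const_sub 2).congr_of_eventuallyEq e
  · subst h
    have h1 : HasDerivWithinAt kap (-1) (Iic 1) 1 := by
      refine (((hasDerivAt_id (1:ℝ)).const_sub 2).hasDerivWithinAt).congr (fun x hx => ?_) ?_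
      · simp [kap, mem_Iic.1 hx]
      · simp [kap]
    have h2 : HasDerivWithinAt kap (-1) (Ici 1) 1 := by
      have := (hasDerivAt_inv (one_ne_zero (α := ℝ))).hasDerivWithinAt (s := Ici 1)
      simp only [one_pow, inv_one] at this
      refine this.congr (fun x hx => ?_) ?_
      · rcases eq_or_lt_of_le (mem_Ici.1 hx) with h | h
        · subst h; norm_num [kap]
        · simp [kap, not_le.2 h]
      · norm_num [kap]
    have h3 := h1.union h2
    rw [Iic_union_Ici, hasDerivWithinAt_univ] at h3
    simpa [kap'] using h3
  · have e : kap =ᶠ[nhds s] fun s => s⁻¹ := by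
      filter_upwards [Ioi_mem_nhds h] with x hx
      simp [kap, not_le.2 (mem_Ioi.1 hx)]
    have : kap' s = -(s ^ 2)⁻¹ := by simp [kap', not_le.2 h]
    rw [this]
    exact (hasDerivAt_inv (by linarith)).congr_of_eventuallyEq e

lemma continuous_kap' : Continuous kap' := by
  have e : kap' = fun s => -((max s 1) ^ 2)⁻¹ := by
    ext s
    rcases le_total s 1 with h | h
    · simp [kap', h]
    · rcases eq_or_lt_of_le h with h' | h'
      · subst h'; simp [kap']
      · simp [kap', not_le.2 h', h]
  rw [e]
  refine (Continuous.inv₀ (by fun_prop) ?_).neg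
  intro x
  have : 0 < max x 1 := lt_max_of_lt_right one_pos
  positivity

lemma contDiff_kap : ContDiff ℝ 1 kap := by
  rw [contDiff_one_iff_deriv]
  refine ⟨fun s => (hasDerivAt_kap s).differentiableAt, ?_⟩
  have : deriv kap = kap' := by ext s; exact (hasDerivAt_kap s).deriv
  rw [this]; exact continuous_kap'

lemma kap_E {s : ℝ} (hs : 0 ≤ s) : |kap s + s * kap' s| ≤ 2 ∧ (1 < s → kap s + s * kap' s = 0) := by
  by_cases h : s ≤ 1
  · refine ⟨?_, fun h' => absurd h (not_le.2 h')⟩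
    simp only [kap, kap', h, if_true]
    rw [abs_le]; constructor <;> linarith
  · have : kap s + s * kap' s = 0 := by
      simp only [kap, kap', h, if_false]
      have : s ≠ 0 := by rintro rfl; simp at h
      field_simp; ring
    rw [this]; simp

lemma kap_chi {s : ℝ} (hs : 0 ≤ s) : |1 - s * kap s| ≤ 1 ∧ (1 < s → 1 - s * kap s = 0) := by
  by_cases h : s ≤ 1
  · refine ⟨?_, fun h' => absurd h (not_le.2 h')⟩
    simp only [kap, h, if_true]
    rw [abs_le]; constructor <;> nlinarith
  · have : 1 - s * kap s = 0 := by
      simp only [kap, h, if_false]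
      have : s ≠ 0 := by rintro rfl; simp at h
      field_simp; ring
    rw [this]; simp

/-- The non-holomorphic part of the cut-off. -/
def cutU (a : ℂ) (R : ℝ) (z : ℂ) : ℂ :=
  (starRingEnd ℂ) (z - a) * (((R ^ 2)⁻¹ * kap (‖z - a‖ ^ 2 * (R ^ 2)⁻¹) : ℝ) : ℂ)

lemma contDiff_cutU (a : ℂ) (R : ℝ) : ContDiff ℝ 1 (cutU a R) := by
  unfold cutU
  refine ContDiff.mul ?_ ?_
  · exact Complex.conjCLE.contDiff.comp (contDiff_id.sub contDiff_const)
  · refine Complex.ofRealCLM.contDiff.comp (contDiff_const.mul (contDiff_kap.comp ?_))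
    exact ((contDiff_normsq_sub a).of_le (by norm_num)).mul contDiff_const

lemma dbar_cutU (a : ℂ) (R : ℝ) (z : ℂ) : dbar (cutU a R) z =
    (((R ^ 2)⁻¹ * (kap (‖z - a‖ ^ 2 * (R ^ 2)⁻¹) + ‖z - a‖ ^ 2 * (R ^ 2)⁻¹ * kap' (‖z - a‖ ^ 2 * (R ^ 2)⁻¹)) : ℝ) : ℂ) := by
  have h1 : HasFDerivAt (fun z : ℂ => (starRingEnd ℂ) (z - a)) (Complex.conjCLE : ℂ →L[ℝ] ℂ) z :=
    (Complex.conjCLE : ℂ →L[ℝ] ℂ).hasFDerivAt.comp z ((hasFDerivAt_id (𝕜 := ℝ) z).sub_const a)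
  have h2 := (hasFDerivAt_normsq a z).mul_const ((R ^ 2)⁻¹)
  have h3 := (hasDerivAt_kap (‖z - a‖ ^ 2 * (R ^ 2)⁻¹)).comp_hasFDerivAt z h2
  have h4 := h3.const_mul ((R ^ 2)⁻¹)
  have h5 := Complex.ofRealCLM.hasFDerivAt.comp z h4
  have h6 := h1.mul h5
  have h7 : fderiv ℝ (cutU a R) z = _ := h6.fderiv
  unfold dbar
  rw [h7]
  set s := ‖z - a‖ ^ 2 * (R ^ 2)⁻¹ with hs
  have e3 : ((‖z - a‖ ^ 2 : ℝ) : ℂ) = (z - a) * (starRingEnd ℂ) (z - a) := by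
    rw [Complex.mul_conj, Complex.normSq_eq_norm_sq]
  have e4 : ((z - a).re : ℂ) + Complex.I * (z - a).im = z - a := by
    rw [mul_comm]; exact Complex.re_add_im _
  simp only [_root_.add_apply, _root_.smul_apply, innerSL_apply_apply, Function.comp,
      smul_eq_mul, ContinuousLinearMap.comp_apply, inner_one', inner_I', Complex.ofRealCLM_apply,
      ContinuousLinearEquiv.coe_coe, Complex.conjCLE_apply, map_one, Complex.conj_I]
  push_cast
  have hI : Complex.I * Complex.I = -1 := Complex.I_mul_I
  have e5 : (s : ℂ) = (z - a) * (starRingEnd ℂ) (z - a) * ((R : ℂ) ^ 2)⁻¹ := by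
    rw [← e3, hs]; push_cast; rfl
  rw [e5, ← hs]
  simp only [nsmul_eq_mul]
  push_cast
  linear_combination (starRingEnd ℂ) (z - a) * (((R : ℂ) ^ 2)⁻¹) ^ 2 * (kap' s : ℂ) * e4
    - ((R : ℂ) ^ 2)⁻¹ * (kap s : ℂ) / 2 * hI

end cutoff

section peak
variable {ω φ : ℂ → ℝ} {τ : ℝ → ℝ} {c₁ c₂ : ℝ}

lemma lint_le_closedBall {f : ℂ → ℝ} {c r : ℝ} {a : ℂ} (hc : 0 ≤ c) (hr : 0 ≤ r)
    (h1 : ∀ z ∈ unitDisc, ‖z - a‖ ≤ r → f z ≤ c) (h2 : ∀ z ∈ unitDisc, r < ‖z - a‖ → f z ≤ 0) :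
    ∫⁻ z in unitDisc, ENNReal.ofReal (f z) ≤ ENNReal.ofReal (c * (Real.pi * r ^ 2)) := by
  have h3 : ∀ z ∈ unitDisc, ENNReal.ofReal (f z) ≤
      (Metric.closedBall a r).indicator (fun _ => ENNReal.ofReal c) z := by
    intro z hz
    by_cases h : ‖z - a‖ ≤ r
    · rw [indicator_of_mem (by simpa [dist_eq_norm] using h)]
      exact ENNReal.ofReal_le_ofReal (h1 z hz h)
    · rw [ENNReal.ofReal_of_nonpos (h2 z hz (not_le.1 h))]
      exact zero_le
  calc ∫⁻ z in unitDisc, ENNReal.ofReal (f z)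
      ≤ ∫⁻ z in unitDisc, (Metric.closedBall a r).indicator (fun _ => ENNReal.ofReal c) z :=
        setLIntegral_mono' measurableSet_unitDisc h3
    _ ≤ ∫⁻ z, (Metric.closedBall a r).indicator (fun _ => ENNReal.ofReal c) z :=
        setLIntegral_le_lintegral _ _
    _ = ENNReal.ofReal c * volume (Metric.closedBall a r) := by
        rw [lintegral_indicator Metric.isClosed_closedBall.measurableSet, setLIntegral_const]
    _ = ENNReal.ofReal (c * (Real.pi * r ^ 2)) := by
        rw [Complex.volume_closedBall, ENNReal.ofReal_mul hc, mul_comm Real.pi,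
          ENNReal.ofReal_mul (by positivity), ENNReal.ofReal_pow hr]
        congr 2
        rw [ENNReal.ofReal, ← NNReal.coe_real_pi, Real.toNNReal_coe]

set_option maxHeartbeats 1000000 in
lemma peak (hW : IsClassW ω φ τ) (hL : IsClassL (radialize τ) c₁ c₂) :
    ∃ C1 : ℝ, 0 < C1 ∧ ∃ ρ : ℝ, 0 ≤ ρ ∧ ρ < 1 ∧ ∀ a ∈ unitDisc, ρ < ‖a‖ →
      ∃ f : ℂ → ℂ, DifferentiableOn ℂ f unitDisc ∧ f a = Complex.exp (φ a) ∧
        ∫⁻ z in unitDisc, ENNReal.ofReal (‖f z‖ ^ 2 * Real.exp (-(2 * φ z))) ≤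
          ENNReal.ofReal (C1 * τ ‖a‖ ^ 2) := by
  obtain ⟨C, hC1, hlap⟩ := lap_bounds hW
  obtain ⟨C0, hC0, happ⟩ := approx_hol hW hL
  obtain ⟨ρ, hρ0, hρ1, hfar⟩ := tau_far hW (K := 2 * C) (by linarith)
  set m := mTau c₁ c₂ with hm
  have hmpos : 0 < m := mTau_pos hL.c₁_pos hL.c₂_pos
  have hm4 : m ≤ 1 / 4 := (mTau_le hL.c₁_pos hL.c₂_pos).1
  set E := Real.exp (2 * C0) with hE
  have hEpos : 0 < E := Real.exp_pos _
  set Ki := 25 * Real.pi * C * E / m ^ 2 with hKi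
  have hKipos : 0 < Ki := by have := Real.pi_pos; positivity
  refine ⟨2 * E * (Real.pi * m ^ 2) + 2 * (4 * C) ^ 2 * (2 * Ki), by have := Real.pi_pos; positivity,
    ρ, hρ0, hρ1, fun a ha haρ => ?_⟩
  obtain ⟨p, hp⟩ := happ a ha
  set t := τ ‖a‖ with ht
  have htpos : 0 < t := tau_pos' hL ha
  set R1 := 2 * (2 * C) * t with hR1
  have hR1pos : 0 < R1 := by positivity
  set R := m * t with hR
  have hRpos : 0 < R := by positivity
  have hRR1 : R ≤ R1 := by
    rw [hR, hR1]
    exact mul_le_mul_of_nonneg_right (by linarith) htpos.le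
  set H : ℂ → ℂ := fun z => (φ a : ℂ) + p * (z - a) with hH
  have hHd : Differentiable ℂ (fun z => Complex.exp (H z)) := by
    rw [hH]; fun_prop
  have hHn : ∀ z, ‖Complex.exp (H z)‖ = Real.exp (φ a + (p * (z - a)).re) := by
    intro z; rw [Complex.norm_exp, hH]; simp
  have hHb : ∀ z, ‖z - a‖ ≤ R → ‖Complex.exp (H z)‖ ^ 2 * Real.exp (-(2 * φ z)) ≤ E := by
    intro z hz
    have := (abs_le.1 (hp z hz)).2
    rw [hHn, ← Real.exp_nat_mul, ← Real.exp_add, hE]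
    apply Real.exp_le_exp.2
    push_cast
    linarith
  set θ : ℂ → ℝ := fun z => φ z - logPot a R1 z with hθ
  have hlogc : ContDiffOn ℝ 2 (logPot a R1) unitDisc := (contDiff_logPot a R1).contDiffOn
  have hθs : ContDiffOn ℝ 2 θ unitDisc := hW.smooth.sub hlogc
  have hθe : ∀ z, Real.exp (-(2 * θ z)) = Real.exp (-(2 * φ z)) * (1 + ‖z - a‖ ^ 2 / R1 ^ 2) := by
    intro z
    have : -(2 * θ z) = -(2 * φ z) + Real.log (1 + ‖z - a‖ ^ 2 / R1 ^ 2) := by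
      simp only [hθ, logPot]; ring
    rw [this, Real.exp_add, Real.exp_log (by positivity)]
  have hθl : ∀ z ∈ unitDisc, 1 / (2 * C * τ ‖z‖ ^ 2) ≤ laplacian θ z := by
    intro z hz
    have hτz : 0 < τ ‖z‖ := tau_pos' hL hz
    rw [hθ, laplacian_sub hW.smooth hlogc hz, laplacian_logPot a hR1pos]
    have h1 := (hlap z hz).1
    have h2 := hfar a ha haρ z hz
    rw [← ht, ← hR1] at h2
    set Q := R1 ^ 2 + ‖z - a‖ ^ 2 with hQ
    have hQpos : 0 < Q := by positivity
    have h3 : 4 * C * τ ‖z‖ ^ 2 * R1 ^ 2 ≤ Q ^ 2 := by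
      have h4 : (2 * C * τ ‖z‖ * R1) ^ 2 ≤ Q ^ 2 := by gcongr
      have h5 : 4 * C * τ ‖z‖ ^ 2 * R1 ^ 2 ≤ 4 * (C * C) * τ ‖z‖ ^ 2 * R1 ^ 2 := by
        gcongr; nlinarith
      nlinarith
    have h6 : 2 * R1 ^ 2 / Q ^ 2 ≤ 1 / (2 * C * τ ‖z‖ ^ 2) := by
      rw [div_le_div_iff₀ (by positivity) (by positivity)]
      nlinarith
    have h7 : 1 / (C * τ ‖z‖ ^ 2) = 1 / (2 * C * τ ‖z‖ ^ 2) + 1 / (2 * C * τ ‖z‖ ^ 2) := by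
      field_simp; norm_num
    linarith
  have hθpos : ∀ z ∈ unitDisc, 0 < laplacian θ z := by
    intro z hz
    have hτz : 0 < τ ‖z‖ := tau_pos' hL hz
    exact lt_of_lt_of_le (by positivity) (hθl z hz)
  set u0 : ℂ → ℂ := fun z => (-cutU a R z) * Complex.exp (H z) with hu0
  have hcd : ContDiff ℝ 1 (fun z => -cutU a R z) := (contDiff_cutU a R).neg
  have hu0s : ContDiffOn ℝ 1 u0 unitDisc := by
    refine (hcd.mul ?_).contDiffOn
    exact (hHd.contDiff (n := 1)).restrict_scalars ℝ
  have hdb : ∀ z, dbar u0 z = -dbar (cutU a R) z * Complex.exp (H z) := by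
    intro z
    have h1 := dbar_holo_mul (F := fun z => Complex.exp (H z)) (g := fun z => -cutU a R z) (z := z)
      (hHd z) (hcd.differentiable (by norm_num) z)
    rw [hu0, h1]
    congr 1
    have : (fun z => -cutU a R z) = -(cutU a R) := rfl
    unfold dbar
    rw [this, fderiv_neg]
    simp; ring
  have hs1 : ∀ z, ‖z - a‖ ≤ R → ‖z - a‖ ^ 2 * (R ^ 2)⁻¹ ≤ 1 := by
    intro z hz
    rw [← div_eq_mul_inv, div_le_one (by positivity)]
    gcongr
  have hs2 : ∀ z, R < ‖z - a‖ → 1 < ‖z - a‖ ^ 2 * (R ^ 2)⁻¹ := by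
    intro z hz
    rw [← div_eq_mul_inv, one_lt_div (by positivity)]
    gcongr
  have hs0 : ∀ z, 0 ≤ ‖z - a‖ ^ 2 * (R ^ 2)⁻¹ := fun z => by positivity
  have hdb0 : ∀ z, R < ‖z - a‖ → dbar u0 z = 0 := by
    intro z hz
    rw [hdb, dbar_cutU, (kap_E (hs0 z)).2 (hs2 z hz)]; simp
  have hdbn : ∀ z, ‖dbar u0 z‖ ^ 2 ≤ 4 / R ^ 4 * ‖Complex.exp (H z)‖ ^ 2 := by
    intro z
    rw [hdb, norm_mul, norm_neg, mul_pow]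
    refine mul_le_mul_of_nonneg_right ?_ (by positivity)
    rw [dbar_cutU, Complex.norm_real, Real.norm_eq_abs, abs_mul, mul_pow,
      abs_of_pos (show 0 < (R ^ 2)⁻¹ by positivity)]
    have h1 := (kap_E (hs0 z)).1
    have h2 := pow_le_pow_left₀ (abs_nonneg _) h1 2
    calc _ ≤ ((R ^ 2)⁻¹) ^ 2 * 2 ^ 2 := by gcongr
      _ = 4 / R ^ 4 := by field_simp; norm_num
  have hK : ∫⁻ z in unitDisc, ENNReal.ofReal (‖dbar u0 z‖ ^ 2 / laplacian θ z * Real.exp (-(2 * θ z))) ≤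
      ENNReal.ofReal Ki := by
    have key : Ki = (25 * C * E * t ^ 2 / R ^ 4) * (Real.pi * R ^ 2) := by
      rw [hKi, hR]; field_simp
    rw [key]
    refine lint_le_closedBall (a := a) (by positivity) hRpos.le (fun z hz hzr => ?_) (fun z hz hzr => ?_)
    · obtain ⟨-, -, hg3⟩ := geom hL ha hzr
      have hτz : 0 < τ ‖z‖ := tau_pos' hL hz
      have h1 : (laplacian θ z)⁻¹ ≤ 2 * C * (5 / 4 * t) ^ 2 := by
        have h2 := inv_anti₀ (by positivity) (hθl z hz)
        rw [one_div, inv_inv] at h2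
        refine h2.trans ?_
        gcongr
      have h3 : 1 + ‖z - a‖ ^ 2 / R1 ^ 2 ≤ 2 := by
        have : ‖z - a‖ ^ 2 / R1 ^ 2 ≤ 1 := by
          rw [div_le_one (by positivity)]
          exact pow_le_pow_left₀ (norm_nonneg _) (hzr.trans hRR1) 2
        linarith
      have h4 : 0 < (laplacian θ z)⁻¹ := inv_pos.2 (hθpos z hz)
      calc ‖dbar u0 z‖ ^ 2 / laplacian θ z * Real.exp (-(2 * θ z))
          = ‖dbar u0 z‖ ^ 2 * (laplacian θ z)⁻¹ * (Real.exp (-(2 * φ z)) * (1 + ‖z - a‖ ^ 2 / R1 ^ 2)) := by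
            rw [hθe, div_eq_mul_inv]
        _ ≤ (4 / R ^ 4 * ‖Complex.exp (H z)‖ ^ 2) * (2 * C * (5 / 4 * t) ^ 2) *
            (Real.exp (-(2 * φ z)) * 2) := by
            gcongr
            exact hdbn z
        _ = (25 * C * t ^ 2 / R ^ 4) * (‖Complex.exp (H z)‖ ^ 2 * Real.exp (-(2 * φ z))) := by ring
        _ ≤ (25 * C * t ^ 2 / R ^ 4) * E := by
            gcongr
            exact hHb z hzr
        _ = _ := by ring
    · rw [hdb0 z hzr]; simp
  obtain ⟨h, hh, hhb⟩ := hormander hθs hθpos hu0s hKipos.le hK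
  refine ⟨fun z => Complex.exp (H z) + (z - a) * h z, ?_, ?_, ?_⟩
  · exact hHd.differentiableOn.add (((differentiable_id.sub_const a).differentiableOn).mul hh)
  · simp [hH]
  have hdec : ∀ z, Complex.exp (H z) + (z - a) * h z =
      ((1 - ‖z - a‖ ^ 2 * (R ^ 2)⁻¹ * kap (‖z - a‖ ^ 2 * (R ^ 2)⁻¹) : ℝ) : ℂ) * Complex.exp (H z) -
        (z - a) * (u0 z - h z) := by
    intro z
    have e3 : ((‖z - a‖ : ℝ) : ℂ) ^ 2 = (z - a) * (starRingEnd ℂ) (z - a) := by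
      rw [Complex.mul_conj, Complex.normSq_eq_norm_sq]; push_cast; rfl
    simp only [hu0, cutU]
    push_cast
    rw [e3]; ring
  have hA : ∫⁻ z in unitDisc, ENNReal.ofReal (2 * ((1 - ‖z - a‖ ^ 2 * (R ^ 2)⁻¹ * kap (‖z - a‖ ^ 2 * (R ^ 2)⁻¹)) ^ 2 *
      (‖Complex.exp (H z)‖ ^ 2 * Real.exp (-(2 * φ z))))) ≤ ENNReal.ofReal (2 * E * (Real.pi * R ^ 2)) := by
    refine lint_le_closedBall (a := a) (by positivity) hRpos.le (fun z hz hzr => ?_) (fun z hz hzr => ?_)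
    · have h1 := (kap_chi (hs0 z)).1
      have h2 := sq_le_one_iff_abs_le_one _ |>.2 h1
      have h3 := hHb z hzr
      have h4 : 0 ≤ ‖Complex.exp (H z)‖ ^ 2 * Real.exp (-(2 * φ z)) := by positivity
      nlinarith
    · rw [(kap_chi (hs0 z)).2 (hs2 z hzr)]; simp
  have hB : ∫⁻ z in unitDisc, ENNReal.ofReal (2 * R1 ^ 2 * (‖u0 z - h z‖ ^ 2 * Real.exp (-(2 * θ z)))) ≤
      ENNReal.ofReal (2 * R1 ^ 2 * (2 * Ki)) := by
    rw [ENNReal.ofReal_mul (by positivity)]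
    calc _ = ∫⁻ z in unitDisc, ENNReal.ofReal (2 * R1 ^ 2) * ENNReal.ofReal (‖u0 z - h z‖ ^ 2 * Real.exp (-(2 * θ z))) := by
          refine lintegral_congr fun z => ?_
          rw [ENNReal.ofReal_mul (by positivity)]
      _ = _ := lintegral_const_mul' _ _ ENNReal.ofReal_ne_top
      _ ≤ _ := mul_le_mul' le_rfl hhb
  have hmeasA : Measurable (fun z : ℂ => ENNReal.ofReal (2 * ((1 - ‖z - a‖ ^ 2 * (R ^ 2)⁻¹ * kap (‖z - a‖ ^ 2 * (R ^ 2)⁻¹)) ^ 2 *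
      (‖Complex.exp (H z)‖ ^ 2)))) := by
    refine Measurable.ennreal_ofReal ?_
    have := contDiff_kap.continuous
    have := hHd.continuous
    apply Continuous.measurable
    fun_prop
  have hφm : AEMeasurable (fun z => Real.exp (-(2 * φ z))) (volume.restrict unitDisc) := by
    refine (ContinuousOn.aemeasurable ?_ measurableSet_unitDisc)
    exact Real.continuous_exp.comp_continuousOn ((hW.smooth.continuousOn.const_smul (2:ℝ)).neg)
  have hmeasA' : AEMeasurable (fun z : ℂ => ENNReal.ofReal (2 * ((1 - ‖z - a‖ ^ 2 * (R ^ 2)⁻¹ * kap (‖z - a‖ ^ 2 * (R ^ 2)⁻¹)) ^ 2 *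
      (‖Complex.exp (H z)‖ ^ 2 * Real.exp (-(2 * φ z)))))) (volume.restrict unitDisc) := by
    refine (hmeasA.aemeasurable.mul hφm.ennreal_ofReal).congr (Eventually.of_forall fun z => ?_)
    simp only [Pi.mul_apply]
    rw [← ENNReal.ofReal_mul (by positivity)]
    congr 1; ring
  calc _ ≤ ∫⁻ z in unitDisc, (ENNReal.ofReal (2 * ((1 - ‖z - a‖ ^ 2 * (R ^ 2)⁻¹ * kap (‖z - a‖ ^ 2 * (R ^ 2)⁻¹)) ^ 2 *
      (‖Complex.exp (H z)‖ ^ 2 * Real.exp (-(2 * φ z))))) +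
        ENNReal.ofReal (2 * R1 ^ 2 * (‖u0 z - h z‖ ^ 2 * Real.exp (-(2 * θ z))))) := by
        refine setLIntegral_mono' measurableSet_unitDisc fun z hz => ?_
        rw [← ENNReal.ofReal_add (by positivity) (by positivity)]
        apply ENNReal.ofReal_le_ofReal
        beta_reduce
        rw [hdec, hθe]
        set χ := 1 - ‖z - a‖ ^ 2 * (R ^ 2)⁻¹ * kap (‖z - a‖ ^ 2 * (R ^ 2)⁻¹) with hχ
        have h1 : ‖(χ : ℂ) * Complex.exp (H z) - (z - a) * (u0 z - h z)‖ ^ 2 ≤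
            2 * (χ ^ 2 * ‖Complex.exp (H z)‖ ^ 2) + 2 * (‖z - a‖ ^ 2 * ‖u0 z - h z‖ ^ 2) := by
          have h2 := norm_sub_le ((χ : ℂ) * Complex.exp (H z)) ((z - a) * (u0 z - h z))
          rw [norm_mul, norm_mul, Complex.norm_real, Real.norm_eq_abs] at h2
          have h3 := pow_le_pow_left₀ (norm_nonneg _) h2 2
          have h4 : χ ^ 2 = |χ| ^ 2 := (sq_abs χ).symm
          rw [h4]
          nlinarith [sq_nonneg (|χ| * ‖Complex.exp (H z)‖ - ‖z - a‖ * ‖u0 z - h z‖)]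
        have h5 : ‖z - a‖ ^ 2 ≤ R1 ^ 2 * (1 + ‖z - a‖ ^ 2 / R1 ^ 2) := by
          have : R1 ^ 2 * (1 + ‖z - a‖ ^ 2 / R1 ^ 2) = R1 ^ 2 + ‖z - a‖ ^ 2 := by field_simp
          rw [this]; nlinarith
        have h6 := mul_le_mul_of_nonneg_right h5 (sq_nonneg ‖u0 z - h z‖)
        have hexp := Real.exp_pos (-(2 * φ z))
        calc _ ≤ (2 * (χ ^ 2 * ‖Complex.exp (H z)‖ ^ 2) + 2 * (R1 ^ 2 * (1 + ‖z - a‖ ^ 2 / R1 ^ 2) * ‖u0 z - h z‖ ^ 2)) *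
              Real.exp (-(2 * φ z)) := by
              refine mul_le_mul_of_nonneg_right ?_ hexp.le
              linarith
          _ = _ := by ring
    _ ≤ ENNReal.ofReal (2 * E * (Real.pi * R ^ 2)) + ENNReal.ofReal (2 * R1 ^ 2 * (2 * Ki)) := by
        rw [lintegral_add_left' hmeasA']
        exact add_le_add hA hB
    _ = _ := by
        rw [← ENNReal.ofReal_add (by have := Real.pi_pos; positivity) (by positivity)]
        congr 1
        rw [hR, hR1]; ring

end peak

section peak2
variable {ω φ : ℂ → ℝ} {τ : ℝ → ℝ} {c₁ c₂ : ℝ}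

lemma peak2 (hW : IsClassW ω φ τ) (hL : IsClassL (radialize τ) c₁ c₂) :
    ∃ δ₀ : ℝ, 0 < δ₀ ∧ δ₀ < mTau c₁ c₂ ∧ ∃ c : ℝ, 0 < c ∧
    ∃ C1 : ℝ, 0 < C1 ∧ ∃ ρ : ℝ, 0 ≤ ρ ∧ ρ < 1 ∧ ∀ a ∈ unitDisc, ρ < ‖a‖ →
      ∃ f : ℂ → ℂ, DifferentiableOn ℂ f unitDisc ∧
        (∀ z, ‖z - a‖ ≤ δ₀ * τ ‖a‖ → c ≤ ‖f z‖ ^ 2 * Real.exp (-(2 * φ z))) ∧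
        ∫⁻ z in unitDisc, ENNReal.ofReal (‖f z‖ ^ 2 * Real.exp (-(2 * φ z))) ≤
          ENNReal.ofReal (C1 * τ ‖a‖ ^ 2) := by
  obtain ⟨C1, hC1, ρ, hρ0, hρ1, hpk⟩ := peak hW hL
  obtain ⟨C0, hC0, happ⟩ := approx_hol hW hL
  obtain ⟨Cw, hCw, hws⟩ := wsubmean hW hL
  set m := mTau c₁ c₂ with hm
  have hmpos : 0 < m := mTau_pos hL.c₁_pos hL.c₂_pos
  set ε := m / 2 with hε
  have hεpos : 0 < ε := by positivity
  set E := Real.exp (2 * C0) with hE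
  have hEpos : 0 < E := Real.exp_pos _
  set B := Cw / (ε * (3 / 4)) ^ 2 * C1 with hB
  have hBpos : 0 < B := by positivity
  set B' := Real.sqrt (B * E) with hB'
  have hB'0 : 0 ≤ B' := Real.sqrt_nonneg _
  refine ⟨m / (2 * (B' + 1)), by positivity, ?_, Real.exp (-(2 * C0)) / 4, by positivity,
    C1, hC1, ρ, hρ0, hρ1, fun a ha haρ => ?_⟩
  · rw [div_lt_iff₀ (by positivity)]; nlinarith
  obtain ⟨f, hf, hfa, hfi⟩ := hpk a ha haρ
  refine ⟨f, hf, ?_, hfi⟩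
  obtain ⟨p, hp⟩ := happ a ha
  set t := τ ‖a‖ with ht
  have htpos : 0 < t := tau_pos' hL ha
  have hub : ∀ z, ‖z - a‖ ≤ m * t → ‖f z‖ ^ 2 * Real.exp (-(2 * φ z)) ≤ B := by
    intro z hz
    obtain ⟨hzD, hg2, -⟩ := geom hL ha hz
    have h1 := hws f hf z hzD ε hεpos (by rw [hε]; linarith)
    have hτz : 0 < τ ‖z‖ := tau_pos' hL hzD
    have hsub : Metric.ball z (ε * τ ‖z‖) ⊆ unitDisc := by
      refine (Metric.ball_subset_closedBall.trans (Metric.closedBall_subset_closedBall ?_)).trans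
        (closedBall_sub hL hzD)
      exact mul_le_mul_of_nonneg_right (by rw [hε]; linarith) hτz.le
    have h2 := h1.trans (mul_le_mul' le_rfl ((lintegral_mono_set hsub).trans hfi))
    rw [← ENNReal.ofReal_mul (by positivity), ENNReal.ofReal_le_ofReal_iff (by positivity)] at h2
    refine h2.trans ?_
    rw [hB]
    have h3 : (ε * (3 / 4) * t) ^ 2 ≤ (ε * τ ‖z‖) ^ 2 := by
      refine pow_le_pow_left₀ (by positivity) ?_ 2
      rw [mul_assoc]
      exact mul_le_mul_of_nonneg_left hg2 hεpos.le
    calc Cw / (ε * τ ‖z‖) ^ 2 * (C1 * t ^ 2) ≤ Cw / (ε * (3 / 4) * t) ^ 2 * (C1 * t ^ 2) := by gcongr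
      _ = _ := by field_simp
  set H : ℂ → ℂ := fun z => (φ a : ℂ) + p * (z - a) with hH
  set G : ℂ → ℂ := fun z => f z * Complex.exp (-H z) with hG
  have hGn : ∀ z, ‖G z‖ ^ 2 = ‖f z‖ ^ 2 * Real.exp (-(2 * (φ a + (p * (z - a)).re))) := by
    intro z
    rw [hG]
    simp only
    rw [norm_mul, mul_pow, Complex.norm_exp, ← Real.exp_nat_mul]
    congr 2
    simp [hH]
    ring
  have hGa : G a = 1 := by
    simp only [hG, hH, hfa]
    rw [← Complex.exp_add]; simp
  have hmt : 0 < m * t := by positivity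
  have hGd : DifferentiableOn ℂ G (Metric.ball a (m * t)) := by
    refine (hf.mono (Metric.ball_subset_closedBall.trans (closedBall_sub hL ha))).mul ?_
    have : Differentiable ℂ (fun z => Complex.exp (-H z)) := by rw [hH]; fun_prop
    exact this.differentiableOn
  have hGb : ∀ z, ‖z - a‖ ≤ m * t → ‖G z‖ ≤ B' := by
    intro z hz
    apply Real.le_sqrt_of_sq_le
    rw [hGn]
    have h1 := (abs_le.1 (hp z hz)).1
    calc _ = (‖f z‖ ^ 2 * Real.exp (-(2 * φ z))) * Real.exp (2 * φ z - 2 * (φ a + (p * (z - a)).re)) := by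
          rw [mul_assoc, ← Real.exp_add]; congr 2; ring
      _ ≤ B * E := by
          refine mul_le_mul (hub z hz) ?_ (Real.exp_pos _).le hBpos.le
          apply Real.exp_le_exp.2
          linarith
  have hmaps : MapsTo G (Metric.ball a (m * t)) (Metric.closedBall (G a) (B' + 1)) := by
    intro z hz
    rw [Metric.mem_ball, dist_eq_norm] at hz
    rw [Metric.mem_closedBall, dist_eq_norm, hGa]
    calc _ ≤ ‖G z‖ + ‖(1:ℂ)‖ := norm_sub_le _ _
      _ ≤ _ := by rw [norm_one]; linarith [hGb z hz.le]
  intro z hz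
  have hzm : ‖z - a‖ < m * t := by
    refine hz.trans_lt (mul_lt_mul_of_pos_right ?_ htpos)
    rw [div_lt_iff₀ (by positivity)]; nlinarith
  have h1 := Complex.dist_le_div_mul_dist_of_mapsTo_ball hGd hmaps
    (show z ∈ Metric.ball a (m * t) by rwa [Metric.mem_ball, dist_eq_norm])
  rw [dist_eq_norm, dist_eq_norm, hGa] at h1
  have h2 : (B' + 1) / (m * t) * ‖z - a‖ ≤ 1 / 2 := by
    calc _ ≤ (B' + 1) / (m * t) * (m / (2 * (B' + 1)) * t) := by gcongr
      _ = 1 / 2 := by field_simp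
  have h3 : 1 / 2 ≤ ‖G z‖ := by
    have h4 : ‖(1:ℂ)‖ ≤ ‖G z‖ + ‖G z - 1‖ := by
      calc ‖(1:ℂ)‖ = ‖G z - (G z - 1)‖ := by congr 1; ring
        _ ≤ _ := norm_sub_le _ _
    rw [norm_one] at h4
    linarith
  have h5 : 1 / 4 ≤ ‖G z‖ ^ 2 := by nlinarith
  have h6 := (abs_le.1 (hp z hzm.le)).1
  calc Real.exp (-(2 * C0)) / 4 = 1 / 4 * Real.exp (-(2 * C0)) := by ring
    _ ≤ ‖G z‖ ^ 2 * Real.exp (2 * (φ a + (p * (z - a)).re) - 2 * φ z) := by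
        refine mul_le_mul h5 ?_ (Real.exp_pos _).le (by positivity)
        apply Real.exp_le_exp.2
        linarith
    _ = _ := by
        rw [hGn, mul_assoc, ← Real.exp_add]; congr 2; ring

end peak2

section testfun
variable {ω φ : ℂ → ℝ} {τ : ℝ → ℝ} {c₁ c₂ : ℝ}

lemma phi_mono (hW : IsClassW ω φ τ) (hL : IsClassL (radialize τ) c₁ c₂) {z : ℂ} (hz : z ∈ unitDisc)
    {r : ℝ} (h0 : 0 ≤ r) (h1 : r ≤ 1) : φ ((r : ℂ) * z) ≤ φ z := by
  obtain ⟨C, hC, hlap⟩ := lap_bounds hW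
  have hmem : ∀ t ∈ Icc (0:ℝ) 1, ((t : ℂ) * z) ∈ unitDisc := by
    intro t ht
    rw [mem_unitDisc, norm_mul, Complex.norm_real, Real.norm_eq_abs, abs_of_nonneg ht.1]
    have := mem_unitDisc.1 hz
    nlinarith [norm_nonneg z, ht.2]
  have hder : ∀ t ∈ Icc (0:ℝ) 1, HasDerivAt (fun t : ℝ => φ ((t : ℂ) * z)) (fderiv ℝ φ ((t : ℂ) * z) z) t := by
    intro t ht
    have h2 := ((hW.smooth.differentiableOn (by norm_num)).differentiableAt
      (isOpen_unitDisc.mem_nhds (hmem t ht))).hasFDerivAt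
    have h3 : HasDerivAt (fun t : ℝ => (t : ℂ) * z) (1 * z) t :=
      (Complex.ofRealCLM.hasDerivAt (x := t)).mul_const z
    rw [one_mul] at h3
    exact h2.comp_hasDerivAt t h3
  have hmono : MonotoneOn (fun t : ℝ => φ ((t : ℂ) * z)) (Icc 0 1) := by
    refine monotoneOn_of_deriv_nonneg (convex_Icc 0 1)
      (fun t ht => (hder t ht).continuousAt.continuousWithinAt) ?_ ?_
    · rw [interior_Icc]
      exact fun t ht => (hder t (Ioo_subset_Icc_self ht)).differentiableAt.differentiableWithinAt
    · rw [interior_Icc]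
      intro t ht
      rw [(hder t (Ioo_subset_Icc_self ht)).deriv]
      have hm := hmem t (Ioo_subset_Icc_self ht)
      have hM : ∀ w, ‖w‖ ≤ ‖(t : ℂ) * z‖ → 0 ≤ laplacian φ w ∧
          laplacian φ w ≤ C / τ ‖(t : ℂ) * z‖ ^ 2 := by
        intro w hw
        have hwD : w ∈ unitDisc := mem_unitDisc.2 (hw.trans_lt (mem_unitDisc.1 hm))
        refine ⟨(hW.lap_pos w hwD).le, (hlap w hwD).2.trans ?_⟩
        have h4 := hW.tau_anti ⟨norm_nonneg _, mem_unitDisc.1 hwD⟩ ⟨norm_nonneg _, mem_unitDisc.1 hm⟩ hw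
        have h5 := tau_pos' hL hm
        gcongr
      have h6 := (radial_first hW.smooth hW.radial hm hM).1
      have h7 : fderiv ℝ φ ((t : ℂ) * z) ((t : ℂ) * z) = t * fderiv ℝ φ ((t : ℂ) * z) z := by
        have : (t : ℂ) * z = t • z := by simp
        conv_lhs => rw [this]
        rw [map_smul, smul_eq_mul, ← this]
      rw [h7] at h6
      exact nonneg_of_mul_nonneg_right h6 ht.1
  have := hmono (a := r) ⟨h0, h1⟩ (b := 1) ⟨zero_le_one, le_rfl⟩ h1
  simpa using this

lemma lintegral_dil (k : ℂ → ℝ≥0∞) {r : ℝ} (hr : 0 < r) :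
    ∫⁻ z, k ((r : ℂ) * z) = ENNReal.ofReal ((r ^ 2)⁻¹) * ∫⁻ z, k z := by
  have h := Measure.map_addHaar_smul (volume : Measure ℂ) hr.ne'
  have he : MeasurableEmbedding (fun z : ℂ => r • z) :=
    (Homeomorph.smulOfNeZero r hr.ne').measurableEmbedding
  have h1 : ∫⁻ z, k z ∂(Measure.map (fun z : ℂ => r • z) volume) = ∫⁻ z, k (r • z) := he.lintegral_map k
  rw [h, lintegral_smul_measure, Complex.finrank_real_complex, abs_of_pos (by positivity)] at h1
  simpa using h1.symm

lemma dilation (hW : IsClassW ω φ τ) (hL : IsClassL (radialize τ) c₁ c₂) (f : ℂ → ℂ)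
    {r : ℝ} (hr : 1 / 2 ≤ r) (h1 : r ≤ 1) :
    ∫⁻ z in unitDisc, ENNReal.ofReal (‖f ((r : ℂ) * z)‖ ^ 2 * Real.exp (-(2 * φ z))) ≤
      4 * ∫⁻ z in unitDisc, ENNReal.ofReal (‖f z‖ ^ 2 * Real.exp (-(2 * φ z))) := by
  set k : ℂ → ℝ≥0∞ := unitDisc.indicator (fun z => ENNReal.ofReal (‖f z‖ ^ 2 * Real.exp (-(2 * φ z)))) with hk
  have hr0 : 0 < r := by linarith
  have hmem : ∀ z ∈ unitDisc, ((r : ℂ) * z) ∈ unitDisc := by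
    intro z hz
    rw [mem_unitDisc, norm_mul, Complex.norm_real, Real.norm_eq_abs, abs_of_pos hr0]
    have := mem_unitDisc.1 hz
    nlinarith [norm_nonneg z]
  calc _ ≤ ∫⁻ z in unitDisc, k ((r : ℂ) * z) := by
        refine setLIntegral_mono' measurableSet_unitDisc fun z hz => ?_
        rw [hk, indicator_of_mem (hmem z hz)]
        apply ENNReal.ofReal_le_ofReal
        gcongr
        exact phi_mono hW hL hz hr0.le h1
    _ ≤ ∫⁻ z, k ((r : ℂ) * z) := setLIntegral_le_lintegral _ _
    _ = ENNReal.ofReal ((r ^ 2)⁻¹) * ∫⁻ z, k z := lintegral_dil k hr0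
    _ ≤ _ := by
        rw [hk, lintegral_indicator measurableSet_unitDisc]
        refine mul_le_mul' ?_ le_rfl
        have : (4 : ℝ≥0∞) = ENNReal.ofReal 4 := by simp
        rw [this]
        apply ENNReal.ofReal_le_ofReal
        rw [inv_le_comm₀ (by positivity) (by norm_num)]
        nlinarith

lemma int_W (hW : IsClassW ω φ τ) : ∫⁻ z in unitDisc, ENNReal.ofReal (Real.exp (-(2 * φ z))) < ⊤ := by
  have h := hW.integrable
  rw [dA_restrict, lintegral_smul_measure] at h
  have h2 : ∫⁻ z in unitDisc, ENNReal.ofReal (ω z) < ⊤ := by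
    by_contra hc
    rw [not_lt, top_le_iff] at hc
    rw [hc, smul_eq_mul, ENNReal.mul_top (by simp)] at h
    exact lt_irrefl _ h
  refine lt_of_le_of_lt (le_of_eq ?_) h2
  refine setLIntegral_congr_fun measurableSet_unitDisc fun z hz => ?_
  simp only [hW.omega_eq z hz]

lemma test_fun (hW : IsClassW ω φ τ) (hL : IsClassL (radialize τ) c₁ c₂) :
    ∃ δ₀ : ℝ, 0 < δ₀ ∧ δ₀ < mTau c₁ c₂ ∧ ∃ c : ℝ, 0 < c ∧ ∃ C1 : ℝ, 0 < C1 ∧ ∀ a ∈ unitDisc,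
      ∃ f : ℂ → ℂ, ∃ M : ℝ, DifferentiableOn ℂ f unitDisc ∧ (∀ z ∈ unitDisc, ‖f z‖ ≤ M) ∧
        (∀ z, ‖z - a‖ ≤ δ₀ * τ ‖a‖ → c ≤ ‖f z‖ ^ 2 * Real.exp (-(2 * φ z))) ∧
        ∫⁻ z in unitDisc, ENNReal.ofReal (‖f z‖ ^ 2 * Real.exp (-(2 * φ z))) ≤
          ENNReal.ofReal (C1 * τ ‖a‖ ^ 2) := by
  obtain ⟨δ₀, hδ0, hδm, c, hc, C1, hC1, ρ, hρ0, hρ1, hpk⟩ := peak2 hW hL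
  set ρ' := ρ + (1 - ρ) / 4 with hρ'
  have hsubD : Metric.closedBall (0:ℂ) ρ' ⊆ unitDisc := by
    intro z hz
    rw [mem_closedBall_zero_iff] at hz
    rw [mem_unitDisc, hρ'] at *
    linarith
  obtain ⟨Mφ, hMφ⟩ := (isCompact_closedBall (0:ℂ) ρ').bddAbove_image (hW.smooth.continuousOn.mono hsubD)
  have hMφ' : ∀ z, ‖z‖ ≤ ρ' → φ z ≤ Mφ := fun z hz =>
    hMφ ⟨z, by rwa [mem_closedBall_zero_iff], rfl⟩
  have hI := int_W hW
  set I := (∫⁻ z in unitDisc, ENNReal.ofReal (Real.exp (-(2 * φ z)))).toReal with hIdef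
  have hI' : ∫⁻ z in unitDisc, ENNReal.ofReal (Real.exp (-(2 * φ z))) = ENNReal.ofReal I :=
    (ENNReal.ofReal_toReal hI.ne).symm
  have hI0 : 0 ≤ I := ENNReal.toReal_nonneg
  have hτρ : 0 < τ ρ := hW.tau_pos ρ ⟨hρ0, hρ1⟩
  have hmpos : 0 < mTau c₁ c₂ := mTau_pos hL.c₁_pos hL.c₂_pos
  refine ⟨δ₀, hδ0, hδm, min (c / 2) (Real.exp (-(2 * Mφ))), lt_min (by positivity) (Real.exp_pos _),
    4 * C1 + I / τ ρ ^ 2, by positivity, fun a ha => ?_⟩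
  have hta : 0 < τ ‖a‖ := tau_pos' hL ha
  have hcb : ∀ z, ‖z - a‖ ≤ δ₀ * τ ‖a‖ → z ∈ unitDisc := by
    intro z hz
    apply closedBall_sub hL ha
    rw [Metric.mem_closedBall, dist_eq_norm]
    exact hz.trans (mul_le_mul_of_nonneg_right hδm.le hta.le)
  rcases lt_or_ge ρ ‖a‖ with h | h
  · obtain ⟨f, hf, hlow, hIntg⟩ := hpk a ha h
    have hcont : ∀ z ∈ Metric.closedBall a (δ₀ * τ ‖a‖), ∀ᶠ q : ℝ × ℂ in nhds ((1:ℝ), z),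
        c / 2 < ‖f ((q.1 : ℂ) * q.2)‖ ^ 2 * Real.exp (-(2 * φ q.2)) := by
      intro z hz
      rw [Metric.mem_closedBall, dist_eq_norm] at hz
      have hzD := hcb z hz
      have hca : ContinuousAt (fun q : ℝ × ℂ => ‖f ((q.1 : ℂ) * q.2)‖ ^ 2 * Real.exp (-(2 * φ q.2))) ((1:ℝ), z) := by
        have h1 : ContinuousAt f ((((1:ℝ) : ℂ)) * z) := by
          simpa using (hf.differentiableAt (isOpen_unitDisc.mem_nhds hzD)).continuousAt
        have h2 : ContinuousAt φ z := hW.smooth.continuousOn.continuousAt (isOpen_unitDisc.mem_nhds hzD)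
        have h3 : ContinuousAt (fun q : ℝ × ℂ => f ((q.1 : ℂ) * q.2)) ((1:ℝ), z) :=
          ContinuousAt.comp (g := f) (f := fun q : ℝ × ℂ => (q.1 : ℂ) * q.2) h1 (by fun_prop)
        have h4 : ContinuousAt (fun q : ℝ × ℂ => φ q.2) ((1:ℝ), z) :=
          ContinuousAt.comp (g := φ) (f := fun q : ℝ × ℂ => q.2) h2 continuousAt_snd
        exact (h3.norm.pow 2).mul (Real.continuous_exp.continuousAt.comp ((h4.const_mul 2).neg))
      refine hca.eventually (lt_mem_nhds ?_)
      simp only [Complex.ofReal_one, one_mul]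
      have := hlow z hz
      linarith
    have hev := (isCompact_closedBall a (δ₀ * τ ‖a‖)).eventually_forall_of_forall_eventually
      (P := fun (r : ℝ) (z : ℂ) => c / 2 < ‖f ((r : ℂ) * z)‖ ^ 2 * Real.exp (-(2 * φ z))) hcont
    have hev2 : ∀ᶠ r : ℝ in nhdsWithin 1 (Iio 1), r ∈ Ioo (1 / 2 : ℝ) 1 :=
      Ioo_mem_nhdsLT (by norm_num)
    obtain ⟨r, hr1, hr2⟩ := ((hev.filter_mono nhdsWithin_le_nhds).and hev2).exists
    have hr0 : 0 < r := by linarith [hr2.1]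
    have hmem : ∀ z ∈ unitDisc, ‖(r : ℂ) * z‖ ≤ r := by
      intro z hz
      rw [norm_mul, Complex.norm_real, Real.norm_eq_abs, abs_of_pos hr0]
      have := mem_unitDisc.1 hz
      nlinarith [norm_nonneg z]
    have hsub : Metric.closedBall (0:ℂ) r ⊆ unitDisc := by
      intro z hz
      rw [mem_closedBall_zero_iff] at hz
      exact mem_unitDisc.2 (hz.trans_lt hr2.2)
    obtain ⟨M, hM⟩ := (isCompact_closedBall (0:ℂ) r).exists_bound_of_continuousOn (hf.continuousOn.mono hsub)
    refine ⟨fun z => f ((r : ℂ) * z), M, ?_, ?_, ?_, ?_⟩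
    · refine hf.comp (by fun_prop) fun z hz => hsub ?_
      rw [mem_closedBall_zero_iff]; exact hmem z hz
    · intro z hz
      exact hM _ (by rw [mem_closedBall_zero_iff]; exact hmem z hz)
    · intro z hz
      refine (min_le_left _ _).trans (hr1 z ?_).le
      rwa [Metric.mem_closedBall, dist_eq_norm]
    · refine (dilation hW hL f hr2.1.le hr2.2.le).trans ((mul_le_mul' le_rfl hIntg).trans ?_)
      have : (4 : ℝ≥0∞) = ENNReal.ofReal 4 := by simp
      rw [this, ← ENNReal.ofReal_mul (by norm_num)]
      apply ENNReal.ofReal_le_ofReal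
      have : 0 ≤ I / τ ρ ^ 2 * τ ‖a‖ ^ 2 := by positivity
      linarith
  · refine ⟨fun _ => 1, 1, differentiableOn_const _, fun z hz => by simp, fun z hz => ?_, ?_⟩
    · refine (min_le_right _ _).trans ?_
      have h2 : ‖z‖ ≤ ρ' := by
        have h3 : ‖z‖ ≤ ‖z - a‖ + ‖a‖ := by
          calc ‖z‖ = ‖(z - a) + a‖ := by ring_nf
            _ ≤ _ := norm_add_le _ _
        have h4 : τ ‖a‖ ≤ c₁ * (1 - ‖a‖) := hL.upper a ha
        have h5 := (mTau_le hL.c₁_pos hL.c₂_pos).2.1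
        have ha1 := mem_unitDisc.1 ha
        have h6 : δ₀ * τ ‖a‖ ≤ 1 / 4 * (1 - ‖a‖) := by
          calc δ₀ * τ ‖a‖ ≤ mTau c₁ c₂ * (c₁ * (1 - ‖a‖)) := by gcongr
            _ = mTau c₁ c₂ * c₁ * (1 - ‖a‖) := by ring
            _ ≤ _ := mul_le_mul_of_nonneg_right h5 (by linarith)
        rw [hρ']; linarith
      have h7 := hMφ' z h2
      simp only [norm_one, one_pow, one_mul]
      apply Real.exp_le_exp.2
      linarith
    · simp only [norm_one, one_pow, one_mul]
      rw [hI']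
      apply ENNReal.ofReal_le_ofReal
      have h8 : τ ρ ≤ τ ‖a‖ := hW.tau_anti ⟨norm_nonneg _, mem_unitDisc.1 ha⟩ ⟨hρ0, hρ1⟩ h
      have h9 : I ≤ I / τ ρ ^ 2 * τ ‖a‖ ^ 2 := by
        calc I = I / τ ρ ^ 2 * τ ρ ^ 2 := by field_simp
          _ ≤ _ := by gcongr
      have : 0 ≤ 4 * C1 * τ ‖a‖ ^ 2 := by positivity
      linarith

end testfun

section onetwo
variable {ω φ : ℂ → ℝ} {τ : ℝ → ℝ} {c₁ c₂ : ℝ}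

lemma localMeanE_eq (τC : ℂ → ℝ) (δ : ℝ) (u : ℂ → ℂ) (z : ℂ) : localMeanE τC δ u z =
    (ENNReal.ofReal ((δ * τC z) ^ 2))⁻¹ * ((ENNReal.ofReal Real.pi)⁻¹ *
      ∫⁻ w in Metric.ball z (δ * τC z), ENNReal.ofReal (‖u w‖ ^ 2)) := by
  unfold localMeanE
  rw [dA_restrict, lintegral_smul_measure, smul_eq_mul]

lemma localMeanE_le {τC : ℂ → ℝ} {δ : ℝ} {u : ℂ → ℂ} {z : ℂ} {K : ℝ} (h0 : 0 < δ * τC z)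
    (h : ∫⁻ w in Metric.ball z (δ * τC z), ENNReal.ofReal (‖u w‖ ^ 2) ≤ ENNReal.ofReal K) :
    localMeanE τC δ u z ≤ ENNReal.ofReal (K / (Real.pi * (δ * τC z) ^ 2)) := by
  rw [localMeanE_eq]
  refine (mul_le_mul' le_rfl (mul_le_mul' le_rfl h)).trans (le_of_eq ?_)
  rw [← ENNReal.ofReal_inv_of_pos (by positivity), ← ENNReal.ofReal_inv_of_pos Real.pi_pos,
    ← ENNReal.ofReal_mul (by have := Real.pi_pos; positivity), ← ENNReal.ofReal_mul (by positivity)]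
  congr 1
  have := Real.pi_pos
  field_simp

set_option maxHeartbeats 1000000 in
lemma one_imp_two (hW : IsClassW ω φ τ) (hL : IsClassL (radialize τ) c₁ c₂)
    (g : ℂ → ℂ) (hg : MemLp g 2 (muW ω)) (T : bergmanH ω →L[ℂ] Lp ℂ 2 (muW ω))
    (hT : IsHankelExtension ω g T) :
    ∃ δ ∈ Set.Ioo 0 (mTau c₁ c₂), ∃ M : ℝ, ∀ z ∈ unitDisc,
        FdeltaSqE (radialize τ) δ g z ≤ ENNReal.ofReal M := by
  obtain ⟨δ, hδ0, hδm, c, hc, C1, hC1, htest⟩ := test_fun hW hL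
  have hD := measurableSet_unitDisc
  have hπ := Real.pi_pos
  set Q := ‖T‖ * Real.sqrt (C1 / Real.pi) + 1 with hQ
  have hQ0 : 0 < Q := by positivity
  refine ⟨δ, ⟨hδ0, hδm⟩, c⁻¹ * Q ^ 2 / δ ^ 2, fun a ha => ?_⟩
  obtain ⟨F, M, hF, hFM, hlow, hIntg⟩ := htest a ha
  set t := τ ‖a‖ with ht
  have htpos : 0 < t := tau_pos' hL ha
  have hDae : ∀ᵐ z ∂(muW ω), z ∈ unitDisc := (ae_muW_iff hW).2 (ae_restrict_mem hD)
  have hFa := hF.continuousOn.aestronglyMeasurable hD (μ := volume)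
  have hFm : MemLp F 2 (muW ω) := memLp_muW hW hFa (hIntg.trans_lt ENNReal.ofReal_lt_top)
  have hfb : hFm.toLp ∈ bergmanH ω :=
    Submodule.le_topologicalClosure _ ⟨F, hF, hFm.coeFn_toLp⟩
  have hfn : ‖hFm.toLp‖ ≤ Real.sqrt (C1 / Real.pi) * t := by
    refine norm_le_of_lintegral hW _ hFm.coeFn_toLp (by positivity) (hIntg.trans (le_of_eq ?_))
    rw [mul_pow, Real.sq_sqrt (by positivity)]
    congr 1; field_simp
  have hgm : MemLp (fun z => g z * F z) 2 (muW ω) := by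
    refine MemLp.of_le_mul (c := M) hg (hg.1.mul hFm.1) ?_
    filter_upwards [hDae] with z hzD
    rw [norm_mul, mul_comm]
    exact mul_le_mul_of_nonneg_right (hFM z hzD) (norm_nonneg _)
  have hTe := hT ⟨hFm.toLp, hfb⟩ F M hF hFM hFm.coeFn_toLp hgm.toLp hgm.coeFn_toLp
  have hTn : ‖hgm.toLp - bergmanProj ω hgm.toLp‖ ≤ ‖T‖ * (Real.sqrt (C1 / Real.pi) * t) := by
    rw [← hTe]
    refine (T.le_opNorm _).trans (mul_le_mul_of_nonneg_left ?_ T.opNorm_nonneg)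
    exact hfn
  have hPm : bergmanProj ω hgm.toLp ∈ closure (bergmanSubmodule ω : Set (Lp ℂ 2 (muW ω))) := by
    rw [← Submodule.topologicalClosure_coe]
    exact (bergmanProjA ω hgm.toLp).2
  obtain ⟨q, ⟨G, hG, hqG⟩, hq⟩ := Metric.mem_closure_iff.1 hPm t htpos
  rw [dist_eq_norm] at hq
  have hdiff : ‖hgm.toLp - q‖ ≤ Q * t := by
    calc ‖hgm.toLp - q‖ = ‖(hgm.toLp - bergmanProj ω hgm.toLp) + (bergmanProj ω hgm.toLp - q)‖ := by
          congr 1; abel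
      _ ≤ _ := norm_add_le _ _
      _ ≤ ‖T‖ * (Real.sqrt (C1 / Real.pi) * t) + t := add_le_add hTn hq.le
      _ = Q * t := by rw [hQ]; ring
  have hae : ((hgm.toLp - q : Lp ℂ 2 (muW ω)) : ℂ → ℂ) =ᵐ[muW ω] fun z => g z * F z - G z := by
    filter_upwards [Lp.coeFn_sub hgm.toLp q, hgm.coeFn_toLp, hqG] with z e1 e2 e3
    rw [e1, Pi.sub_apply, e2, e3]
  have hI := muW_normsq hW _ hae
  have hI2 : ∫⁻ z in unitDisc, ENNReal.ofReal (‖g z * F z - G z‖ ^ 2 * Real.exp (-(2 * φ z))) ≤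
      ENNReal.ofReal (Real.pi * (Q * t) ^ 2) := by
    rw [hI]
    apply ENNReal.ofReal_le_ofReal
    gcongr
  have hball : Metric.ball a (δ * radialize τ a) ⊆ unitDisc := by
    refine (Metric.ball_subset_closedBall.trans (Metric.closedBall_subset_closedBall ?_)).trans
        (closedBall_sub hL ha)
    exact mul_le_mul_of_nonneg_right hδm.le htpos.le
  have hlow' : ∀ z ∈ Metric.ball a (δ * radialize τ a), c ≤ ‖F z‖ ^ 2 * Real.exp (-(2 * φ z)) := by
    intro z hz
    rw [Metric.mem_ball, dist_eq_norm] at hz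
    exact hlow z hz.le
  have hF0 : ∀ z ∈ Metric.ball a (δ * radialize τ a), F z ≠ 0 := by
    intro z hz h0
    have := hlow' z hz
    rw [h0] at this
    simp at this
    linarith
  have hhd : DifferentiableOn ℂ (fun z => G z / F z) (Metric.ball a (δ * radialize τ a)) :=
    (hG.mono hball).div (hF.mono hball) hF0
  refine (iInf₂_le (fun z => G z / F z) hhd).trans ?_
  have hδt : 0 < δ * radialize τ a := mul_pos hδ0 htpos
  refine (localMeanE_le (K := c⁻¹ * (Real.pi * (Q * t) ^ 2)) hδt ?_).trans (le_of_eq ?_)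
  · rw [ENNReal.ofReal_mul (by positivity)]
    refine le_trans ?_ (mul_le_mul' le_rfl ((lintegral_mono_set hball).trans hI2))
    rw [← lintegral_const_mul' _ _ ENNReal.ofReal_ne_top]
    refine setLIntegral_mono' Metric.isOpen_ball.measurableSet fun z hz => ?_
    rw [← ENNReal.ofReal_mul (by positivity)]
    apply ENNReal.ofReal_le_ofReal
    have e : g z * F z - G z = (g z - G z / F z) * F z := by
      have := hF0 z hz
      field_simp
    rw [e, norm_mul]
    calc ‖g z - G z / F z‖ ^ 2 = c⁻¹ * (‖g z - G z / F z‖ ^ 2 * c) := by field_simp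
      _ ≤ c⁻¹ * (‖g z - G z / F z‖ ^ 2 * (‖F z‖ ^ 2 * Real.exp (-(2 * φ z)))) := by
          gcongr
          exact hlow' z hz
      _ = _ := by ring
  · have : radialize τ a = t := rfl
    rw [this]
    congr 1
    field_simp

end onetwo

section sigma
variable {ω φ : ℂ → ℝ} {τ : ℝ → ℝ} {c₁ c₂ : ℝ}

lemma tau_lip_real (hL : IsClassL (radialize τ) c₁ c₂) {x y : ℝ} (hx : x ∈ Ico (0:ℝ) 1) (hy : y ∈ Ico (0:ℝ) 1) :
    |τ x - τ y| ≤ c₂ * |x - y| := by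
  have h := hL.lip (x : ℂ) (mem_unitDisc.2 (by simpa [abs_of_nonneg hx.1] using hx.2))
    (y : ℂ) (mem_unitDisc.2 (by simpa [abs_of_nonneg hy.1] using hy.2))
  simp only [radialize, Complex.norm_real, Real.norm_eq_abs, abs_of_nonneg hx.1, abs_of_nonneg hy.1] at h
  rw [← Complex.ofReal_sub, Complex.norm_real, Real.norm_eq_abs] at h
  exact h

lemma tau_deriv_ge (hW : IsClassW ω φ τ) (hL : IsClassL (radialize τ) c₁ c₂) {x : ℝ} (hx : x ∈ Ioo (0:ℝ) 1) :
    |deriv τ x| ≤ c₂ := by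
  have h := (hW.tau_diff x ⟨hx.1.le, hx.2⟩).hasDerivAt
  have := h.le_of_lip' hL.c₂_pos.le (by
    filter_upwards [Ioo_mem_nhds hx.1 hx.2] with y hy
    rw [Real.norm_eq_abs, Real.norm_eq_abs]
    exact tau_lip_real hL ⟨hy.1.le, hy.2⟩ ⟨hx.1.le, hx.2⟩)
  simpa using this

/-- The ODE regularisation on the half-line. -/
lemma exists_S (hW : IsClassW ω φ τ) (hL : IsClassL (radialize τ) c₁ c₂) :
    ∃ S : ℝ → ℝ, ContDiffOn ℝ 1 S (Iio 1) ∧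
      ∀ t ∈ Ico (0:ℝ) 1, τ (max (Real.sqrt t) (1 / 2)) ≤ S t ∧ S t ≤ 2 * τ (max (Real.sqrt t) (1 / 2)) ∧
        |deriv S t| ≤ 2 * c₂ := by
  set T : ℝ → ℝ := fun t => τ (max (Real.sqrt t) (1 / 2)) with hT
  have hmem : ∀ t, t < 1 → max (Real.sqrt t) (1 / 2) ∈ Ico (0:ℝ) 1 := by
    intro t ht
    refine ⟨le_max_of_le_right (by norm_num), max_lt ?_ (by norm_num)⟩
    rw [Real.sqrt_lt' one_pos]; simpa using ht
  have hTpos : ∀ t, t < 1 → 0 < T t := fun t ht => hW.tau_pos _ (hmem t ht)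
  have hTc : ContinuousOn T (Iio 1) := by
    have h1 : ContinuousOn τ (Ico 0 1) := fun x hx => (hW.tau_diff x hx).continuousAt.continuousWithinAt
    refine h1.comp (Continuous.continuousOn (by fun_prop)) fun t ht => hmem t ht
  have hTanti : ∀ s t, s ≤ t → t < 1 → T t ≤ T s := fun s t hst ht =>
    hW.tau_anti (hmem s (hst.trans_lt ht)) (hmem t ht)
      (max_le_max (Real.sqrt_le_sqrt hst) le_rfl)
  set N := 2 * c₂ with hN
  have hNpos : 0 < N := by have := hL.c₂_pos; positivity
  have hIc : ContinuousOn (fun t => N / T t) (Iio 1) :=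
    continuousOn_const.div hTc fun t ht => (hTpos t ht).ne'
  set A : ℝ → ℝ := fun t => ∫ s in (0:ℝ)..t, N / T s with hA
  have hFTC : ∀ (u : ℝ → ℝ), ContinuousOn u (Iio 1) → ∀ t, t < 1 →
      HasDerivAt (fun t => ∫ s in (0:ℝ)..t, u s) (u t) t := by
    intro u hu t ht
    have hsub : uIcc 0 t ⊆ Iio 1 := by
      intro x hx
      rw [mem_uIcc] at hx
      rw [mem_Iio]
      rcases hx with hx | hx <;> linarith
    refine intervalIntegral.integral_hasDerivAt_right ((hu.mono hsub).intervalIntegrable) ?_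
      (hu.continuousAt (Iio_mem_nhds ht))
    exact hu.stronglyMeasurableAtFilter isOpen_Iio t ht
  have hA' : ∀ t, t < 1 → HasDerivAt A (N / T t) t := hFTC _ hIc
  have hAc : ContinuousOn A (Iio 1) := fun t ht => (hA' t ht).continuousAt.continuousWithinAt
  have hEc : ContinuousOn (fun t => Real.exp (A t)) (Iio 1) := Real.continuous_exp.comp_continuousOn hAc
  set J : ℝ → ℝ := fun t => ∫ s in (0:ℝ)..t, Real.exp (A s) with hJ
  have hJ' : ∀ t, t < 1 → HasDerivAt J (Real.exp (A t)) t := hFTC _ hEc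
  have hA0 : A 0 = 0 := by simp [hA]
  have hJ0 : J 0 = 0 := by simp [hJ]
  set S : ℝ → ℝ := fun t => Real.exp (-A t) * (T 0 + N * J t) with hS
  have hS' : ∀ t, t < 1 → HasDerivAt S (N * (1 - S t / T t)) t := by
    intro t ht
    have h1 := ((hA' t ht).neg.exp).mul (((hJ' t ht).const_mul N).const_add (T 0))
    refine h1.congr_deriv ?_
    have h2 : Real.exp (-A t) * Real.exp (A t) = 1 := by rw [← Real.exp_add]; simp
    simp only [hS, Pi.neg_apply]
    have := (hTpos t ht).ne'
    field_simp
    linear_combination (T t) * h2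
  have hSlow : ∀ t ∈ Ico (0:ℝ) 1, T t ≤ S t := by
    intro t ht
    -- monotone comparison function
    have hmono : MonotoneOn (fun s => T 0 + N * J s - T t * Real.exp (A s)) (Icc 0 t) := by
      have hd : ∀ s ∈ Icc 0 t, HasDerivAt (fun s => T 0 + N * J s - T t * Real.exp (A s))
          (N * Real.exp (A s) - T t * (Real.exp (A s) * (N / T s))) s := fun s hs =>
        (((hJ' s (hs.2.trans_lt ht.2)).const_mul N).const_add (T 0)).sub
          (((hA' s (hs.2.trans_lt ht.2)).exp).const_mul (T t))
      refine monotoneOn_of_deriv_nonneg (convex_Icc 0 t)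
        (fun s hs => (hd s hs).continuousAt.continuousWithinAt) ?_ ?_
      · rw [interior_Icc]
        exact fun s hs => (hd s (Ioo_subset_Icc_self hs)).differentiableAt.differentiableWithinAt
      · rw [interior_Icc]
        intro s hs
        rw [(hd s (Ioo_subset_Icc_self hs)).deriv]
        have h3 := hTanti s t hs.2.le ht.2
        have h4 := hTpos s (hs.2.trans ht.2)
        have h5 : T t / T s ≤ 1 := (div_le_one h4).2 h3
        have h6 : N * Real.exp (A s) - T t * (Real.exp (A s) * (N / T s)) =
          N * Real.exp (A s) * (1 - T t / T s) := by ring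
        rw [h6]
        have := Real.exp_pos (A s)
        exact mul_nonneg (by positivity) (by linarith)
    have h7 := hmono (left_mem_Icc.2 ht.1) (right_mem_Icc.2 ht.1) ht.1
    simp only [hA0, hJ0, Real.exp_zero] at h7
    have h8 := hTanti 0 t ht.1 ht.2
    simp only [hS]
    rw [Real.exp_neg, ← div_eq_inv_mul, le_div_iff₀ (Real.exp_pos _)]
    linarith
  have hSup : ∀ t ∈ Ico (0:ℝ) 1, S t ≤ 2 * T t := by
    set h : ℝ → ℝ := fun t => 2 * T t * Real.exp (A t) - N * J t with hh
    have hc : ContinuousOn h (Iio 1) := by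
      refine ((continuousOn_const.mul hTc).mul hEc).sub (continuousOn_const.mul ?_)
      exact fun t ht => (hJ' t ht).continuousAt.continuousWithinAt
    have hd : ∀ t, t < 1 → ∀ D, HasDerivAt T D t →
        HasDerivAt h (Real.exp (A t) * (N + 2 * D)) t := by
      intro t ht D hD
      have h1 := ((hD.const_mul 2).mul (hA' t ht).exp).sub ((hJ' t ht).const_mul N)
      refine h1.congr_deriv ?_
      have := (hTpos t ht).ne'
      field_simp
      ring
    have m1 : MonotoneOn h (Icc 0 (1 / 4)) := by
      have hd1 : ∀ t ∈ Ioo (0:ℝ) (1 / 4), HasDerivAt h (Real.exp (A t) * (N + 2 * 0)) t := by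
        intro t ht
        refine hd t (by linarith [ht.2]) 0 ?_
        refine (hasDerivAt_const t (τ (1 / 2))).congr_of_eventuallyEq ?_
        filter_upwards [Iio_mem_nhds ht.2] with s hs
        simp only [hT]
        rw [max_eq_right]
        rw [Real.sqrt_le_left (by norm_num)]
        have : s < 1 / 4 := hs
        norm_num; linarith
      refine monotoneOn_of_deriv_nonneg (convex_Icc 0 _)
        (hc.mono fun s hs => by have := hs.2; rw [mem_Iio]; linarith) ?_ ?_
      · rw [interior_Icc]
        exact fun s hs => (hd1 s hs).differentiableAt.differentiableWithinAt
      · rw [interior_Icc]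
        intro s hs
        rw [(hd1 s hs).deriv]
        positivity
    have m2 : MonotoneOn h (Ico (1 / 4) 1) := by
      have hd2 : ∀ t ∈ Ioo (1 / 4 : ℝ) 1, HasDerivAt h
          (Real.exp (A t) * (N + 2 * (deriv τ (Real.sqrt t) * (1 / (2 * Real.sqrt t))))) t := by
        intro t ht
        refine hd t ht.2 _ ?_
        have hs1 : Real.sqrt t ∈ Ico (0:ℝ) 1 := ⟨Real.sqrt_nonneg _, by
          rw [Real.sqrt_lt' one_pos]; simpa using ht.2⟩
        have hs := Real.hasDerivAt_sqrt (show t ≠ 0 by linarith [ht.1])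
        refine ((hW.tau_diff _ hs1).hasDerivAt.comp t hs).congr_of_eventuallyEq ?_
        filter_upwards [Ioi_mem_nhds ht.1] with s hs
        simp only [hT, Function.comp]
        rw [max_eq_left]
        apply Real.le_sqrt_of_sq_le
        have : 1 / 4 < s := hs
        norm_num; linarith
      refine monotoneOn_of_deriv_nonneg (convex_Ico _ 1) (hc.mono fun s hs => hs.2) ?_ ?_
      · rw [interior_Ico]
        exact fun s hs => (hd2 s hs).differentiableAt.differentiableWithinAt
      · rw [interior_Ico]
        intro s hs
        rw [(hd2 s hs).deriv]
        have hq : 1 / 2 < Real.sqrt s := by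
          apply Real.lt_sqrt_of_sq_lt
          have := hs.1
          norm_num; linarith
        have hq1 : Real.sqrt s < 1 := by rw [Real.sqrt_lt' one_pos]; simpa using hs.2
        have h1 := (abs_le.1 (tau_deriv_ge hW hL (x := Real.sqrt s) ⟨by linarith, hq1⟩)).1
        have h2 : 1 / (2 * Real.sqrt s) ≤ 1 := by
          rw [div_le_one (by positivity)]; linarith
        have h3 : 0 ≤ 1 / (2 * Real.sqrt s) := by positivity
        have hc2 := hL.c₂_pos
        refine mul_nonneg (Real.exp_pos _).le ?_
        rw [hN]
        nlinarith
    have m3 : ∀ t ∈ Ico (0:ℝ) 1, h 0 ≤ h t := by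
      intro t ht
      rcases le_total t (1 / 4) with h' | h'
      · exact m1 ⟨le_rfl, by norm_num⟩ ⟨ht.1, h'⟩ ht.1
      · exact (m1 ⟨le_rfl, by norm_num⟩ ⟨by norm_num, le_rfl⟩ (by norm_num)).trans
          (m2 ⟨le_rfl, by norm_num⟩ ⟨h', ht.2⟩ h')
    intro t ht
    have h7 := m3 t ht
    simp only [hh, hA0, hJ0, Real.exp_zero] at h7
    have h8 := hTpos 0 (by norm_num)
    simp only [hS]
    rw [Real.exp_neg, ← div_eq_inv_mul, div_le_iff₀ (Real.exp_pos _)]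
    linarith
  refine ⟨S, ?_, fun t ht => ⟨hSlow t ht, hSup t ht, ?_⟩⟩
  · rw [contDiffOn_one_iff_derivWithin isOpen_Iio.uniqueDiffOn]
    refine ⟨fun t ht => (hS' t ht).differentiableAt.differentiableWithinAt, ?_⟩
    have hSc : ContinuousOn S (Iio 1) := fun t ht => (hS' t ht).continuousAt.continuousWithinAt
    have : ContinuousOn (fun t => N * (1 - S t / T t)) (Iio 1) :=
      continuousOn_const.mul (continuousOn_const.sub (hSc.div hTc fun t ht => (hTpos t ht).ne'))
    refine this.congr fun t ht => ?_
    rw [derivWithin_of_isOpen isOpen_Iio ht, (hS' t ht).deriv]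
  · rw [(hS' t ht.2).deriv]
    have hp := hTpos t ht.2
    have h1 : 1 ≤ S t / T t := (one_le_div hp).2 (hSlow t ht)
    have h2 : S t / T t ≤ 2 := (div_le_iff₀ hp).2 (hSup t ht)
    rw [abs_le]
    constructor <;> nlinarith

lemma exists_sigma (hW : IsClassW ω φ τ) (hL : IsClassL (radialize τ) c₁ c₂) :
    ∃ σ : ℂ → ℝ, ContDiffOn ℝ 1 σ unitDisc ∧ ∃ q : ℝ, 0 < q ∧ ∃ Λ : ℝ, 0 ≤ Λ ∧
      (∀ z ∈ unitDisc, q * τ ‖z‖ ≤ σ z ∧ σ z ≤ τ ‖z‖) ∧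
      ∀ z ∈ unitDisc, ∀ w ∈ unitDisc, |σ z - σ w| ≤ Λ * ‖z - w‖ := by
  obtain ⟨S, hSc, hS⟩ := exists_S hW hL
  have hc2 := hL.c₂_pos
  have hmemt : ∀ z ∈ unitDisc, ‖z‖ ^ 2 ∈ Ico (0:ℝ) 1 := by
    intro z hz
    have := mem_unitDisc.1 hz
    exact ⟨by positivity, by nlinarith [norm_nonneg z]⟩
  have hd : ∀ z ∈ unitDisc, HasFDerivAt (fun z : ℂ => S (‖z‖ ^ 2) / 2)
      ((2:ℝ)⁻¹ • (deriv S (‖z‖ ^ 2) • (2 • (innerSL ℝ z)))) z := by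
    intro z hz
    have h1 := (hasFDerivAt_normsq 0 z)
    simp only [sub_zero] at h1
    have h2 := ((hSc.differentiableOn (by norm_num)).differentiableAt
      (isOpen_Iio.mem_nhds (hmemt z hz).2)).hasDerivAt
    have h3 := (h2.comp_hasFDerivAt z h1).const_mul (2:ℝ)⁻¹
    refine h3.congr_of_eventuallyEq (Eventually.of_forall fun w => ?_)
    simp only [Function.comp]; ring
  have h0 : 0 < τ 0 := hW.tau_pos 0 ⟨le_rfl, one_pos⟩
  have h12 : 0 < τ (1 / 2) := hW.tau_pos _ ⟨by norm_num, by norm_num⟩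
  have h120 : τ (1 / 2) ≤ τ 0 := hW.tau_anti ⟨le_rfl, one_pos⟩ ⟨by norm_num, by norm_num⟩ (by norm_num)
  refine ⟨fun z => S (‖z‖ ^ 2) / 2, ?_, τ (1 / 2) / τ 0 / 2, by positivity, 2 * c₂, by positivity, ?_, ?_⟩
  · refine ContDiffOn.div_const (hSc.comp (contDiff_norm_sq ℝ).contDiffOn fun z hz => (hmemt z hz).2) 2
  · intro z hz
    obtain ⟨h1, h2, -⟩ := hS _ (hmemt z hz)
    rw [Real.sqrt_sq (norm_nonneg z)] at h1 h2
    have hz1 := mem_unitDisc.1 hz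
    have hzm : ‖z‖ ∈ Ico (0:ℝ) 1 := ⟨norm_nonneg _, hz1⟩
    have hmm : max ‖z‖ (1 / 2) ∈ Ico (0:ℝ) 1 := ⟨le_max_of_le_right (by norm_num), max_lt hz1 (by norm_num)⟩
    have h3 : τ (max ‖z‖ (1 / 2)) ≤ τ ‖z‖ := hW.tau_anti hzm hmm (le_max_left _ _)
    have hq1 : τ (1 / 2) / τ 0 ≤ 1 := (div_le_one h0).2 h120
    have hτz := hW.tau_pos _ hzm
    have h4 : τ (1 / 2) / τ 0 * τ ‖z‖ ≤ τ (max ‖z‖ (1 / 2)) := by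
      rcases le_total ‖z‖ (1 / 2) with h | h
      · rw [max_eq_right h]
        have h5 : τ ‖z‖ ≤ τ 0 := hW.tau_anti ⟨le_rfl, one_pos⟩ hzm (norm_nonneg _)
        calc τ (1 / 2) / τ 0 * τ ‖z‖ ≤ τ (1 / 2) / τ 0 * τ 0 := by gcongr
          _ = _ := by field_simp
      · rw [max_eq_left h]
        nlinarith
    constructor <;> linarith
  · intro z hz w hw
    have hcx : Convex ℝ unitDisc := convex_ball _ _
    have := hcx.norm_image_sub_le_of_norm_hasFDerivWithin_le (C := 2 * c₂)
      (fun x hx => (hd x hx).hasFDerivWithinAt) (fun x hx => ?_) hw hz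
    · simpa [Real.norm_eq_abs] using this
    · rw [norm_smul, norm_smul, ← Nat.cast_smul_eq_nsmul ℝ, norm_smul, innerSL_apply_norm]
      obtain ⟨-, -, h3⟩ := hS _ (hmemt x hx)
      have hx1 := mem_unitDisc.1 hx
      rw [Real.norm_eq_abs (deriv S _)]
      norm_num
      nlinarith [norm_nonneg x, abs_nonneg (deriv S (‖x‖ ^ 2))]

end sigma

section smoothing

/-- rescaled kernel -/
def kern (ψ : ℝ → ℝ) (s : ℝ) (x : ℂ) : ℝ := (s⁻¹) ^ 2 * ψ ‖s⁻¹ • x‖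

/-- data of a radial kernel -/
structure KernData (ψ : ℝ → ℝ) (B L : ℝ) : Prop where
  cont : Continuous ψ
  bd : ∀ t, |ψ t| ≤ B
  supp : ∀ t, 1 ≤ |t| → ψ t = 0
  smooth : ContDiff ℝ 1 (fun w : ℂ => ψ ‖w‖)
  lip : ∀ x y : ℂ, |ψ ‖x‖ - ψ ‖y‖| ≤ L * ‖x - y‖
  int : ∫ w : ℂ, ψ ‖w‖ = 1
  L0 : 0 ≤ L

lemma exists_kernData : ∃ ψ B L, KernData ψ B L := by
  obtain ⟨ψ, hc, ⟨B, hB⟩, h0, hs, hi⟩ := exists_radial_kernel (ε := 1) one_pos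
  have hcs : HasCompactSupport (fun w : ℂ => ψ ‖w‖) := by
    refine HasCompactSupport.intro (isCompact_closedBall (0:ℂ) 1) fun x hx => ?_
    apply h0
    rw [abs_norm]
    simp at hx
    exact hx.le
  have hs1 : ContDiff ℝ 1 (fun w : ℂ => ψ ‖w‖) := hs.of_le (by norm_num)
  obtain ⟨L, hL⟩ := hs1.lipschitzWith_of_hasCompactSupport hcs (by norm_num)
  refine ⟨ψ, B, L, hc, hB, h0, hs1, fun x y => ?_, hi, L.2⟩
  have := hL.dist_le_mul x y
  rwa [Real.dist_eq, dist_eq_norm] at this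

variable {ψ : ℝ → ℝ} {B L : ℝ}

lemma KernData.B0 (hk : KernData ψ B L) : 0 ≤ B := (abs_nonneg _).trans (hk.bd 0)

lemma kern_zero (hk : KernData ψ B L) {s : ℝ} (hs : 0 < s) {x : ℂ} (hx : s ≤ ‖x‖) :
    kern ψ s x = 0 := by
  unfold kern
  rw [hk.supp, mul_zero]
  rw [abs_norm, norm_smul, norm_inv, Real.norm_of_nonneg hs.le, ← div_eq_inv_mul, one_le_div hs]
  exact hx

lemma kern_bd (hk : KernData ψ B L) {s A : ℝ} (hs : 0 < s) (hA : s⁻¹ ≤ A) (x : ℂ) :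
    |kern ψ s x| ≤ A ^ 2 * B := by
  unfold kern
  have := inv_pos.2 hs
  rw [abs_mul, abs_of_nonneg (by positivity)]
  have := hk.bd ‖s⁻¹ • x‖
  gcongr

lemma kern_continuous (hk : KernData ψ B L) (s : ℝ) : Continuous (kern ψ s) := by
  unfold kern
  have := hk.cont
  fun_prop

lemma kern_diff (hk : KernData ψ B L) {s s0 A d Λ r : ℝ} (hs : 0 < s) (hs0 : 0 < s0)
    (hA : s⁻¹ ≤ A) (hA0 : s0⁻¹ ≤ A) {x y : ℂ} (hxy : ‖x - y‖ ≤ d) (hss : |s - s0| ≤ Λ * d)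
    (hΛ : 0 ≤ Λ) (hy : ‖y‖ ≤ r) :
    |kern ψ s x - kern ψ s0 y| ≤ A ^ 3 * d * (L * (1 + Λ * (A * r)) + 2 * Λ * B) := by
  have hB0 := hk.B0
  have hL0 := hk.L0
  have hd : 0 ≤ d := (norm_nonneg _).trans hxy
  have hr : 0 ≤ r := (norm_nonneg _).trans hy
  have ha := inv_pos.2 hs
  have ha0 := inv_pos.2 hs0
  have hA' : 0 < A := ha.trans_le hA
  have h1 : |s⁻¹ - s0⁻¹| ≤ Λ * d * A ^ 2 := by
    rw [inv_sub_inv hs.ne' hs0.ne', abs_div, abs_of_pos (mul_pos hs hs0), abs_sub_comm,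
      div_eq_mul_inv, mul_inv]
    calc |s - s0| * (s⁻¹ * s0⁻¹) ≤ Λ * d * (A * A) := by gcongr
      _ = _ := by ring
  have h2 : |ψ ‖s⁻¹ • x‖ - ψ ‖s0⁻¹ • y‖| ≤ L * (A * d + Λ * d * A ^ 2 * r) := by
    refine (hk.lip _ _).trans ?_
    gcongr
    have : s⁻¹ • x - s0⁻¹ • y = s⁻¹ • (x - y) + (s⁻¹ - s0⁻¹) • y := by
      rw [smul_sub, sub_smul]; abel
    rw [this]
    refine (norm_add_le _ _).trans ?_
    rw [norm_smul, norm_smul, Real.norm_eq_abs, Real.norm_eq_abs, abs_of_pos ha]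
    gcongr
  have h3 : |s⁻¹ ^ 2 - s0⁻¹ ^ 2| ≤ Λ * d * A ^ 2 * (A + A) := by
    rw [sq_sub_sq, mul_comm, abs_mul, abs_of_pos (a := s⁻¹ + s0⁻¹) (by positivity)]
    gcongr
  have h4 : kern ψ s x - kern ψ s0 y = s⁻¹ ^ 2 * (ψ ‖s⁻¹ • x‖ - ψ ‖s0⁻¹ • y‖) +
      (s⁻¹ ^ 2 - s0⁻¹ ^ 2) * ψ ‖s0⁻¹ • y‖ := by unfold kern; ring
  rw [h4]
  refine (abs_add_le _ _).trans ?_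
  rw [abs_mul, abs_mul, abs_of_nonneg (a := s⁻¹ ^ 2) (by positivity)]
  calc _ ≤ A ^ 2 * (L * (A * d + Λ * d * A ^ 2 * r)) + Λ * d * A ^ 2 * (A + A) * B := by
        have := hk.bd ‖s0⁻¹ • y‖
        gcongr
    _ = _ := by ring

lemma kern_mean (hk : KernData ψ B L) {s R : ℝ} (hs : 0 < s) (hR : s < R) {z : ℂ} {G : ℂ → ℂ}
    (hG : DifferentiableOn ℂ G (Metric.ball z R)) :
    Integrable (fun w => G w * (kern ψ s (z - w) : ℂ)) ∧
      ∫ w, G w * (kern ψ s (z - w) : ℂ) = G z := by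
  have ha := inv_pos.2 hs
  have key := mean_radial (z := z) (ρ := fun t => s⁻¹ ^ 2 * ψ (s⁻¹ * t)) (R' := s) (R := R)
    (B := s⁻¹ ^ 2 * B) hR hG
    (by have := hk.cont.measurable; fun_prop)
    (fun t => by
      rw [abs_mul, abs_of_nonneg (by positivity)]
      have := hk.bd (s⁻¹ * t)
      gcongr)
    (fun t ht => by
      rw [hk.supp, mul_zero]
      rw [abs_of_pos (mul_pos ha (hs.trans ht)), ← div_eq_inv_mul, one_le_div hs]
      exact ht.le)
  have hI : ∫ w : ℂ, s⁻¹ ^ 2 * ψ (s⁻¹ * ‖w‖) = 1 := by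
    have h1 := Measure.integral_comp_smul (volume : Measure ℂ) (fun w : ℂ => ψ ‖w‖) s⁻¹
    rw [hk.int, Complex.finrank_real_complex] at h1
    rw [integral_const_mul]
    have h2 : ∀ w : ℂ, ψ (s⁻¹ * ‖w‖) = ψ ‖s⁻¹ • w‖ := fun w => by
      rw [norm_smul, Real.norm_of_nonneg ha.le]
    simp_rw [h2]
    rw [h1, abs_of_pos (by positivity)]
    simp only [smul_eq_mul, mul_one]
    field_simp
  rw [hI] at key
  have hf : ∀ w : ℂ, ((s⁻¹ ^ 2 * ψ (s⁻¹ * ‖w‖) : ℝ) : ℂ) * G (z + w) =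
      (fun v => G v * (kern ψ s (z - v) : ℂ)) (z + w) := by
    intro w
    simp only [kern]
    rw [norm_smul, Real.norm_of_nonneg ha.le, show z - (z + w) = -w by ring, norm_neg, mul_comm]
  simp_rw [hf] at key
  obtain ⟨k1, k2⟩ := key
  rw [integral_add_left_eq_self (fun v => G v * (kern ψ s (z - v) : ℂ))] at k2
  refine ⟨?_, by simpa using k2⟩
  have h := k1.comp_add_left (-z)
  simpa only [add_neg_cancel_left] using h

end smoothing

section localest

variable {ψ : ℝ → ℝ} {B L : ℝ}

/-- the smoothed function -/
def smoothG (ψ : ℝ → ℝ) (s : ℂ → ℝ) (g : ℂ → ℂ) (z : ℂ) : ℂ :=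
  ∫ w, g w * (kern ψ (s z) (z - w) : ℂ)

lemma int_u {z0 : ℂ} {r K : ℝ} (hr : 0 < r) (hK : 0 ≤ K) {u : ℂ → ℂ}
    (hm : AEStronglyMeasurable u (volume.restrict (Metric.ball z0 r)))
    (hu : ∫⁻ w in Metric.ball z0 r, ENNReal.ofReal (‖u w‖ ^ 2) ≤ ENNReal.ofReal (K * r ^ 2)) :
    IntegrableOn u (Metric.ball z0 r) ∧ ∫ w in Metric.ball z0 r, ‖u w‖ ≤ (K + 4) * r ^ 2 := by
  have hb : ∫⁻ w in Metric.ball z0 r, ENNReal.ofReal ‖u w‖ ≤ ENNReal.ofReal ((K + 4) * r ^ 2) := by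
    calc _ ≤ ∫⁻ w in Metric.ball z0 r, (ENNReal.ofReal (‖u w‖ ^ 2) + 1) := by
          refine lintegral_mono fun w => ?_
          rw [← ENNReal.ofReal_one, ← ENNReal.ofReal_add (by positivity) zero_le_one]
          apply ENNReal.ofReal_le_ofReal
          nlinarith [sq_nonneg (‖u w‖ - 1)]
      _ = (∫⁻ w in Metric.ball z0 r, ENNReal.ofReal (‖u w‖ ^ 2)) + volume (Metric.ball z0 r) := by
          rw [lintegral_add_right _ measurable_const]; simp
      _ ≤ ENNReal.ofReal (K * r ^ 2) + ENNReal.ofReal (4 * r ^ 2) := by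
          refine add_le_add hu ?_
          rw [Complex.volume_ball, ← ENNReal.ofReal_pow hr.le, ← ENNReal.ofReal_coe_nnreal,
            ← ENNReal.ofReal_mul (by positivity)]
          apply ENNReal.ofReal_le_ofReal
          have := Real.pi_le_four
          rw [NNReal.coe_real_pi]
          nlinarith [sq_nonneg r]
      _ = _ := by rw [← ENNReal.ofReal_add (by positivity) (by positivity)]; ring_nf
  have hI : IntegrableOn u (Metric.ball z0 r) := by
    refine ⟨hm, ?_⟩
    rw [hasFiniteIntegral_iff_norm]
    exact hb.trans_lt ENNReal.ofReal_lt_top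
  refine ⟨hI, ?_⟩
  rw [integral_eq_lintegral_of_nonneg_ae (Eventually.of_forall fun w => norm_nonneg _) hm.norm]
  exact ENNReal.toReal_le_of_le_ofReal (by positivity) hb

lemma kern_mul_int (hk : KernData ψ B L) {z0 : ℂ} {r s : ℝ} (hs : 0 < s) {u : ℂ → ℂ}
    (hu : IntegrableOn u (Metric.ball z0 r)) (z : ℂ) :
    IntegrableOn (fun w => u w * (kern ψ s (z - w) : ℂ)) (Metric.ball z0 r) := by
  refine Integrable.mul_bdd (c := (s⁻¹) ^ 2 * B) hu ?_ (Eventually.of_forall fun w => ?_)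
  · have := kern_continuous hk s
    exact (by fun_prop : Continuous fun w => (kern ψ s (z - w) : ℂ)).aestronglyMeasurable
  · rw [Complex.norm_real, Real.norm_eq_abs]
    exact kern_bd hk hs le_rfl _

lemma smoothG_rep (hk : KernData ψ B L) {z0 : ℂ} {r : ℝ} (hr : 0 < r) {s : ℂ → ℝ} {g h : ℂ → ℂ}
    (hh : DifferentiableOn ℂ h (Metric.ball z0 r))
    (hu : IntegrableOn (fun w => g w - h w) (Metric.ball z0 r))
    {z : ℂ} (hz : z ∈ Metric.ball z0 (r / 4)) (hs : 0 < s z) (hsr : s z ≤ r / 2) :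
    smoothG ψ s g z - h z =
      ∫ w in Metric.ball z0 r, (g w - h w) * (kern ψ (s z) (z - w) : ℂ) := by
  rw [Metric.mem_ball, dist_eq_norm] at hz
  have hsub : Metric.ball z (3 / 4 * r) ⊆ Metric.ball z0 r := by
    refine Metric.ball_subset_ball' ?_
    rw [dist_eq_norm]; linarith
  obtain ⟨hmi, hm⟩ := kern_mean hk hs (show s z < 3 / 4 * r by linarith) (hh.mono hsub)
  have hi := (kern_mul_int hk hs hu z)
  rw [← integrable_indicator_iff Metric.isOpen_ball.measurableSet] at hi
  rw [← integral_indicator Metric.isOpen_ball.measurableSet, sub_eq_iff_eq_add]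
  rw [← hm]
  rw [← integral_add hi hmi]
  unfold smoothG
  congr 1
  ext w
  by_cases hw : w ∈ Metric.ball z0 r
  · rw [indicator_of_mem hw]; ring
  · rw [indicator_of_notMem hw, kern_zero hk hs]
    · simp
    · rw [Metric.mem_ball, dist_eq_norm, not_lt] at hw
      have h1 : ‖w - z0‖ ≤ ‖z - w‖ + ‖z - z0‖ := by
        rw [← norm_sub_rev w z]; exact norm_sub_le_norm_sub_add_norm_sub w z z0
      linarith

/-- constant for the Lipschitz estimate -/
def lipC (B L K q Λ : ℝ) : ℝ := (K + 4) * (L * (1 + Λ * q⁻¹) + 2 * Λ * B) * (q⁻¹) ^ 3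

lemma smoothG_est (hk : KernData ψ B L) {z0 : ℂ} {r K q Λ : ℝ} (hr : 0 < r) (hK : 0 ≤ K)
    (hq : 0 < q) (hΛ : 0 ≤ Λ) {s : ℂ → ℝ} {g h : ℂ → ℂ}
    (hh : DifferentiableOn ℂ h (Metric.ball z0 r))
    (hm : AEStronglyMeasurable g (volume.restrict (Metric.ball z0 r)))
    (hu : ∫⁻ w in Metric.ball z0 r, ENNReal.ofReal (‖g w - h w‖ ^ 2) ≤ ENNReal.ofReal (K * r ^ 2))
    (hs1 : ∀ z ∈ Metric.ball z0 (r / 4), q * r ≤ s z ∧ s z ≤ r / 2)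
    (hs2 : ∀ z ∈ Metric.ball z0 (r / 4), |s z - s z0| ≤ Λ * ‖z - z0‖) :
    (∀ z ∈ Metric.ball z0 (r / 4), ‖smoothG ψ s g z - h z‖ ≤ (K + 4) * B * (q⁻¹) ^ 2) ∧
    (∀ z ∈ Metric.ball z0 (r / 4), ‖(smoothG ψ s g z - h z) - (smoothG ψ s g z0 - h z0)‖ ≤
      lipC B L K q Λ / r * ‖z - z0‖) := by
  have hhm : AEStronglyMeasurable h (volume.restrict (Metric.ball z0 r)) :=
    hh.continuousOn.aestronglyMeasurable Metric.isOpen_ball.measurableSet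
  obtain ⟨hI, hN⟩ := int_u (u := fun w => g w - h w) hr hK (hm.sub hhm) hu
  have hB0 := hk.B0
  have hL0 := hk.L0
  have hz0 : z0 ∈ Metric.ball z0 (r / 4) := Metric.mem_ball_self (by positivity)
  have hspos : ∀ z ∈ Metric.ball z0 (r / 4), 0 < s z := fun z hz =>
    (mul_pos hq hr).trans_le (hs1 z hz).1
  have hsinv : ∀ z ∈ Metric.ball z0 (r / 4), (s z)⁻¹ ≤ q⁻¹ * r⁻¹ := fun z hz => by
    rw [← mul_inv]; exact inv_anti₀ (mul_pos hq hr) (hs1 z hz).1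
  have hrep : ∀ z ∈ Metric.ball z0 (r / 4), _ := fun z hz =>
    smoothG_rep hk hr hh hI hz (hspos z hz) (hs1 z hz).2
  have gen : ∀ (k : ℂ → ℂ) (A : ℝ), 0 ≤ A → (∀ w ∈ Metric.ball z0 r, ‖k w‖ ≤ A) →
      ‖∫ w in Metric.ball z0 r, (g w - h w) * k w‖ ≤ A * ((K + 4) * r ^ 2) := by
    intro k A hA hkA
    calc _ ≤ ∫ w in Metric.ball z0 r, A * ‖g w - h w‖ := by
          refine norm_integral_le_of_norm_le (hI.norm.const_mul A) ?_
          refine (ae_restrict_mem Metric.isOpen_ball.measurableSet).mono fun w hw => ?_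
          rw [norm_mul, mul_comm]
          have := hkA w hw
          gcongr
      _ = A * ∫ w in Metric.ball z0 r, ‖g w - h w‖ := integral_const_mul _ _
      _ ≤ _ := by gcongr
  constructor
  · intro z hz
    rw [hrep z hz]
    refine (gen _ ((q⁻¹ * r⁻¹) ^ 2 * B) (by positivity) fun w _ => ?_).trans (le_of_eq ?_)
    · rw [Complex.norm_real, Real.norm_eq_abs]
      exact kern_bd hk (hspos z hz) (hsinv z hz) _
    · field_simp
  · intro z hz
    rw [hrep z hz, hrep z0 hz0, ← integral_sub (kern_mul_int hk (hspos z hz) hI z)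
      (kern_mul_int hk (hspos z0 hz0) hI z0)]
    simp_rw [← mul_sub]
    refine (gen _ ((q⁻¹ * r⁻¹) ^ 3 * ‖z - z0‖ *
      (L * (1 + Λ * ((q⁻¹ * r⁻¹) * r)) + 2 * Λ * B)) (by positivity) fun w hw => ?_).trans
        (le_of_eq ?_)
    · rw [← Complex.ofReal_sub, Complex.norm_real, Real.norm_eq_abs]
      refine kern_diff hk (hspos z hz) (hspos z0 hz0) (hsinv z hz) (hsinv z0 hz0) ?_ (hs2 z hz)
        hΛ ?_
      · rw [sub_sub_sub_cancel_right]
      · rw [Metric.mem_ball, dist_eq_norm, norm_sub_rev] at hw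
        exact hw.le
    · unfold lipC
      field_simp

lemma smoothG_contDiff (hk : KernData ψ B L) {z0 : ℂ} {r K q : ℝ} (hr : 0 < r) (hK : 0 ≤ K)
    (hq : 0 < q) {s : ℂ → ℝ} {g h : ℂ → ℂ}
    (hh : DifferentiableOn ℂ h (Metric.ball z0 r))
    (hm : AEStronglyMeasurable g (volume.restrict (Metric.ball z0 r)))
    (hu : ∫⁻ w in Metric.ball z0 r, ENNReal.ofReal (‖g w - h w‖ ^ 2) ≤ ENNReal.ofReal (K * r ^ 2))
    (hs1 : ∀ z ∈ Metric.ball z0 (r / 4), q * r ≤ s z ∧ s z ≤ r / 2)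
    (hsc : ContDiffOn ℝ 1 s (Metric.ball z0 (r / 4))) :
    ContDiffOn ℝ 1 (smoothG ψ s g) (Metric.ball z0 (r / 4)) := by
  have hhm : AEStronglyMeasurable h (volume.restrict (Metric.ball z0 r)) :=
    hh.continuousOn.aestronglyMeasurable Metric.isOpen_ball.measurableSet
  obtain ⟨hI, -⟩ := int_u (u := fun w => g w - h w) hr hK (hm.sub hhm) hu
  have hspos : ∀ z ∈ Metric.ball z0 (r / 4), 0 < s z := fun z hz =>
    (mul_pos hq hr).trans_le (hs1 z hz).1
  have hsub : Metric.closedBall z0 (3 / 4 * r) ⊆ Metric.ball z0 r :=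
    Metric.closedBall_subset_ball (by linarith)
  have hgi : IntegrableOn g (Metric.closedBall z0 (3 / 4 * r)) := by
    have h1 : IntegrableOn h (Metric.closedBall z0 (3 / 4 * r)) :=
      (hh.continuousOn.mono hsub).integrableOn_compact (isCompact_closedBall _ _)
    have := (hI.mono_set hsub).add h1
    refine this.congr (Eventually.of_forall fun w => ?_)
    simp
  set f := (Metric.closedBall z0 (3 / 4 * r)).indicator g with hf
  have hfi : Integrable f := (integrable_indicator_iff measurableSet_closedBall).2 hgi
  have hsm := contDiffOn_convolution_right_with_param_comp (𝕜 := ℝ) (n := 1) (μ := volume)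
    (ContinuousLinearMap.mul ℝ ℂ) (s := Metric.ball z0 (r / 4)) (v := fun z : ℂ => z)
    contDiffOn_id (f := f) (g := fun p x => (kern ψ (s p) x : ℂ)) (k := Metric.closedBall 0 r)
    Metric.isOpen_ball (isCompact_closedBall _ _) ?_ hfi.locallyIntegrable ?_
  · refine hsm.congr fun z hz => ?_
    simp only [smoothG, convolution_def, ContinuousLinearMap.mul_apply']
    congr 1
    ext w
    rw [hf]
    by_cases hw : w ∈ Metric.closedBall z0 (3 / 4 * r)
    · rw [indicator_of_mem hw]
    · rw [indicator_of_notMem hw, kern_zero hk (hspos z hz)]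
      · simp
      · rw [Metric.mem_closedBall, dist_eq_norm, not_le] at hw
        rw [Metric.mem_ball, dist_eq_norm] at hz
        have h1 : ‖w - z0‖ ≤ ‖z - w‖ + ‖z - z0‖ := by
          rw [← norm_sub_rev w z]; exact norm_sub_le_norm_sub_add_norm_sub w z z0
        have := (hs1 z (by rwa [Metric.mem_ball, dist_eq_norm])).2
        linarith
  · intro p x hp hx
    rw [mem_closedBall_zero_iff, not_le] at hx
    have := (hs1 p hp).2
    rw [kern_zero hk (hspos p hp) (by linarith)]
    simp
  · have h1 : ContDiffOn ℝ 1 (fun x : ℂ × ℂ => (s x.1)⁻¹) (Metric.ball z0 (r / 4) ×ˢ univ) := by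
      refine ContDiffOn.inv ?_ fun x hx => (hspos x.1 hx.1).ne'
      exact hsc.comp contDiff_fst.contDiffOn fun x hx => hx.1
    have h2 : ContDiffOn ℝ 1 (fun x : ℂ × ℂ => kern ψ (s x.1) x.2)
        (Metric.ball z0 (r / 4) ×ˢ univ) := by
      unfold kern
      exact (h1.pow 2).mul (hk.smooth.comp_contDiffOn (h1.smul contDiff_snd.contDiffOn))
    exact Complex.ofRealCLM.contDiff.comp_contDiffOn h2

end localest

section twothree
variable {ω φ : ℂ → ℝ} {τ : ℝ → ℝ} {c₁ c₂ : ℝ}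

lemma Fdelta_extract {τC : ℂ → ℝ} {δ M : ℝ} {g : ℂ → ℂ} {z : ℂ} (h0 : 0 < δ * τC z) (hM0 : 0 ≤ M)
    (h : FdeltaSqE τC δ g z ≤ ENNReal.ofReal M) :
    ∃ f : ℂ → ℂ, DifferentiableOn ℂ f (Metric.ball z (δ * τC z)) ∧
      ∫⁻ w in Metric.ball z (δ * τC z), ENNReal.ofReal (‖g w - f w‖ ^ 2) ≤
        ENNReal.ofReal (Real.pi * (M + 1) * (δ * τC z) ^ 2) := by
  have h1 : FdeltaSqE τC δ g z < ENNReal.ofReal (M + 1) :=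
    h.trans_lt ((ENNReal.ofReal_lt_ofReal_iff (by linarith)).2 (by linarith))
  unfold FdeltaSqE at h1
  obtain ⟨f, hf⟩ := iInf_lt_iff.1 h1
  obtain ⟨hfd, hf2⟩ := iInf_lt_iff.1 hf
  refine ⟨f, hfd, ?_⟩
  rw [localMeanE_eq, ← mul_assoc] at hf2
  have hpi := Real.pi_pos
  have e : ENNReal.ofReal (Real.pi * (M + 1) * (δ * τC z) ^ 2) =
      ENNReal.ofReal (M + 1) * ENNReal.ofReal ((δ * τC z) ^ 2 * Real.pi) := by
    rw [← ENNReal.ofReal_mul (by positivity)]; congr 1; ring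
  rw [e]
  have e2 : (ENNReal.ofReal ((δ * τC z) ^ 2))⁻¹ * (ENNReal.ofReal Real.pi)⁻¹ =
      (ENNReal.ofReal ((δ * τC z) ^ 2 * Real.pi))⁻¹ := by
    rw [ENNReal.ofReal_mul (by positivity),
      ENNReal.mul_inv (Or.inr ENNReal.ofReal_ne_top) (Or.inl ENNReal.ofReal_ne_top)]
  rw [e2] at hf2
  rw [← ENNReal.div_le_iff (by simp; positivity) ENNReal.ofReal_ne_top,
    ENNReal.div_eq_inv_mul]
  exact hf2.le

lemma norm_dbar_le (f : ℂ → ℂ) (z : ℂ) : ‖dbar f z‖ ≤ ‖fderiv ℝ f z‖ := by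
  unfold dbar
  rw [norm_div, Complex.norm_ofNat, div_le_iff₀ two_pos]
  refine (norm_add_le _ _).trans ?_
  rw [norm_mul, Complex.norm_I, one_mul]
  have h1 := (fderiv ℝ f z).le_opNorm 1
  have h2 := (fderiv ℝ f z).le_opNorm Complex.I
  rw [norm_one] at h1
  rw [Complex.norm_I] at h2
  linarith

lemma two_imp_three (hW : IsClassW ω φ τ) (hL : IsClassL (radialize τ) c₁ c₂)
    (g : ℂ → ℂ) (hg : MemLp g 2 (muW ω)) {δ M : ℝ} (hδ : δ ∈ Set.Ioo 0 (mTau c₁ c₂))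
    (hM : ∀ z ∈ unitDisc, FdeltaSqE (radialize τ) δ g z ≤ ENNReal.ofReal M) :
    ∃ g₁ g₂ : ℂ → ℂ, (∀ z ∈ unitDisc, g z = g₁ z + g₂ z) ∧
        ContDiffOn ℝ 1 g₂ unitDisc ∧
        (∃ M : ℝ, ∀ z ∈ unitDisc,
          ‖dbar g₂ z‖ / Real.sqrt (laplacian φ z) ≤ M) ∧
        (∃ δ ∈ Set.Ioo 0 (mTau c₁ c₂), ∃ M : ℝ, ∀ z ∈ unitDisc,
          localMeanE (radialize τ) δ g₁ z ≤ ENNReal.ofReal M) := by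
  obtain ⟨hδ0, hδm⟩ := hδ
  obtain ⟨ψ, B, L, hk⟩ := exists_kernData
  obtain ⟨σ, hσc, q, hq, Λ, hΛ, hσ, hσl⟩ := exists_sigma hW hL
  obtain ⟨C, hC, hlap⟩ := lap_bounds hW
  have hpi := Real.pi_pos
  set s : ℂ → ℝ := fun z => δ / 4 * σ z with hs
  set K : ℝ := Real.pi * (max M 0 + 1) with hK
  have hK0 : 0 ≤ K := by positivity
  have hga : AEStronglyMeasurable g (volume.restrict unitDisc) := (aesm_muW_iff hW).1 hg.1
  have htau : ∀ z ∈ unitDisc, 0 < τ ‖z‖ := fun z hz => hL.pos z hz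
  set g₂ := smoothG ψ s g with hg₂
  have hball : ∀ z0 ∈ unitDisc, Metric.ball z0 (δ * τ ‖z0‖) ⊆ unitDisc := by
    intro z0 hz0
    refine (Metric.ball_subset_closedBall.trans (Metric.closedBall_subset_closedBall ?_)).trans
      (closedBall_sub hL hz0)
    have := htau z0 hz0
    gcongr
  have hgeo : ∀ z0 ∈ unitDisc, ∀ z ∈ Metric.ball z0 (δ * τ ‖z0‖ / 4),
      z ∈ unitDisc ∧ 3/4 * τ ‖z0‖ ≤ τ ‖z‖ ∧ τ ‖z‖ ≤ 5/4 * τ ‖z0‖ := by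
    intro z0 hz0 z hz
    have ht := htau z0 hz0
    rw [Metric.mem_ball, dist_eq_norm] at hz
    refine geom hL hz0 ?_
    have : 0 < δ * τ ‖z0‖ := by positivity
    have : δ * τ ‖z0‖ ≤ mTau c₁ c₂ * τ ‖z0‖ := by gcongr
    linarith
  have hs1 : ∀ z0 ∈ unitDisc, ∀ z ∈ Metric.ball z0 (δ * τ ‖z0‖ / 4),
      (3 / 16 * q) * (δ * τ ‖z0‖) ≤ s z ∧ s z ≤ (δ * τ ‖z0‖) / 2 := by
    intro z0 hz0 z hz
    obtain ⟨hzD, h1, h2⟩ := hgeo z0 hz0 z hz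
    obtain ⟨h3, h4⟩ := hσ z hzD
    have ht := htau z0 hz0
    constructor
    · calc (3 / 16 * q) * (δ * τ ‖z0‖) = δ / 4 * (q * (3 / 4 * τ ‖z0‖)) := by ring
        _ ≤ δ / 4 * (q * τ ‖z‖) := by gcongr
        _ ≤ _ := by simp only [hs]; gcongr
    · calc s z ≤ δ / 4 * (5 / 4 * τ ‖z0‖) := by simp only [hs]; gcongr; linarith
        _ ≤ _ := by nlinarith [mul_pos hδ0 ht]
  have hs2 : ∀ z0 ∈ unitDisc, ∀ z ∈ Metric.ball z0 (δ * τ ‖z0‖ / 4),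
      |s z - s z0| ≤ (δ / 4 * Λ) * ‖z - z0‖ := by
    intro z0 hz0 z hz
    have := hσl z (hgeo z0 hz0 z hz).1 z0 hz0
    simp only [hs]
    rw [← mul_sub, abs_mul, abs_of_pos (by positivity), mul_assoc]
    gcongr
  have hsc : ContDiffOn ℝ 1 s unitDisc := contDiffOn_const.mul hσc
  set C1 : ℝ := (K + 4) * B * ((3 / 16 * q)⁻¹) ^ 2 with hC1
  set C2 : ℝ := lipC B L K (3 / 16 * q) (δ / 4 * Λ) with hC2
  have hC20 : 0 ≤ C2 := by
    have := hk.B0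
    have := hk.L0
    simp only [hC2, lipC]; positivity
  have main : ∀ z0 ∈ unitDisc, ∃ h : ℂ → ℂ, DifferentiableOn ℂ h (Metric.ball z0 (δ * τ ‖z0‖)) ∧
      (∫⁻ w in Metric.ball z0 (δ * τ ‖z0‖), ENNReal.ofReal (‖g w - h w‖ ^ 2) ≤
        ENNReal.ofReal (K * (δ * τ ‖z0‖) ^ 2)) ∧
      (∀ z ∈ Metric.ball z0 (δ * τ ‖z0‖ / 4), ‖g₂ z - h z‖ ≤ C1) ∧
      (∀ z ∈ Metric.ball z0 (δ * τ ‖z0‖ / 4), ‖(g₂ z - h z) - (g₂ z0 - h z0)‖ ≤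
        C2 / (δ * τ ‖z0‖) * ‖z - z0‖) ∧
      ContDiffOn ℝ 1 g₂ (Metric.ball z0 (δ * τ ‖z0‖ / 4)) := by
    intro z0 hz0
    have ht := htau z0 hz0
    obtain ⟨h, hh, hu⟩ := Fdelta_extract (τC := radialize τ) (δ := δ) (g := g) (z := z0)
      (M := max M 0) (mul_pos hδ0 ht) (le_max_right _ _)
      ((hM z0 hz0).trans (ENNReal.ofReal_le_ofReal (le_max_left _ _)))
    have hm : AEStronglyMeasurable g (volume.restrict (Metric.ball z0 (δ * τ ‖z0‖))) :=
      hga.mono_measure (Measure.restrict_mono (hball z0 hz0) le_rfl)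
    have h1 := smoothG_est hk (mul_pos hδ0 ht) hK0 (q := 3 / 16 * q) (by positivity)
      (Λ := δ / 4 * Λ) (by positivity) hh hm hu (hs1 z0 hz0) (hs2 z0 hz0)
    have h2 := smoothG_contDiff hk (mul_pos hδ0 ht) hK0 (q := 3 / 16 * q) (by positivity) hh hm hu
      (hs1 z0 hz0) (hsc.mono fun z hz => (hgeo z0 hz0 z hz).1)
    exact ⟨h, hh, hu, h1.1, h1.2, h2⟩
  have hat : ∀ z0 ∈ unitDisc, ContDiffAt ℝ 1 g₂ z0 := by
    intro z0 hz0
    obtain ⟨h, -, -, -, -, h5⟩ := main z0 hz0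
    have ht := htau z0 hz0
    exact h5.contDiffAt (Metric.ball_mem_nhds _ (by positivity))
  refine ⟨fun z => g z - g₂ z, g₂, fun z _ => by simp,
    fun z hz => (hat z hz).contDiffWithinAt, ⟨C2 / δ * Real.sqrt C, ?_⟩,
    ⟨δ / 4, ⟨by positivity, by linarith⟩, (32 * K + 8 * C1 ^ 2) / Real.pi, ?_⟩⟩
  · intro z0 hz0
    obtain ⟨h, hh, -, -, h4, -⟩ := main z0 hz0
    have ht := htau z0 hz0
    have hr : 0 < δ * τ ‖z0‖ := by positivity
    have hd : DifferentiableAt ℂ h z0 := hh.differentiableAt (Metric.ball_mem_nhds _ hr)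
    have hdR : DifferentiableAt ℝ h z0 := hd.restrictScalars ℝ
    have hgd : DifferentiableAt ℝ g₂ z0 := (hat z0 hz0).differentiableAt (by norm_num)
    have e1 : dbar (fun z => g₂ z - h z) z0 = dbar g₂ z0 := by
      have hz : dbar h z0 = 0 := by
        unfold dbar
        rw [hd.fderiv_restrictScalars ℝ]
        have : (fderiv ℂ h z0) Complex.I = Complex.I * fderiv ℂ h z0 1 := by
          rw [← smul_eq_mul, ← map_smul]; simp
        simp only [ContinuousLinearMap.coe_restrictScalars']
        rw [this, ← mul_assoc, Complex.I_mul_I]; ring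
      have : dbar (fun z => g₂ z - h z) z0 = dbar g₂ z0 - dbar h z0 := by
        unfold dbar
        rw [fderiv_fun_sub hgd hdR]
        simp only [_root_.sub_apply]
        ring
      rw [this, hz, sub_zero]
    have hn : ‖dbar g₂ z0‖ ≤ C2 / (δ * τ ‖z0‖) := by
      rw [← e1]
      refine (norm_dbar_le _ _).trans ?_
      refine norm_fderiv_le_of_lip' ℝ (by positivity) ?_
      filter_upwards [Metric.ball_mem_nhds z0 (show 0 < δ * τ ‖z0‖ / 4 by positivity)] with z hz
      exact h4 z hz
    have hl := (hlap z0 hz0).1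
    have hlp := hW.lap_pos z0 hz0
    have hsq : 1 / (Real.sqrt C * τ ‖z0‖) ≤ Real.sqrt (laplacian φ z0) := by
      apply Real.le_sqrt_of_sq_le
      rw [div_pow, mul_pow, Real.sq_sqrt (by linarith), one_pow]
      exact hl
    have hsC : 0 < Real.sqrt C := Real.sqrt_pos.2 (by linarith)
    rw [div_le_iff₀ (Real.sqrt_pos.2 hlp)]
    calc ‖dbar g₂ z0‖ ≤ C2 / (δ * τ ‖z0‖) := hn
      _ = C2 / δ * Real.sqrt C * (1 / (Real.sqrt C * τ ‖z0‖)) := by field_simp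
      _ ≤ _ := by gcongr
  · intro z0 hz0
    obtain ⟨h, hh, hu, h3, -, -⟩ := main z0 hz0
    have ht := htau z0 hz0
    have hr : 0 < δ * τ ‖z0‖ := by positivity
    have hrad : δ / 4 * radialize τ z0 = δ * τ ‖z0‖ / 4 := by unfold radialize; ring
    have hb : ∫⁻ w in Metric.ball z0 (δ / 4 * radialize τ z0), ENNReal.ofReal (‖g w - g₂ w‖ ^ 2) ≤
        ENNReal.ofReal ((32 * K + 8 * C1 ^ 2) * (δ / 4 * radialize τ z0) ^ 2) := by
      rw [hrad]
      calc _ ≤ ∫⁻ w in Metric.ball z0 (δ * τ ‖z0‖ / 4),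
            (ENNReal.ofReal 2 * ENNReal.ofReal (‖g w - h w‖ ^ 2) + ENNReal.ofReal (2 * C1 ^ 2)) := by
            refine setLIntegral_mono' Metric.isOpen_ball.measurableSet fun w hw => ?_
            rw [← ENNReal.ofReal_mul (by norm_num),
              ← ENNReal.ofReal_add (by positivity) (by positivity)]
            apply ENNReal.ofReal_le_ofReal
            have h5 := h3 w hw
            have h6 : ‖g w - g₂ w‖ ≤ ‖g w - h w‖ + ‖g₂ w - h w‖ := by
              rw [norm_sub_rev (g₂ w) (h w)]
              exact norm_sub_le_norm_sub_add_norm_sub (g w) (h w) (g₂ w)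
            have h7 := norm_nonneg (g w - g₂ w)
            have h8 := norm_nonneg (g w - h w)
            have h9 := norm_nonneg (g₂ w - h w)
            have h10 : ‖g w - g₂ w‖ ^ 2 ≤ (‖g w - h w‖ + C1) ^ 2 := by gcongr; linarith
            nlinarith [sq_nonneg (‖g w - h w‖ - C1)]
        _ = ENNReal.ofReal 2 * (∫⁻ w in Metric.ball z0 (δ * τ ‖z0‖ / 4),
              ENNReal.ofReal (‖g w - h w‖ ^ 2)) +
              ENNReal.ofReal (2 * C1 ^ 2) * volume (Metric.ball z0 (δ * τ ‖z0‖ / 4)) := by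
            rw [lintegral_add_right _ measurable_const,
              lintegral_const_mul' _ _ ENNReal.ofReal_ne_top]; simp
        _ ≤ ENNReal.ofReal 2 * ENNReal.ofReal (K * (δ * τ ‖z0‖) ^ 2) +
              ENNReal.ofReal (2 * C1 ^ 2) * ENNReal.ofReal (4 * (δ * τ ‖z0‖ / 4) ^ 2) := by
            refine add_le_add (mul_le_mul' le_rfl
              ((lintegral_mono_set (Metric.ball_subset_ball (by linarith))).trans hu))
              (mul_le_mul' le_rfl ?_)
            rw [Complex.volume_ball, ← ENNReal.ofReal_pow (by positivity),
              ← ENNReal.ofReal_coe_nnreal, ← ENNReal.ofReal_mul (by positivity)]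
            apply ENNReal.ofReal_le_ofReal
            have := Real.pi_le_four
            rw [NNReal.coe_real_pi]
            nlinarith [sq_nonneg (δ * τ ‖z0‖ / 4)]
        _ = _ := by
            rw [← ENNReal.ofReal_mul (by norm_num), ← ENNReal.ofReal_mul (by positivity),
              ← ENNReal.ofReal_add (by positivity) (by positivity)]
            congr 1
            ring
    refine (localMeanE_le (u := fun w => g w - g₂ w) (by rw [hrad]; positivity) hb).trans
      (le_of_eq ?_)
    congr 1
    rw [hrad]
    field_simp

end twothree

theorem stmt3 (ω φ : ℂ → ℝ) (τ : ℝ → ℝ) (c₁ c₂ : ℝ)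
    (hW : IsClassW ω φ τ) (hL : IsClassL (radialize τ) c₁ c₂)
    (g : ℂ → ℂ) (hg : MemLp g 2 (muW ω)) :
    ((∃ T : bergmanH ω →L[ℂ] Lp ℂ 2 (muW ω), IsHankelExtension ω g T) ↔
      (∃ δ ∈ Set.Ioo 0 (mTau c₁ c₂), ∃ M : ℝ, ∀ z ∈ unitDisc,
        FdeltaSqE (radialize τ) δ g z ≤ ENNReal.ofReal M)) ∧
    ((∃ δ ∈ Set.Ioo 0 (mTau c₁ c₂), ∃ M : ℝ, ∀ z ∈ unitDisc,
        FdeltaSqE (radialize τ) δ g z ≤ ENNReal.ofReal M) ↔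
      (∃ g₁ g₂ : ℂ → ℂ, (∀ z ∈ unitDisc, g z = g₁ z + g₂ z) ∧
        ContDiffOn ℝ 1 g₂ unitDisc ∧
        (∃ M : ℝ, ∀ z ∈ unitDisc,
          ‖dbar g₂ z‖ / Real.sqrt (laplacian φ z) ≤ M) ∧
        (∃ δ ∈ Set.Ioo 0 (mTau c₁ c₂), ∃ M : ℝ, ∀ z ∈ unitDisc,
          localMeanE (radialize τ) δ g₁ z ≤ ENNReal.ofReal M))) := by
  refine ⟨⟨?_, ?_⟩, ⟨?_, ?_⟩⟩
  · rintro ⟨T, hT⟩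
    exact one_imp_two hW hL g hg T hT
  · rintro ⟨δ, hδ, M, hM⟩
    obtain ⟨g₁, g₂, hdec, hsm, ⟨M1, hM1⟩, ⟨δ', hδ', M2, hM2⟩⟩ := two_imp_three hW hL g hg hδ hM
    exact three_imp_one hW hL g hg g₁ g₂ hdec hsm hM1 hδ' hM2
  · rintro ⟨δ, hδ, M, hM⟩
    exact two_imp_three hW hL g hg hδ hM
  · rintro ⟨g₁, g₂, hdec, hsm, ⟨M1, hM1⟩, ⟨δ', hδ', M2, hM2⟩⟩
    obtain ⟨T, hT⟩ := three_imp_one hW hL g hg g₁ g₂ hdec hsm hM1 hδ' hM2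
    exact one_imp_two hW hL g hg T hT

end
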